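/- arXiv:1704.07440 — 4 statements merged into one kernel-verified Lean document; each statement's English description precedes it below -/
import Mathlib

section
/- Let n₀ be a non-zero integer and N a positive integer. There are only finitely many natural numbers m such that 2^m + n₀ = u·y² for some square-free divisor u of 2N and some integer y. -/
namespace RN

open Finset

/-- exponent `2(i+j-b)+1` -/
def ee (b i j : ℕ) : ℤ := 2 * ((i : ℤ) + j - b) + 1

lemma ee_ne (b i j : ℕ) : ee b i j ≠ 0 := by unfold ee; omega

lemma ee_abs (b i j : ℕ) : (1 : ℝ) ≤ |(ee b i j : ℝ)| := by
  have := Int.one_le_abs (ee_ne b i j)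
  exact_mod_cast this

/-- antiderivative of `s^(-2b) (s^2-W)^b (1-s^2)^a` -/
noncomputable def F (a b : ℕ) (W s : ℝ) : ℝ :=
  ∑ i ∈ range (b + 1), ∑ j ∈ range (a + 1),
    ((b.choose i : ℝ) * (a.choose j : ℝ) * (-1) ^ j * (-W) ^ (b - i)) *
      (s ^ (ee b i j) / (ee b i j : ℝ))

noncomputable def Q (a b : ℕ) (W : ℝ) : ℝ :=
  ∑ i ∈ range (b + 1), ∑ j ∈ range (a + 1),
    ((b.choose i : ℝ) * (a.choose j : ℝ) * (-1) ^ j * (-1) ^ (b - i)) *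
      (W ^ j / (ee b i j : ℝ))

lemma F_deriv (a b : ℕ) (W s : ℝ) (hs : 0 < s) :
    HasDerivAt (F a b W) ((s ^ (2 * b))⁻¹ * (s ^ 2 - W) ^ b * (1 - s ^ 2) ^ a) s := by
  have h1 : HasDerivAt (F a b W)
      (∑ i ∈ range (b + 1), ∑ j ∈ range (a + 1),
        ((b.choose i : ℝ) * (a.choose j : ℝ) * (-1) ^ j * (-W) ^ (b - i)) *
          (((ee b i j : ℝ) * s ^ (ee b i j - 1)) / (ee b i j : ℝ))) s := by
    unfold F
    apply HasDerivAt.fun_sum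
    intro i _
    apply HasDerivAt.fun_sum
    intro j _
    apply HasDerivAt.const_mul
    apply HasDerivAt.div_const
    exact hasDerivAt_zpow _ _ (Or.inl hs.ne')
  convert h1 using 1
  have e1 : (s ^ 2 - W) ^ b = ∑ i ∈ range (b + 1), (s ^ 2) ^ i * (-W) ^ (b - i) * (b.choose i : ℝ) := by
    rw [sub_eq_add_neg, add_pow]
  have e2 : (1 - s ^ 2) ^ a = ∑ j ∈ range (a + 1), (-s ^ 2) ^ j * (a.choose j : ℝ) := by
    rw [sub_eq_add_neg, add_comm, add_pow]
    simp
  rw [e1, e2, mul_assoc, Finset.sum_mul_sum, Finset.mul_sum]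
  refine Finset.sum_congr rfl fun i _ => ?_
  rw [Finset.mul_sum]
  refine Finset.sum_congr rfl fun j _ => ?_
  have he : (ee b i j : ℝ) ≠ 0 := by exact_mod_cast ee_ne b i j
  rw [mul_div_cancel_left₀ _ he]
  have : s ^ (ee b i j - 1) = (s ^ (2 * b))⁻¹ * (s ^ 2) ^ i * (s ^ 2) ^ j := by
    rw [← pow_mul, ← pow_mul, ← zpow_natCast, ← zpow_natCast, ← zpow_natCast, ← zpow_neg,
      ← zpow_add₀ hs.ne', ← zpow_add₀ hs.ne']
    congr 1
    unfold ee; push_cast; ring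
  rw [this, neg_pow (s ^ 2)]
  ring

lemma F_sqrt (a b : ℕ) (W f : ℝ) (hf : 0 < f) (hW : f ^ 2 = W) : F a b W f = f * Q a b W := by
  unfold F Q
  rw [Finset.mul_sum]
  refine Finset.sum_congr rfl fun i hi => ?_
  rw [Finset.mul_sum]
  refine Finset.sum_congr rfl fun j _ => ?_
  have hi' : i ≤ b := by simpa [Nat.lt_succ_iff] using hi
  have : W ^ (b - i) * f ^ (ee b i j) = f * W ^ j := by
    rw [← hW, ← pow_mul, ← pow_mul, ← zpow_natCast, ← zpow_natCast, ← zpow_add₀ hf.ne',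
      ← zpow_one_add₀ hf.ne']
    congr 1
    unfold ee; push_cast [Nat.cast_sub hi']; ring
  rw [neg_pow W]
  calc _ = ((b.choose i : ℝ) * (a.choose j : ℝ) * (-1) ^ j * (-1) ^ (b - i)) / (ee b i j : ℝ)
          * (W ^ (b - i) * f ^ (ee b i j)) := by ring
    _ = _ := by rw [this]; ring

lemma R_bound (a b : ℕ) (W f z : ℝ) (hf : 0 < f) (hW : f ^ 2 = W) (hz : |1 - W| = z)
    (hz2 : z ≤ 1 / 2) : |F a b W 1 - F a b W f| ≤ 2 ^ b * z ^ (a + b + 1) := by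
  have hz0 : 0 ≤ z := hz ▸ abs_nonneg _
  have hzz := abs_le.1 hz.le
  have hf1 : |1 - f| ≤ z := by
    have : |1 - W| = |1 - f| * (1 + f) := by
      rw [← hW, show (1 - f ^ 2) = (1 - f) * (1 + f) by ring, abs_mul, abs_of_pos (by linarith : 0 < 1 + f)]
    nlinarith [abs_nonneg (1 - f)]
  have key : ∀ s ∈ Set.uIcc f 1, 0 < s ∧
      |(s ^ (2 * b))⁻¹ * (s ^ 2 - W) ^ b * (1 - s ^ 2) ^ a| ≤ 2 ^ b * z ^ (a + b) := by
    intro s hs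
    have hs' : 0 < s ∧ |s ^ 2 - W| ≤ z ∧ |1 - s ^ 2| ≤ z := by
      rcases Set.mem_uIcc.1 hs with ⟨h1, h2⟩ | ⟨h1, h2⟩
      · refine ⟨by linarith, ?_, ?_⟩ <;> rw [abs_le] <;> constructor <;> nlinarith
      · refine ⟨by linarith, ?_, ?_⟩ <;> rw [abs_le] <;> constructor <;> nlinarith
    obtain ⟨h0, h1, h2⟩ := hs'
    refine ⟨h0, ?_⟩
    rw [abs_mul, abs_mul, abs_pow, abs_pow, abs_inv, abs_of_pos (by positivity : 0 < s ^ (2 * b)),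
      pow_mul, ← inv_pow]
    have h3 : (s ^ 2)⁻¹ ≤ 2 := by
      have := abs_le.1 h2
      rw [inv_le_comm₀ (by positivity) (by norm_num)]
      linarith
    calc _ ≤ 2 ^ b * z ^ b * z ^ a := by gcongr
      _ = _ := by ring
  have := Convex.norm_image_sub_le_of_norm_hasDerivWithin_le (f := F a b W)
    (f' := fun s => (s ^ (2 * b))⁻¹ * (s ^ 2 - W) ^ b * (1 - s ^ 2) ^ a)
    (s := Set.uIcc f 1) (C := 2 ^ b * z ^ (a + b)) (x := f) (y := 1)
    (fun s hs => (F_deriv a b W s (key s hs).1).hasDerivWithinAt)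
    (fun s hs => (key s hs).2) (convex_uIcc _ _) Set.left_mem_uIcc Set.right_mem_uIcc
  simp only [Real.norm_eq_abs] at this
  calc _ ≤ _ := this
    _ ≤ 2 ^ b * z ^ (a + b) * z := by gcongr
    _ = _ := by ring

lemma beta_sum (a : ℕ) : ∀ (x : ℝ), (∀ j : ℕ, x + 2 * j ≠ 0) →
    ∑ j ∈ range (a + 1), (a.choose j : ℝ) * (-1) ^ j / (x + 2 * j) =
      2 ^ a * a.factorial / ∏ j ∈ range (a + 1), (x + 2 * j) := by
  induction a with
  | zero => intro x hx; simp
  | succ a ih =>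
    intro x hx
    have hx2 : ∀ j : ℕ, (x + 2) + 2 * j ≠ 0 := by
      intro j; have := hx (j + 1); push_cast at this; convert this using 1; ring
    have step : ∑ j ∈ range (a + 1 + 1), ((a + 1).choose j : ℝ) * (-1) ^ j / (x + 2 * j) =
        ∑ j ∈ range (a + 1), (a.choose j : ℝ) * (-1) ^ j / (x + 2 * j) -
        ∑ j ∈ range (a + 1), (a.choose j : ℝ) * (-1) ^ j / ((x + 2) + 2 * j) := by
      rw [Finset.sum_range_succ']
      have h2 : ∑ j ∈ range (a + 1), (a.choose j : ℝ) * (-1) ^ j / (x + 2 * j) =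
        ∑ j ∈ range (a + 1), (a.choose (j + 1) : ℝ) * (-1) ^ (j + 1) / (x + 2 * (j + 1 : ℕ))
          + 1 / x := by
        have := Finset.sum_range_succ' (fun j : ℕ => (a.choose j : ℝ) * (-1) ^ j / (x + 2 * j)) (a + 1)
        rw [Finset.sum_range_succ] at this
        simpa using this
      rw [h2]
      have h3 : ∀ j ∈ range (a + 1), ((a + 1).choose (j + 1) : ℝ) * (-1) ^ (j + 1) / (x + 2 * (j + 1 : ℕ)) =
        (a.choose (j + 1) : ℝ) * (-1) ^ (j + 1) / (x + 2 * (j + 1 : ℕ)) -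
          (a.choose j : ℝ) * (-1) ^ j / ((x + 2) + 2 * j) := by
        intro j _
        rw [Nat.choose_succ_succ]
        have : x + 2 * ((j + 1 : ℕ) : ℝ) = (x + 2) + 2 * j := by push_cast; ring
        rw [this]; push_cast; ring
      rw [Finset.sum_congr rfl h3, Finset.sum_sub_distrib]
      simp; ring
    rw [step, ih x hx, ih (x + 2) hx2]
    have p1 : ∏ j ∈ range (a + 1 + 1), (x + 2 * (j : ℝ)) =
        (∏ j ∈ range (a + 1), (x + 2 * (j : ℝ))) * (x + 2 * (a + 1)) := by
      rw [Finset.prod_range_succ]; push_cast; rfl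
    have p2 : ∏ j ∈ range (a + 1 + 1), (x + 2 * (j : ℝ)) =
        (∏ j ∈ range (a + 1), ((x + 2) + 2 * (j : ℝ))) * x := by
      rw [Finset.prod_range_succ']
      congr 1
      · refine Finset.prod_congr rfl fun j _ => ?_
        push_cast; ring
      · simp
    have n1 : (∏ j ∈ range (a + 1), (x + 2 * (j : ℝ))) ≠ 0 := Finset.prod_ne_zero_iff.2 fun j _ => hx j
    have n2 : (∏ j ∈ range (a + 1), ((x + 2) + 2 * (j : ℝ))) ≠ 0 :=
      Finset.prod_ne_zero_iff.2 fun j _ => hx2 j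
    have n3 : x + 2 * ((a : ℝ) + 1) ≠ 0 := by have := hx (a + 1); push_cast at this; exact this
    have n4 : x ≠ 0 := by simpa using hx 0
    set A := ∏ j ∈ range (a + 1), (x + 2 * (j : ℝ))
    set B := ∏ j ∈ range (a + 1), ((x + 2) + 2 * (j : ℝ))
    rw [p1]
    have hAB : A * (x + 2 * (a + 1)) = B * x := by rw [← p1, p2]
    rw [Nat.factorial_succ, div_sub_div _ _ n1 n2, div_eq_div_iff (mul_ne_zero n1 n2) (mul_ne_zero n1 n3)]
    push_cast
    linear_combination (2 ^ a * (a.factorial : ℝ) * (-A)) * hAB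

lemma odd_ne (x : ℤ) (j : ℕ) : ((1 - 2 * x : ℤ) : ℝ) + 2 * j ≠ 0 := by
  have : (1 - 2 * x) + 2 * (j : ℤ) ≠ 0 := by omega
  exact_mod_cast this

lemma F_one (a b : ℕ) (W : ℝ) : F a b W 1 = ∑ i ∈ range (b + 1),
    (b.choose i : ℝ) * W ^ (b - i) * ((-1) ^ (b - i) * (2 ^ a * a.factorial /
      ∏ j ∈ range (a + 1), (((1 - 2 * ((b - i : ℕ) : ℤ) : ℤ) : ℝ) + 2 * j))) := by
  unfold F
  refine Finset.sum_congr rfl fun i hi => ?_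
  have hi' : i ≤ b := by simpa [Nat.lt_succ_iff] using hi
  rw [← beta_sum a _ (odd_ne _), Finset.mul_sum, Finset.mul_sum]
  refine Finset.sum_congr rfl fun j _ => ?_
  have : ((1 - 2 * ((b - i : ℕ) : ℤ) : ℤ) : ℝ) + 2 * j = (ee b i j : ℝ) := by
    unfold ee; push_cast [Nat.cast_sub hi']; ring
  rw [this, neg_pow W, one_zpow]
  ring

lemma prod_sign (a t : ℕ) (h : t ≤ a) :
    0 < (-1 : ℝ) ^ t * ∏ j ∈ range (a + 1), (((1 - 2 * (t : ℤ) : ℤ) : ℝ) + 2 * j) := by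
  obtain ⟨c, hc⟩ : ∃ c, a + 1 = t + c := ⟨a + 1 - t, by omega⟩
  rw [hc, Finset.prod_range_add, ← mul_assoc]
  have : (-1 : ℝ) ^ t = ∏ j ∈ range t, (-1 : ℝ) := by simp
  rw [this, ← Finset.prod_mul_distrib]
  apply mul_pos
  · apply Finset.prod_pos
    intro j hj
    have : (j : ℝ) + 1 ≤ t := by exact_mod_cast Finset.mem_range.1 hj
    push_cast; linarith
  · apply Finset.prod_pos
    intro j hj
    push_cast
    have : (0 : ℝ) ≤ j := by positivity
    linarith

lemma prod_le (a : ℕ) : ∏ j ∈ range (a + 1), ((1 : ℝ) + 2 * j) ≤ 4 ^ a * a.factorial := by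
  induction a with
  | zero => simp
  | succ a ih =>
    rw [Finset.prod_range_succ, Nat.factorial_succ]
    push_cast
    calc _ ≤ 4 ^ a * (a.factorial : ℝ) * (1 + 2 * (a + 1)) := by gcongr
      _ ≤ 4 ^ a * (a.factorial : ℝ) * (4 * (a + 1)) := by gcongr; linarith [(Nat.cast_nonneg a : (0 : ℝ) ≤ a)]
      _ = _ := by ring

lemma P_lower (a b : ℕ) (W : ℝ) (hW : 0 < W) (hab : b ≤ a) : 1 ≤ 2 ^ a * F a b W 1 := by
  have h1 : (2 ^ a * a.factorial / ∏ j ∈ range (a + 1), ((1 : ℝ) + 2 * j)) ≤ F a b W 1 := by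
    rw [F_one]
    have := Finset.single_le_sum (s := range (b + 1)) (f := fun i => (b.choose i : ℝ) * W ^ (b - i) * ((-1) ^ (b - i) * (2 ^ a * a.factorial /
      ∏ j ∈ range (a + 1), (((1 - 2 * ((b - i : ℕ) : ℤ) : ℤ) : ℝ) + 2 * j)))) (a := b) ?_ (by simp)
    · simpa using this
    · intro i hi
      have hp := prod_sign a (b - i) (by omega)
      have : ((-1 : ℝ) ^ (b - i) * (2 ^ a * a.factorial /
        ∏ j ∈ range (a + 1), (((1 - 2 * ((b - i : ℕ) : ℤ) : ℤ) : ℝ) + 2 * j))) =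
        2 ^ a * a.factorial / ((-1 : ℝ) ^ (b - i) * ∏ j ∈ range (a + 1), (((1 - 2 * ((b - i : ℕ) : ℤ) : ℤ) : ℝ) + 2 * j)) := by
        have hs : ((-1 : ℝ) ^ (b - i)) = ((-1 : ℝ) ^ (b - i))⁻¹ := by
          rcases neg_one_pow_eq_or ℝ (b - i) with h | h <;> rw [h] <;> norm_num
        conv_lhs => rw [hs]
        rw [← div_div, div_eq_mul_inv _ ((-1 : ℝ) ^ (b - i))]
        ring
      simp only [this]
      positivity
  have hpos : (0 : ℝ) < ∏ j ∈ range (a + 1), ((1 : ℝ) + 2 * j) :=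
    Finset.prod_pos fun j _ => by positivity
  have h2 : (1 : ℝ) ≤ 2 ^ a * (2 ^ a * a.factorial / ∏ j ∈ range (a + 1), ((1 : ℝ) + 2 * j)) := by
    rw [← mul_div_assoc, one_le_div hpos]
    calc _ ≤ _ := prod_le a
      _ = _ := by rw [← mul_assoc, ← mul_pow]; norm_num
  calc _ ≤ _ := h2
    _ ≤ _ := by gcongr

lemma P_upper (a b : ℕ) (W : ℝ) (hW : 0 < W) (hW2 : W ≤ 2) : F a b W 1 ≤ 2 ^ (a + 2 * b) := by
  have : F a b W 1 ≤ ∑ i ∈ range (b + 1), ∑ j ∈ range (a + 1),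
      (b.choose i : ℝ) * (a.choose j : ℝ) * 2 ^ b := by
    unfold F
    refine Finset.sum_le_sum fun i hi => Finset.sum_le_sum fun j hj => ?_
    refine (le_abs_self _).trans ?_
    rw [abs_mul, abs_mul, abs_mul, abs_pow, abs_pow, abs_neg, abs_neg, one_zpow, abs_div, abs_one, one_pow,
      abs_mul, Nat.abs_cast, Nat.abs_cast, abs_of_pos hW]
    have h1 : 1 / |(ee b i j : ℝ)| ≤ 1 := by
      rw [div_le_one (lt_of_lt_of_le one_pos (ee_abs b i j))]; exact ee_abs b i j
    have h2 : W ^ (b - i) ≤ 2 ^ b := by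
      calc W ^ (b - i) ≤ 2 ^ (b - i) := by gcongr
        _ ≤ 2 ^ b := pow_le_pow_right₀ (by norm_num) (Nat.sub_le b i)
    calc _ ≤ (b.choose i : ℝ) * (a.choose j : ℝ) * 1 * 2 ^ b * 1 := by gcongr
      _ = _ := by ring
  refine this.trans (le_of_eq ?_)
  simp_rw [← Finset.sum_mul]
  rw [← Finset.sum_mul_sum]
  have e1 : ∑ i ∈ range (b + 1), (b.choose i : ℝ) = 2 ^ b := by exact_mod_cast Nat.sum_range_choose b
  have e2 : ∑ i ∈ range (a + 1), (a.choose i : ℝ) = 2 ^ a := by exact_mod_cast Nat.sum_range_choose a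
  rw [e1, e2]; ring

lemma lcm_bound (n : ℕ) : (Nat.lcmUpto n : ℝ) ≤ 2 ^ (10 * n) := by
  have h1 := Chebyshev.psi_le_const_mul_self (x := (n : ℝ)) (by positivity)
  rw [Chebyshev.psi_eq_log_lcmUpto] at h1
  have h0 : (0 : ℝ) < Nat.lcmUpto n := by exact_mod_cast Nat.lcmUpto_pos n
  rw [← Real.log_le_log_iff h0 (by positivity), Real.log_pow]
  refine h1.trans ?_
  have : Real.log 4 = 2 * Real.log 2 := by
    rw [show (4 : ℝ) = 2 ^ 2 by norm_num, Real.log_pow]; norm_num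
  have h2 := Real.log_two_gt_d9
  have h3 : (0 : ℝ) ≤ n := by positivity
  rw [this]; push_cast
  nlinarith

lemma ee_dvd (a b i j : ℕ) (hab : b ≤ a) (hi : i ≤ b) (hj : j ≤ a) :
    ∃ q : ℤ, (Nat.lcmUpto (2 * a + 1) : ℝ) / (ee b i j : ℝ) = q := by
  have h1 : (ee b i j).natAbs ∣ Nat.lcmUpto (2 * a + 1) := by
    unfold Nat.lcmUpto
    have : (ee b i j).natAbs ∈ Finset.Icc 1 (2 * a + 1) := by
      rw [Finset.mem_Icc]; unfold ee; omega
    exact Finset.dvd_lcm (f := id) this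
  obtain ⟨q, hq⟩ := Int.natAbs_dvd.1 (Int.natCast_dvd_natCast.2 h1)
  refine ⟨q, ?_⟩
  have he : (ee b i j : ℝ) ≠ 0 := by exact_mod_cast ee_ne b i j
  rw [div_eq_iff he]
  have : ((Nat.lcmUpto (2 * a + 1) : ℤ) : ℝ) = ((ee b i j * q : ℤ) : ℝ) := by rw [hq]
  push_cast at this
  rw [this]; ring

lemma lam_int (a b m0 k : ℕ) (u y0 y : ℤ) (hab : b ≤ a) (hk : m0 * a ≤ m0 * b + k) (W : ℝ)
    (hW : W = (u : ℝ) * (y0 : ℝ) ^ 2 / 2 ^ m0) :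
    ∃ Z : ℤ, (Z : ℝ) = (Nat.lcmUpto (2 * a + 1) : ℝ) * 2 ^ (m0 * b) *
      (y * F a b W 1 - y0 * 2 ^ k * Q a b W) := by
  have hI : ∀ z : ℤ, (z : ℝ) ∈ (Int.castRingHom ℝ).range := fun z => ⟨z, by simp⟩
  suffices h : (Nat.lcmUpto (2 * a + 1) : ℝ) * 2 ^ (m0 * b) *
      (y * F a b W 1 - y0 * 2 ^ k * Q a b W) ∈ (Int.castRingHom ℝ).range by
    obtain ⟨Z, hZ⟩ := h
    exact ⟨Z, by simpa using hZ⟩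
  have h20 : (2 : ℝ) ^ m0 ≠ 0 := by positivity
  have hW' : 2 ^ m0 * W = (u : ℝ) * (y0 : ℝ) ^ 2 := by rw [hW]; field_simp
  rw [mul_sub]
  apply sub_mem
  · unfold F
    simp only [Finset.mul_sum]
    refine sum_mem fun i hi => sum_mem fun j hj => ?_
    have hi' : i ≤ b := by simpa [Nat.lt_succ_iff] using hi
    have hj' : j ≤ a := by simpa [Nat.lt_succ_iff] using hj
    obtain ⟨q, hq⟩ := ee_dvd a b i j hab hi' hj'
    have e : (2 : ℝ) ^ (m0 * b) * (-W) ^ (b - i) = 2 ^ (m0 * i) * (-(u * y0 ^ 2)) ^ (b - i) := by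
      rw [← hW', ← mul_neg, mul_pow, ← pow_mul, ← mul_assoc, ← pow_add, ← mul_add,
        Nat.add_sub_cancel' hi']
    convert hI (y * (b.choose i) * (a.choose j) * (-1) ^ j * (2 ^ (m0 * i) * (-(u * y0 ^ 2)) ^ (b - i)) * q) using 1
    push_cast
    rw [← hq, ← e, one_zpow]
    ring
  · unfold Q
    simp only [Finset.mul_sum]
    refine sum_mem fun i hi => sum_mem fun j hj => ?_
    have hi' : i ≤ b := by simpa [Nat.lt_succ_iff] using hi
    have hj' : j ≤ a := by simpa [Nat.lt_succ_iff] using hj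
    obtain ⟨q, hq⟩ := ee_dvd a b i j hab hi' hj'
    have hle : m0 * j ≤ m0 * b + k := (Nat.mul_le_mul_left _ hj').trans hk
    have e : (2 : ℝ) ^ (m0 * b) * 2 ^ k * W ^ j = 2 ^ (m0 * b + k - m0 * j) * (u * y0 ^ 2) ^ j := by
      rw [← hW', mul_pow, ← pow_mul, ← pow_add, ← mul_assoc, ← pow_add, Nat.sub_add_cancel hle]
    convert hI (y0 * (b.choose i) * (a.choose j) * (-1) ^ j * (-1) ^ (b - i) * (2 ^ (m0 * b + k - m0 * j) * (u * y0 ^ 2) ^ j) * q) using 1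
    push_cast
    rw [← hq, ← e]
    ring

set_option maxHeartbeats 2000000 in
lemma key (n0 u y0 y : ℤ) (h m0 k : ℕ) (hn : n0 ≠ 0) (hh : |n0| ≤ 2 ^ h) (hu : 1 ≤ u)
    (hy0 : 1 ≤ y0) (hy : 1 ≤ y) (h0 : 2 ^ m0 + n0 = u * y0 ^ 2)
    (h1 : 2 ^ (m0 + 2 * k) + n0 = u * y ^ 2) (hm0 : 200 + 11 * h ≤ m0) (hk : 32 * m0 ≤ k) :
    False := by
  obtain ⟨d, hd8, hd1, hd2⟩ : ∃ d, 8 ≤ d ∧ 4 * d * m0 ≤ k ∧ k < 4 * (d + 1) * m0 := by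
    have hm : 0 < 4 * m0 := by omega
    refine ⟨k / (4 * m0), ?_, ?_, ?_⟩
    · rw [Nat.le_div_iff_mul_le hm]; omega
    · have := Nat.div_mul_le_self k (4 * m0); nlinarith
    · have := Nat.lt_div_mul_add (a := k) hm; nlinarith
  set W : ℝ := (u : ℝ) * (y0 : ℝ) ^ 2 / 2 ^ m0 with hW
  set z : ℝ := |(n0 : ℝ)| / 2 ^ m0 with hzdef
  have hnR1 : (1 : ℝ) ≤ |(n0 : ℝ)| := by exact_mod_cast Int.one_le_abs hn
  have hnR2 : |(n0 : ℝ)| ≤ 2 ^ h := by exact_mod_cast hh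
  have h0R : (2 : ℝ) ^ m0 + n0 = u * (y0 : ℝ) ^ 2 := by exact_mod_cast h0
  have h1R : (2 : ℝ) ^ (m0 + 2 * k) + n0 = u * (y : ℝ) ^ 2 := by exact_mod_cast h1
  have huR : (1 : ℝ) ≤ u := by exact_mod_cast hu
  have hy0R : (1 : ℝ) ≤ y0 := by exact_mod_cast hy0
  have hyR : (1 : ℝ) ≤ y := by exact_mod_cast hy
  have hWz : |1 - W| = z := by
    have : 1 - W = - (n0 : ℝ) / 2 ^ m0 := by rw [hW, ← h0R]; field_simp; ring
    rw [this, abs_div, abs_neg, abs_of_pos (by positivity : (0 : ℝ) < 2 ^ m0)]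
  have hz1 : z ≤ 2 ^ h / 2 ^ m0 := by rw [hzdef]; gcongr
  have hz2 : z ≤ 1 / 2 := by
    refine hz1.trans ?_
    rw [div_le_div_iff₀ (by positivity) (by norm_num), ← pow_succ, one_mul]
    gcongr
    · norm_num
    · omega
  have hWpos : 0 < W := by rw [hW]; positivity
  have hW2 : W ≤ 2 := by have := abs_le.1 hWz.le; linarith
  set f := Real.sqrt W with hf
  have hfpos : 0 < f := Real.sqrt_pos.2 hWpos
  have hf2 : f ^ 2 = W := Real.sq_sqrt hWpos.le
  -- g = y f / (y0 2^k)
  set g : ℝ := y * f / (y0 * 2 ^ k) with hg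
  have hgpos : 0 < g := by rw [hg]; positivity
  have hg2 : g ^ 2 = 1 + n0 / 2 ^ (m0 + 2 * k) := by
    rw [hg, div_pow, mul_pow, hf2, hW]
    have : 1 + (n0 : ℝ) / 2 ^ (m0 + 2 * k) = u * (y : ℝ) ^ 2 / 2 ^ (m0 + 2 * k) := by
      rw [← h1R]; field_simp
    rw [this]
    field_simp
    ring
  have hgabs : |g - 1| * (g + 1) = |(n0 : ℝ)| / 2 ^ (m0 + 2 * k) := by
    rw [← abs_of_pos (by linarith : 0 < g + 1), ← abs_mul,
      show (g - 1) * (g + 1) = g ^ 2 - 1 by ring, hg2, add_sub_cancel_left, abs_div,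
      abs_of_pos (by positivity : (0 : ℝ) < 2 ^ (m0 + 2 * k))]
  have hgup : |g - 1| ≤ 2 ^ h / 2 ^ (m0 + 2 * k) := by
    have : |(n0 : ℝ)| / 2 ^ (m0 + 2 * k) ≤ 2 ^ h / 2 ^ (m0 + 2 * k) := by gcongr
    nlinarith [abs_nonneg (g - 1)]
  have hgle : g ≤ 2 := by
    have : (2 : ℝ) ^ h / 2 ^ (m0 + 2 * k) ≤ 1 := by
      rw [div_le_one (by positivity)]
      gcongr
      · norm_num
      · omega
    have := abs_le.1 (hgup.trans this)
    linarith
  have hglow : 1 ≤ |g - 1| * 2 ^ (m0 + 2 * k + 2) := by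
    have h3 : |g - 1| * (g + 1) * 2 ^ (m0 + 2 * k) = |(n0 : ℝ)| := by
      rw [hgabs]; field_simp
    calc (1 : ℝ) ≤ |g - 1| * (g + 1) * 2 ^ (m0 + 2 * k) := by rw [h3]; exact hnR1
      _ ≤ |g - 1| * 4 * 2 ^ (m0 + 2 * k) := by gcongr; linarith
      _ = _ := by ring
  set P := F (7 * d) (3 * d) W 1 with hP
  set q := Q (7 * d) (3 * d) W with hq
  have hPlow : 1 ≤ 2 ^ (7 * d) * P := P_lower _ _ _ hWpos (by omega)
  have hPup : P ≤ 2 ^ (7 * d + 2 * (3 * d)) := P_upper _ _ _ hWpos hW2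
  have hPpos : 0 < P := by
    by_contra hcon
    have : (2 : ℝ) ^ (7 * d) * P ≤ 0 := mul_nonpos_of_nonneg_of_nonpos (by positivity) (not_lt.1 hcon)
    linarith
  have hR : |P - f * q| ≤ 2 ^ (3 * d) * z ^ (7 * d + 3 * d + 1) := by
    rw [hq, ← F_sqrt _ _ _ _ hfpos hf2]
    exact R_bound _ _ _ _ _ hfpos hf2 hWz hz2
  -- remainder smaller than main term
  have hRlt : |P - f * q| < |g - 1| * P := by
    have hE : 3 * d + h * (10 * d + 1) + (m0 + 2 * k + 2 + 7 * d) < m0 * (10 * d + 1) := by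
      nlinarith
    have hA : |P - f * q| * 2 ^ (m0 + 2 * k + 2 + 7 * d) < 1 := by
      calc |P - f * q| * 2 ^ (m0 + 2 * k + 2 + 7 * d)
          ≤ (2 ^ (3 * d) * (2 ^ h / 2 ^ m0) ^ (7 * d + 3 * d + 1)) * 2 ^ (m0 + 2 * k + 2 + 7 * d) := by
            gcongr
            refine hR.trans ?_
            gcongr
        _ = 2 ^ (3 * d + h * (10 * d + 1) + (m0 + 2 * k + 2 + 7 * d)) / 2 ^ (m0 * (10 * d + 1)) := by
            rw [div_pow, ← pow_mul, ← pow_mul, show 7 * d + 3 * d + 1 = 10 * d + 1 by ring,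
              pow_add _ _ (m0 + 2 * k + 2 + 7 * d), pow_add _ (3 * d)]
            ring
        _ < 1 := by
            rw [div_lt_one (by positivity)]
            exact pow_lt_pow_right₀ (by norm_num) hE
    have hB : 1 ≤ |g - 1| * P * 2 ^ (m0 + 2 * k + 2 + 7 * d) := by
      calc (1 : ℝ) = 1 * 1 := by ring
        _ ≤ (|g - 1| * 2 ^ (m0 + 2 * k + 2)) * (2 ^ (7 * d) * P) := by gcongr
        _ = _ := by rw [pow_add _ _ (7 * d)]; ring
    have hpw : (0 : ℝ) < 2 ^ (m0 + 2 * k + 2 + 7 * d) := by positivity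
    exact lt_of_mul_lt_mul_right (hA.trans_le hB) hpw.le
  have hkab : m0 * (7 * d) ≤ m0 * (3 * d) + k := by nlinarith
  obtain ⟨Z, hZ⟩ := lam_int (7 * d) (3 * d) m0 k u y0 y (by omega) hkab W hW
  have hid : y * P - y0 * 2 ^ k * q = (y0 * 2 ^ k / f) * ((P - f * q) + (g - 1) * P) := by
    rw [hg]; field_simp; ring
  rw [← hP, ← hq, hid] at hZ
  have hDpos : (0 : ℝ) < Nat.lcmUpto (2 * (7 * d) + 1) := by exact_mod_cast Nat.lcmUpto_pos _
  have hin : (P - f * q) + (g - 1) * P ≠ 0 := by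
    intro hcon
    have : P - f * q = -((g - 1) * P) := by linarith
    rw [this, abs_neg, abs_mul, abs_of_pos hPpos] at hRlt
    exact lt_irrefl _ hRlt
  have hZne : Z ≠ 0 := by
    intro hcon
    rw [hcon, Int.cast_zero] at hZ
    refine absurd hZ.symm (mul_ne_zero (by positivity) (mul_ne_zero (by positivity) hin))
  have hZ1 : (1 : ℝ) ≤ |(Z : ℝ)| := by exact_mod_cast Int.one_le_abs hZne
  have hy0f : y0 / f ≤ (2 : ℝ) ^ m0 := by
    rw [div_le_iff₀ hfpos]
    have hp1 : (1 : ℝ) ≤ 2 ^ m0 := one_le_pow₀ (by norm_num)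
    refine le_of_sq_le_sq ?_ (by positivity)
    rw [mul_pow, hf2, hW]
    have : ((2 : ℝ) ^ m0) ^ 2 * (u * (y0 : ℝ) ^ 2 / 2 ^ m0) = 2 ^ m0 * u * (y0 : ℝ) ^ 2 := by
      field_simp
    rw [this]
    have : 1 ≤ 2 ^ m0 * (u : ℝ) := one_le_mul_of_one_le_of_one_le hp1 huR
    nlinarith [sq_nonneg (y0 : ℝ)]
  have hinup : |(P - f * q) + (g - 1) * P| ≤ 2 * (2 ^ h / 2 ^ (m0 + 2 * k)) * 2 ^ (13 * d) := by
    calc |(P - f * q) + (g - 1) * P| ≤ |P - f * q| + |(g - 1) * P| := abs_add_le _ _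
      _ ≤ |g - 1| * P + |g - 1| * P := by
          rw [abs_mul (g - 1), abs_of_pos hPpos]; linarith
      _ = 2 * |g - 1| * P := by ring
      _ ≤ 2 * (2 ^ h / 2 ^ (m0 + 2 * k)) * 2 ^ (13 * d) := by
          have : 7 * d + 2 * (3 * d) = 13 * d := by ring
          rw [this] at hPup
          gcongr
  have hfin : |(Z : ℝ)| < 1 := by
    rw [hZ, abs_mul, abs_mul (y0 * 2 ^ k / f), abs_of_pos (by positivity : (0 : ℝ) < (Nat.lcmUpto (2 * (7 * d) + 1) : ℝ) * 2 ^ (m0 * (3 * d))),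
      abs_of_pos (by positivity : (0 : ℝ) < y0 * 2 ^ k / f)]
    have hE : 10 * (2 * (7 * d) + 1) + m0 * (3 * d) + (m0 + k) + (1 + h + 13 * d) < m0 + 2 * k := by
      nlinarith
    calc _ ≤ ((2 : ℝ) ^ (10 * (2 * (7 * d) + 1)) * 2 ^ (m0 * (3 * d))) * (2 ^ m0 * 2 ^ k *
            (2 * (2 ^ h / 2 ^ (m0 + 2 * k)) * 2 ^ (13 * d))) := by
          have := lcm_bound (2 * (7 * d) + 1)
          have h5 : y0 * 2 ^ k / f ≤ (2 : ℝ) ^ m0 * 2 ^ k := by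
            rw [mul_div_right_comm]; gcongr
          gcongr
      _ = (2 : ℝ) ^ (10 * (2 * (7 * d) + 1) + m0 * (3 * d) + (m0 + k) + (1 + h + 13 * d)) / 2 ^ (m0 + 2 * k) := by
          rw [pow_add _ _ (1 + h + 13 * d), pow_add _ _ (m0 + k), pow_add _ (10 * (2 * (7 * d) + 1)),
            pow_add _ m0 k, pow_add _ _ (13 * d), pow_add _ 1 h]
          ring
      _ < 1 := by
          rw [div_lt_one (by positivity)]
          exact pow_lt_pow_right₀ (by norm_num) hE
  linarith

lemma class_finite (n0 u : ℤ) (hn : n0 ≠ 0) (p : ℕ) :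
    {m : ℕ | m % 2 = p ∧ ∃ y : ℤ, 2 ^ m + n0 = u * y ^ 2}.Finite := by
  by_contra hinf
  replace hinf : Set.Infinite _ := hinf
  set h := n0.natAbs with hh
  have hb : |n0| < 2 ^ h := by
    rw [Int.abs_eq_natAbs]
    exact_mod_cast Nat.lt_two_pow_self
  have aux : ∀ m : ℕ, h ≤ m → ∀ y : ℤ, 2 ^ m + n0 = u * y ^ 2 → 1 ≤ u ∧ 1 ≤ |y| := by
    intro m hm y hy
    have h2 : (2 : ℤ) ^ h ≤ 2 ^ m := pow_le_pow_right₀ (by norm_num) hm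
    have h3 : 0 < u * y ^ 2 := by rw [← hy]; have := neg_abs_le n0; linarith
    have hy0 : y ≠ 0 := by rintro rfl; simp at h3
    exact ⟨pos_of_mul_pos_left h3 (sq_nonneg y), Int.one_le_abs hy0⟩
  obtain ⟨m0, ⟨hp0, y0, e0⟩, hm0⟩ := hinf.exists_gt (200 + 11 * h)
  obtain ⟨m, ⟨hp, y, e1⟩, hm⟩ := hinf.exists_gt (65 * m0)
  obtain ⟨k, rfl⟩ : ∃ k, m = m0 + 2 * k := ⟨(m - m0) / 2, by omega⟩
  obtain ⟨hu, hy0⟩ := aux m0 (by omega) y0 e0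
  obtain ⟨-, hy⟩ := aux _ (by omega) y e1
  exact key n0 u |y0| |y| h m0 k hn hb.le hu hy0 hy (by rw [sq_abs]; exact e0)
    (by rw [sq_abs]; exact e1) (by omega) (by omega)

end RN

/-- Let `n₀` be a non-zero integer and `N` a positive integer. There are only
finitely many natural numbers `m` such that `2^m + n₀ = u·y²` for some
square-free divisor `u` of `2N` and some integer `y`. -/
theorem stmt1 (n₀ : ℤ) (hn₀ : n₀ ≠ 0) (N : ℕ) (hN : 0 < N) :
    {m : ℕ | ∃ u y : ℤ, Squarefree u ∧ u ∣ 2 * (N : ℤ) ∧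
      2 ^ m + n₀ = u * y ^ 2}.Finite := by
  have hfin : (Set.Icc (-(2 * (N : ℤ))) (2 * N)).Finite := Set.finite_Icc _ _
  have hfin2 : (Set.Iio 2 : Set ℕ).Finite := Set.finite_Iio 2
  refine Set.Finite.subset (hfin.biUnion fun u _ => hfin2.biUnion fun p _ =>
    RN.class_finite n₀ u hn₀ p) ?_
  rintro m ⟨u, y, -, hu, e⟩
  simp only [Set.mem_iUnion]
  have hle : |u| ≤ 2 * (N : ℤ) := Int.le_of_dvd (by positivity) ((abs_dvd _ _).2 hu)
  exact ⟨u, abs_le.1 hle, m % 2, Nat.mod_lt _ (by norm_num), rfl, y, e⟩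
end

section
/- Let u ≥ 1 be a fixed integer and a an integer with 1 ≤ a ≤ X. The number of primes p with up ≤ X such that p = a + m² for some integer m is ≪ (√X / log X) · ∏_{p ≤ X^{1/4}} (1 - χ_{-4a}(p)/p), where χ_{-4a} is the Kronecker symbol of discriminant -4a, and the implied constant depends only on u. -/
open Finset in
/-- The Selberg upper bound sieve with crude remainder control. -/
theorem selberg_bound (s : BoundingSieve) (Y : ℕ) (hY : 1 ≤ Y)
    (hnu : ∀ d, d ∣ s.prodPrimes → (s.nu d)⁻¹ ≤ d)
    (hrem : ∀ d, d ∣ s.prodPrimes → |s.rem d| ≤ d) :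
    s.siftedSum ≤ s.totalMass / (∑ l ∈ s.prodPrimes.divisors.filter (· ≤ Y), s.selbergTerms l)
      + (Y : ℝ) ^ 6 := by
  set P := s.prodPrimes with hP
  have hP0 : P ≠ 0 := BoundingSieve.prodPrimes_ne_zero
  set G : ℝ := ∑ l ∈ P.divisors.filter (· ≤ Y), s.selbergTerms l with hG
  have hgpos : ∀ l ∈ P.divisors, 0 < s.selbergTerms l := fun l hl =>
    BoundingSieve.selbergTerms_pos (Nat.dvd_of_mem_divisors hl)
  have hGpos : 0 < G := by
    apply Finset.sum_pos
    · intro l hl; exact hgpos l (Finset.mem_filter.mp hl).1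
    · exact ⟨1, by simp [hP0, hY]⟩
  let y : ℕ → ℝ := fun l => if l ≤ Y then (ArithmeticFunction.moebius l : ℝ) * s.selbergTerms l / G else 0
  let w : ℕ → ℝ := fun d => if d ∣ P then
    (s.nu d)⁻¹ * ∑ l ∈ P.divisors, if d ∣ l then (ArithmeticFunction.moebius (l / d) : ℝ) * y l else 0 else 0
  have hmuabs : ∀ n : ℕ, |(ArithmeticFunction.moebius n : ℝ)| ≤ 1 := by
    intro n
    exact_mod_cast (ArithmeticFunction.abs_moebius_le_one (n := n))
  have hyabs : ∀ l ∈ P.divisors, |y l| ≤ if l ≤ Y then s.selbergTerms l / G else 0 := by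
    intro l hl
    simp only [y]
    split_ifs
    · rw [abs_div, abs_mul, abs_of_pos hGpos, abs_of_pos (hgpos l hl)]
      gcongr
      exact mul_le_of_le_one_left (hgpos l hl).le (hmuabs l)
    · simp
  have hw1 : w 1 = 1 := by
    simp only [w, one_dvd, if_true, s.nu_mult.1, inv_one, one_mul, Nat.div_one, y]
    have : ∀ l ∈ P.divisors, (ArithmeticFunction.moebius l : ℝ) *
        (if l ≤ Y then (ArithmeticFunction.moebius l : ℝ) * s.selbergTerms l / G else 0)
        = if l ≤ Y then s.selbergTerms l / G else 0 := by
      intro l hl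
      have hsq : Squarefree l := BoundingSieve.squarefree_of_mem_divisors_prodPrimes hl
      have h2 : ((ArithmeticFunction.moebius l : ℝ)) ^ 2 = 1 := by
        exact_mod_cast ArithmeticFunction.moebius_sq_eq_one_of_squarefree hsq
      split_ifs
      · rw [← mul_div_assoc, ← mul_assoc, ← sq, h2, one_mul]
      · simp
    rw [Finset.sum_congr rfl this, ← Finset.sum_filter, ← Finset.sum_div, div_self hGpos.ne']
  have hwY : ∀ d, Y < d → w d = 0 := by
    intro d hd
    simp only [w]
    split_ifs with hdP
    · rw [Finset.sum_eq_zero, mul_zero]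
      intro l hl
      split_ifs with hdl
      · have : ¬ l ≤ Y := by
          have := Nat.le_of_dvd (Nat.pos_of_mem_divisors hl) hdl
          omega
        simp [y, this]
      · rfl
    · rfl
  have hwabs : ∀ d, |w d| ≤ d := by
    intro d
    simp only [w]
    split_ifs with hdP
    · have hnupos := BoundingSieve.nu_pos_of_dvd_prodPrimes hdP
      rw [abs_mul, abs_of_pos (inv_pos.mpr hnupos)]
      have hS : |∑ l ∈ P.divisors, if d ∣ l then (ArithmeticFunction.moebius (l / d) : ℝ) * y l else 0| ≤ 1 := by
        calc _ ≤ ∑ l ∈ P.divisors, (if l ≤ Y then s.selbergTerms l / G else 0) := by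
              refine (Finset.abs_sum_le_sum_abs _ _).trans (Finset.sum_le_sum fun l hl => ?_)
              split_ifs with h1 h2 h2
              · have := hyabs l hl
                rw [if_pos h2] at this
                rw [abs_mul]
                exact (mul_le_of_le_one_left (abs_nonneg _) (hmuabs _)).trans this
              · simp [y, h2]
              · simp only [abs_zero]; exact div_nonneg (hgpos l hl).le hGpos.le
              · simp
          _ = 1 := by
              rw [← Finset.sum_filter, ← Finset.sum_div, div_self hGpos.ne']
      calc _ ≤ (d : ℝ) * 1 := mul_le_mul (hnu d hdP) hS (abs_nonneg _) (by positivity)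
        _ = d := mul_one _
    · simp
  have hinv : ∀ l ∈ P.divisors, (∑ d ∈ P.divisors, if l ∣ d then s.nu d * w d else 0) = y l := by
    intro l hl
    have h1 : ∀ d ∈ P.divisors, (if l ∣ d then s.nu d * w d else 0) =
        ∑ k ∈ P.divisors, if l ∣ d ∧ d ∣ k then (ArithmeticFunction.moebius (k / d) : ℝ) * y k else 0 := by
      intro d hd
      have hdP := Nat.dvd_of_mem_divisors hd
      have hnupos := BoundingSieve.nu_pos_of_dvd_prodPrimes hdP
      split_ifs with hld
      · simp only [w, hdP, if_true, hld, true_and]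
        rw [← mul_assoc, mul_inv_cancel₀ hnupos.ne', one_mul]
      · simp [hld]
    rw [Finset.sum_congr rfl h1, Finset.sum_comm]
    have h2 : ∀ k ∈ P.divisors, (∑ d ∈ P.divisors, if l ∣ d ∧ d ∣ k then (ArithmeticFunction.moebius (k / d) : ℝ) * y k else 0)
        = if k = l then y k else 0 := by
      intro k hk
      have hkP := Nat.dvd_of_mem_divisors hk
      have hk0 : k ≠ 0 := (Nat.pos_of_mem_divisors hk).ne'
      by_cases hlk : l ∣ k
      · obtain ⟨e, rfl⟩ := hlk
        have hl0 : l ≠ 0 := left_ne_zero_of_mul hk0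
        have he0 : e ≠ 0 := right_ne_zero_of_mul hk0
        rw [← Finset.sum_filter]
        have : P.divisors.filter (fun d => l ∣ d ∧ d ∣ l * e) = e.divisors.image (fun f => l * f) := by
          ext d
          simp only [Finset.mem_filter, Nat.mem_divisors, Finset.mem_image]
          constructor
          · rintro ⟨_, ⟨f, rfl⟩, h⟩
            exact ⟨f, ⟨Nat.dvd_of_mul_dvd_mul_left (Nat.pos_of_ne_zero hl0) h, he0⟩, rfl⟩
          · rintro ⟨f, ⟨hf, _⟩, rfl⟩
            exact ⟨⟨(Nat.mul_dvd_mul_left l hf).trans hkP, hP0⟩, dvd_mul_right _ _, Nat.mul_dvd_mul_left l hf⟩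
        rw [this, Finset.sum_image (by intro x _ y _ h; exact Nat.eq_of_mul_eq_mul_left (Nat.pos_of_ne_zero hl0) h),
          ← Finset.sum_mul]
        have h3 : ∀ f ∈ e.divisors, (ArithmeticFunction.moebius (l * e / (l * f)) : ℝ) = (ArithmeticFunction.moebius (e / f) : ℝ) := by
          intro f hf
          rw [Nat.mul_div_mul_left _ _ (Nat.pos_of_ne_zero hl0)]
        rw [Finset.sum_congr rfl h3, Nat.sum_div_divisors e (fun f => (ArithmeticFunction.moebius f : ℝ))]
        have h4 : (∑ f ∈ e.divisors, (ArithmeticFunction.moebius f : ℝ)) = if e = 1 then 1 else 0 := by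
          have := congrArg (fun F : ArithmeticFunction ℤ => F e) ArithmeticFunction.moebius_mul_coe_zeta
          simp only [ArithmeticFunction.coe_mul_zeta_apply, ArithmeticFunction.one_apply] at this
          exact_mod_cast this
        rw [h4]
        by_cases he : e = 1
        · simp [he]
        · have : l * e ≠ l := by
            intro h; apply he
            exact Nat.eq_of_mul_eq_mul_left (Nat.pos_of_ne_zero hl0) (by simpa using h)
          simp [he, this]
      · rw [Finset.sum_eq_zero, if_neg]
        · rintro rfl; exact hlk dvd_rfl
        · intro d _
          rw [if_neg]
          rintro ⟨h, h'⟩; exact hlk (h.trans h')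
    rw [Finset.sum_congr rfl h2]
    simp [Nat.dvd_of_mem_divisors hl, hP0]
  have hmain : s.mainSum (BoundingSieve.lambdaSquared w) = 1 / G := by
    rw [BoundingSieve.mainSum_lambdaSquared_eq_sum_mul_sum_sq]
    have : ∀ l ∈ P.divisors, (s.selbergTerms l)⁻¹ * (∑ d ∈ P.divisors, if l ∣ d then s.nu d * w d else 0) ^ 2
        = if l ≤ Y then s.selbergTerms l / G ^ 2 else 0 := by
      intro l hl
      rw [hinv l hl]
      have hsq : Squarefree l := BoundingSieve.squarefree_of_mem_divisors_prodPrimes hl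
      have h2 : ((ArithmeticFunction.moebius l : ℝ)) ^ 2 = 1 := by
        exact_mod_cast ArithmeticFunction.moebius_sq_eq_one_of_squarefree hsq
      have := hgpos l hl
      simp only [y]
      split_ifs
      · rw [div_pow, mul_pow, h2]; field_simp
      · simp
    rw [Finset.sum_congr rfl this, ← Finset.sum_filter, ← Finset.sum_div, ← hG]
    field_simp
  have herr : s.errSum (BoundingSieve.lambdaSquared w) ≤ (Y : ℝ) ^ 6 := by
    unfold BoundingSieve.errSum
    have h1 : ∀ d ∈ P.divisors, |BoundingSieve.lambdaSquared w d| * |s.rem d| ≤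
        ∑ d1 ∈ Finset.Icc 1 Y, ∑ d2 ∈ Finset.Icc 1 Y, if d = Nat.lcm d1 d2 then (Y : ℝ) ^ 4 else 0 := by
      intro d hd
      have hdP := Nat.dvd_of_mem_divisors hd
      have hd0 : 0 < d := Nat.pos_of_mem_divisors hd
      have h2 : |BoundingSieve.lambdaSquared w d| ≤
          ∑ d1 ∈ d.divisors, ∑ d2 ∈ d.divisors, if d = Nat.lcm d1 d2 then |w d1| * |w d2| else 0 := by
        unfold BoundingSieve.lambdaSquared
        refine (Finset.abs_sum_le_sum_abs _ _).trans (Finset.sum_le_sum fun d1 _ => ?_)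
        refine (Finset.abs_sum_le_sum_abs _ _).trans (Finset.sum_le_sum fun d2 _ => ?_)
        split_ifs <;> simp [abs_mul]
      have hvan : ∀ d1 ∈ d.divisors, d1 ∉ d.divisors.filter (· ≤ Y) → w d1 = 0 := by
        intro d1 h h'
        apply hwY
        simp only [Finset.mem_filter, not_and] at h'
        have := h' h; omega
      have h3 : (∑ d1 ∈ d.divisors, ∑ d2 ∈ d.divisors, if d = Nat.lcm d1 d2 then |w d1| * |w d2| else 0)
          = ∑ d1 ∈ d.divisors.filter (· ≤ Y), ∑ d2 ∈ d.divisors.filter (· ≤ Y), if d = Nat.lcm d1 d2 then |w d1| * |w d2| else 0 := by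
        rw [← Finset.sum_subset (Finset.filter_subset (· ≤ Y) d.divisors)]
        · refine Finset.sum_congr rfl fun d1 _ => ?_
          rw [← Finset.sum_subset (Finset.filter_subset (· ≤ Y) d.divisors)]
          intro d2 h h'
          simp [hvan d2 h h']
        · intro d1 h h'
          simp [hvan d1 h h']
      calc _ ≤ (∑ d1 ∈ d.divisors.filter (· ≤ Y), ∑ d2 ∈ d.divisors.filter (· ≤ Y), if d = Nat.lcm d1 d2 then |w d1| * |w d2| else 0) * d := by
            rw [← h3]
            exact mul_le_mul h2 (hrem d hdP) (abs_nonneg _) ((abs_nonneg _).trans h2)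
        _ = ∑ d1 ∈ d.divisors.filter (· ≤ Y), ∑ d2 ∈ d.divisors.filter (· ≤ Y), if d = Nat.lcm d1 d2 then |w d1| * |w d2| * d else 0 := by
            rw [Finset.sum_mul]
            refine Finset.sum_congr rfl fun d1 _ => ?_
            rw [Finset.sum_mul]
            refine Finset.sum_congr rfl fun d2 _ => ?_
            split_ifs <;> simp
        _ ≤ ∑ d1 ∈ d.divisors.filter (· ≤ Y), ∑ d2 ∈ d.divisors.filter (· ≤ Y), if d = Nat.lcm d1 d2 then (Y : ℝ) ^ 4 else 0 := by
            refine Finset.sum_le_sum fun d1 h1 => Finset.sum_le_sum fun d2 h2 => ?_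
            split_ifs with h
            · have e1 : (d1 : ℝ) ≤ Y := by exact_mod_cast (Finset.mem_filter.mp h1).2
              have e2 : (d2 : ℝ) ≤ Y := by exact_mod_cast (Finset.mem_filter.mp h2).2
              have e3 : (d : ℝ) ≤ Y * Y := by
                have : d ≤ d1 * d2 := by
                  rw [h]; exact Nat.le_of_dvd (Nat.mul_pos (Nat.pos_of_mem_divisors (Finset.mem_filter.mp h1).1) (Nat.pos_of_mem_divisors (Finset.mem_filter.mp h2).1)) (Nat.lcm_dvd_mul d1 d2)
                calc (d : ℝ) ≤ d1 * d2 := by exact_mod_cast this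
                  _ ≤ Y * Y := by gcongr
              calc |w d1| * |w d2| * d ≤ Y * Y * (Y * Y) := by
                    gcongr
                    · exact (hwabs d1).trans e1
                    · exact (hwabs d2).trans e2
                _ = (Y : ℝ) ^ 4 := by ring
            · exact le_rfl
        _ ≤ _ := by
            have hsub : d.divisors.filter (· ≤ Y) ⊆ Finset.Icc 1 Y := by
              intro x hx
              rw [Finset.mem_filter] at hx
              exact Finset.mem_Icc.mpr ⟨Nat.pos_of_mem_divisors hx.1, hx.2⟩
            refine (Finset.sum_le_sum fun d1 _ => Finset.sum_le_sum_of_subset_of_nonneg hsub ?_).trans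
              (Finset.sum_le_sum_of_subset_of_nonneg hsub ?_)
            · intros; positivity
            · intros; positivity
    calc _ ≤ ∑ d ∈ P.divisors, ∑ d1 ∈ Finset.Icc 1 Y, ∑ d2 ∈ Finset.Icc 1 Y, (if d = Nat.lcm d1 d2 then (Y : ℝ) ^ 4 else 0) :=
          Finset.sum_le_sum h1
      _ = ∑ d1 ∈ Finset.Icc 1 Y, ∑ d2 ∈ Finset.Icc 1 Y, ∑ d ∈ P.divisors, (if d = Nat.lcm d1 d2 then (Y : ℝ) ^ 4 else 0) := by
          rw [Finset.sum_comm]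
          refine Finset.sum_congr rfl fun d1 _ => ?_
          rw [Finset.sum_comm]
      _ ≤ ∑ d1 ∈ Finset.Icc 1 Y, ∑ d2 ∈ Finset.Icc 1 Y, (Y : ℝ) ^ 4 := by
          refine Finset.sum_le_sum fun d1 h1 => Finset.sum_le_sum fun d2 h2 => ?_
          rw [Finset.sum_ite_eq']
          split_ifs
          · exact le_rfl
          · positivity
      _ = (Y : ℝ) ^ 6 := by
          simp; ring
  have := BoundingSieve.siftedSum_le_mainSum_errSum_of_upperMoebius (s := s) _ (BoundingSieve.upperMoebius_lambdaSquared w hw1)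
  rw [hmain] at this
  rw [div_eq_mul_one_div]
  linarith

open Finset in
/-- Powerset form of the first moment identity. -/
theorem powerset_moment (g L : ℕ → ℝ) (S : Finset ℕ) (hg : ∀ p ∈ S, 0 ≤ g p) :
    ∑ T ∈ S.powerset, (∏ p ∈ T, g p) * ∑ p ∈ T, L p =
      (∏ p ∈ S, (1 + g p)) * ∑ p ∈ S, g p / (1 + g p) * L p := by
  induction S using Finset.induction_on with
  | empty => simp
  | insert q S hq ih =>
    have ih := ih (fun p hp => hg p (Finset.mem_insert_of_mem hp))
    have hgq := hg q (Finset.mem_insert_self _ _)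
    rw [Finset.sum_powerset_insert hq]
    have h1 : ∀ T ∈ S.powerset, (∏ p ∈ insert q T, g p) * ∑ p ∈ insert q T, L p
        = g q * L q * (∏ p ∈ T, g p) + g q * ((∏ p ∈ T, g p) * ∑ p ∈ T, L p) := by
      intro T hT
      have : q ∉ T := fun h => hq (Finset.mem_powerset.mp hT h)
      rw [Finset.prod_insert this, Finset.sum_insert this]; ring
    rw [Finset.sum_congr rfl h1, Finset.sum_add_distrib, ← Finset.mul_sum, ← Finset.mul_sum, ih,
      ← Finset.prod_one_add, Finset.prod_insert hq, Finset.sum_insert hq]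
    have : 1 + g q ≠ 0 := by positivity
    field_simp
    ring

open Finset in
/-- Markov lower bound for the Selberg sum. -/
theorem selberg_sum_lower (s : BoundingSieve) (Y : ℕ) (hY : 2 ≤ Y)
    (h : ∑ p ∈ s.prodPrimes.primeFactors, s.nu p * Real.log p ≤ Real.log Y / 2) :
    (∏ p ∈ s.prodPrimes.primeFactors, (1 - s.nu p)⁻¹) / 2 ≤
      ∑ l ∈ s.prodPrimes.divisors.filter (· ≤ Y), s.selbergTerms l := by
  set P := s.prodPrimes with hP
  have hP0 : P ≠ 0 := BoundingSieve.prodPrimes_ne_zero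
  have hgpos : ∀ l ∈ P.divisors, 0 < s.selbergTerms l := fun l hl =>
    BoundingSieve.selbergTerms_pos (Nat.dvd_of_mem_divisors hl)
  have hgp : ∀ p ∈ P.primeFactors, 0 < 1 - s.nu p ∧ s.selbergTerms p = s.nu p * (1 - s.nu p)⁻¹ := by
    intro p hp
    have hpp := Nat.prime_of_mem_primeFactors hp
    refine ⟨by linarith [s.nu_lt_one_of_prime p hpp (Nat.dvd_of_mem_primeFactors hp)], ?_⟩
    rw [BoundingSieve.selbergTerms_apply, hpp.primeFactors]; simp
  have hconv : ∀ f : ℕ → ℝ, ∑ d ∈ P.divisors, f d = ∑ T ∈ P.primeFactors.powerset, f (∏ p ∈ T, p) := by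
    intro f
    rw [← Nat.divisors_filter_squarefree_of_squarefree s.prodPrimes_squarefree,
      Nat.sum_divisors_filter_squarefree hP0, Nat.factors_eq]
    refine Finset.sum_congr rfl fun T _ => ?_
    rw [T.prod_val, Function.id_def]
  have hone : ∀ p ∈ P.primeFactors, 1 + s.selbergTerms p = (1 - s.nu p)⁻¹ := by
    intro p hp
    obtain ⟨h1, h2⟩ := hgp p hp
    rw [h2]; field_simp; ring
  have hprod : ∀ T ∈ P.primeFactors.powerset, s.selbergTerms (∏ p ∈ T, p) = ∏ p ∈ T, s.selbergTerms p := by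
    intro T hT
    exact BoundingSieve.selbergTerms_isMultiplicative.map_prod_of_subset_primeFactors _ _ (Finset.mem_powerset.mp hT)
  have htot : ∑ d ∈ P.divisors, s.selbergTerms d = ∏ p ∈ P.primeFactors, (1 - s.nu p)⁻¹ := by
    rw [hconv, Finset.sum_congr rfl hprod, ← Finset.prod_one_add, Finset.prod_congr rfl hone]
  have hmom : ∑ d ∈ P.divisors, s.selbergTerms d * Real.log d =
      (∏ p ∈ P.primeFactors, (1 - s.nu p)⁻¹) * ∑ p ∈ P.primeFactors, s.nu p * Real.log p := by
    rw [hconv]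
    have := powerset_moment (fun p => s.selbergTerms p) (fun p => Real.log p) P.primeFactors (fun p hp => by
      exact (hgpos p (Nat.mem_divisors.mpr ⟨Nat.dvd_of_mem_primeFactors hp, hP0⟩)).le)
    rw [Finset.prod_congr rfl hone] at this
    rw [show (∑ p ∈ P.primeFactors, s.nu p * Real.log p) = ∑ p ∈ P.primeFactors, s.selbergTerms p / (1 + s.selbergTerms p) * Real.log p from ?_, ← this]
    · refine Finset.sum_congr rfl fun T hT => ?_
      rw [hprod T hT]
      push_cast
      rw [Real.log_prod]
      intro p hp
      have := Nat.prime_of_mem_primeFactors (Finset.mem_powerset.mp hT hp)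
      exact_mod_cast this.ne_zero
    · refine Finset.sum_congr rfl fun p hp => ?_
      obtain ⟨h1, h2⟩ := hgp p hp
      rw [hone p hp, h2]; field_simp
  have hlogY : 0 < Real.log Y := Real.log_pos (by exact_mod_cast hY)
  have htail : Real.log Y * ∑ d ∈ P.divisors.filter (¬ · ≤ Y), s.selbergTerms d ≤ ∑ d ∈ P.divisors, s.selbergTerms d * Real.log d := by
    rw [Finset.mul_sum]
    refine le_trans (Finset.sum_le_sum fun d hd => ?_) (Finset.sum_le_sum_of_subset_of_nonneg (Finset.filter_subset (¬ · ≤ Y) _) ?_)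
    · have hd' := Finset.mem_filter.mp hd
      rw [mul_comm]
      have := hgpos d hd'.1
      gcongr
      omega
    · intro d hd _
      have h1 := hgpos d hd
      exact mul_nonneg h1.le (Real.log_natCast_nonneg d)
  have hsplit := Finset.sum_filter_add_sum_filter_not P.divisors (· ≤ Y) (fun d => s.selbergTerms d)
  rw [htot] at hsplit
  rw [hmom] at htail
  have hFpos : 0 < ∏ p ∈ P.primeFactors, (1 - s.nu p)⁻¹ :=
    Finset.prod_pos fun p hp => inv_pos.mpr (hgp p hp).1
  set F := ∏ p ∈ P.primeFactors, (1 - s.nu p)⁻¹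
  have h5 : Real.log Y * ∑ d ∈ P.divisors.filter (¬ · ≤ Y), s.selbergTerms d ≤ Real.log Y * (F / 2) := by
    refine htail.trans ((mul_le_mul_of_nonneg_left h hFpos.le).trans (le_of_eq (by ring)))
  have h6 := le_of_mul_le_mul_left h5 hlogY
  linarith

open Finset in
/-- A weak form of the first Mertens theorem. -/
theorem sum_log_div_le (N : ℕ) :
    ∑ p ∈ (range (N + 1)).filter Nat.Prime, Real.log p / p ≤ 2 * Real.log N := by
  rcases Nat.eq_zero_or_pos N with rfl | hN
  · simp [Finset.filter_singleton, Nat.not_prime_zero]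
  have hNr : (0 : ℝ) < N := by exact_mod_cast hN
  have h1 : ∀ p ∈ (range (N + 1)).filter Nat.Prime,
      (N : ℝ) / 2 * (Real.log p / p) ≤ ∑ n ∈ Ioc 0 N, if p ∣ n then Real.log p else 0 := by
    intro p hp
    obtain ⟨hpN, hpp⟩ := Finset.mem_filter.mp hp
    have hpN : p ≤ N := by simpa [Nat.lt_succ_iff] using hpN
    rw [← Finset.sum_filter, Finset.sum_const, Nat.Ioc_filter_dvd_card_eq_div, nsmul_eq_mul]
    have hp0 : (0 : ℝ) < p := by exact_mod_cast hpp.pos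
    have hk : 1 ≤ N / p := Nat.div_pos hpN hpp.pos
    have hlt : N < p * (N / p + 1) := Nat.lt_mul_div_succ N hpp.pos
    have hle : (N : ℝ) ≤ 2 * p * (N / p : ℕ) := by
      have : N ≤ 2 * p * (N / p) := by nlinarith
      exact_mod_cast this
    have hlog : 0 ≤ Real.log p := Real.log_natCast_nonneg p
    have : (N : ℝ) / 2 / p ≤ (N / p : ℕ) := by
      rw [div_le_iff₀ hp0]; linarith
    calc (N : ℝ) / 2 * (Real.log p / p) = (N : ℝ) / 2 / p * Real.log p := by ring
      _ ≤ _ := by gcongr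
  have h2 : ∀ n ∈ Ioc 0 N, (∑ p ∈ (range (N + 1)).filter Nat.Prime, if p ∣ n then Real.log p else 0)
      ≤ Real.log N := by
    intro n hn
    obtain ⟨hn0, hnN⟩ := Finset.mem_Ioc.mp hn
    have : ((range (N + 1)).filter Nat.Prime).filter (· ∣ n) = n.primeFactors := by
      ext p
      simp only [Finset.mem_filter, Finset.mem_range, Nat.mem_primeFactors]
      constructor
      · rintro ⟨⟨_, h⟩, h'⟩; exact ⟨h, h', by omega⟩
      · rintro ⟨h, h', _⟩
        have := Nat.le_of_dvd hn0 h'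
        exact ⟨⟨by omega, h⟩, h'⟩
    rw [← Finset.sum_filter, this, ← Real.log_prod (fun p hp => by
      exact_mod_cast (Nat.prime_of_mem_primeFactors hp).ne_zero)]
    have hdvd := Nat.le_of_dvd hn0 (Nat.prod_primeFactors_dvd n)
    have hpos : 0 < ∏ p ∈ n.primeFactors, p := Finset.prod_pos fun p hp => (Nat.prime_of_mem_primeFactors hp).pos
    apply Real.log_le_log
    · rw [← Nat.cast_prod]; exact_mod_cast hpos
    · rw [← Nat.cast_prod]; exact_mod_cast hdvd.trans hnN
  have h3 : (N : ℝ) / 2 * ∑ p ∈ (range (N + 1)).filter Nat.Prime, Real.log p / p ≤ N * Real.log N := by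
    rw [Finset.mul_sum]
    refine (Finset.sum_le_sum h1).trans ?_
    rw [Finset.sum_comm]
    refine (Finset.sum_le_sum h2).trans ?_
    simp
  have h4 : (N : ℝ) / 2 * ∑ p ∈ (range (N + 1)).filter Nat.Prime, Real.log p / p ≤ N / 2 * (2 * Real.log N) := by
    linarith
  exact le_of_mul_le_mul_left h4 (by positivity)

open Finset in
theorem prod_one_sub_inv_le (N : ℕ) (hN : 2 ≤ N) :
    ∏ p ∈ (range (N + 1)).filter Nat.Prime, (1 - 1 / (p : ℝ)) ≤ 1 / Real.log N := by
  have hlog : 0 < Real.log N := Real.log_pos (by exact_mod_cast hN)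
  let f : ℕ →* ℝ :=
    { toFun := fun n => (n : ℝ)⁻¹
      map_one' := by simp
      map_mul' := by intro x y; push_cast; rw [mul_inv] }
  obtain ⟨hs, hsum⟩ := EulerProduct.summable_and_hasSum_smoothNumbers_prod_primesBelow_geometric (f := f) (by
    intro p hp
    have : (1 : ℝ) < p := by exact_mod_cast hp.one_lt
    simp only [f, MonoidHom.coe_mk, OneHom.coe_mk, norm_inv, Real.norm_natCast]
    exact inv_lt_one_of_one_lt₀ this) (N + 1)
  have hle : (harmonic N : ℝ) ≤ ∏ p ∈ (N + 1).primesBelow, (1 - f p)⁻¹ := by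
    rw [harmonic_eq_sum_Icc]
    have hemb : ∀ i ∈ Icc 1 N, i ∈ Nat.smoothNumbers (N + 1) := fun i hi => by
      obtain ⟨h1, h2⟩ := Finset.mem_Icc.mp hi
      exact Nat.mem_smoothNumbers_of_lt (by omega) (by omega)
    classical
    have := sum_le_hasSum ((Icc 1 N).subtype (· ∈ Nat.smoothNumbers (N + 1)))
      (fun i _ => by simp [f]) hsum
    refine le_trans (le_of_eq ?_) this
    rw [Finset.sum_subtype_of_mem (fun i => f i) hemb]
    simp [f]
  have h1 : Real.log N ≤ ∏ p ∈ (N + 1).primesBelow, (1 - f p)⁻¹ := by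
    refine le_trans ?_ (le_trans (log_add_one_le_harmonic N) hle)
    apply Real.log_le_log
    · positivity
    · push_cast; linarith
  have h2 : ∏ p ∈ (N + 1).primesBelow, (1 - f p)⁻¹ = (∏ p ∈ (range (N + 1)).filter Nat.Prime, (1 - 1 / (p : ℝ)))⁻¹ := by
    rw [Finset.prod_inv_distrib]
    simp [Nat.primesBelow, f]
  rw [h2] at h1
  rw [le_div_iff₀ hlog]
  have hpos : 0 < ∏ p ∈ (range (N + 1)).filter Nat.Prime, (1 - 1 / (p : ℝ)) := by
    apply Finset.prod_pos
    intro p hp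
    have : (1 : ℝ) < p := by exact_mod_cast (Finset.mem_filter.mp hp).2.one_lt
    rw [sub_pos, div_lt_one (by linarith)]; exact this
  calc _ ≤ _ := mul_le_mul_of_nonneg_left h1 hpos.le
    _ = 1 := mul_inv_cancel₀ hpos.ne'

open Finset in
theorem prod_one_sub_inv_ge (N : ℕ) (hN : 1 ≤ N) (S : Finset ℕ) (hS : S ⊆ Icc 2 N) :
    1 / (N : ℝ) ≤ ∏ p ∈ S, (1 - 1 / (p : ℝ)) := by
  have h1 : ∏ p ∈ Icc 2 N, (1 - 1 / (p : ℝ)) = 1 / N := by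
    clear hS
    induction N, hN using Nat.le_induction with
    | base => simp
    | succ n hn ih =>
      rw [Finset.prod_Icc_succ_top (by omega), ih]
      have : (n : ℝ) ≠ 0 := by positivity
      push_cast
      field_simp
      ring
  rw [← h1, ← Finset.prod_sdiff hS]
  have hf : ∀ p ∈ Icc 2 N, 0 ≤ (1 - 1 / (p : ℝ)) ∧ (1 - 1 / (p : ℝ)) ≤ 1 := by
    intro p hp
    have : (2 : ℝ) ≤ p := by exact_mod_cast (Finset.mem_Icc.mp hp).1
    constructor
    · rw [sub_nonneg, div_le_one (by linarith)]; linarith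
    · have : 0 ≤ 1 / (p : ℝ) := by positivity
      linarith
  apply mul_le_of_le_one_left
  · exact Finset.prod_nonneg fun p hp => (hf p (hS hp)).1
  · exact Finset.prod_le_one (fun p hp => (hf p (Finset.mem_sdiff.mp hp).1).1) (fun p hp => (hf p (Finset.mem_sdiff.mp hp).1).2)

open Finset in
theorem prod_one_sub_inv_sq_ge (N : ℕ) (S : Finset ℕ) (hS : S ⊆ Icc 2 N) :
    1 / (2 : ℝ) ≤ ∏ p ∈ S, (1 - 1 / (p : ℝ) ^ 2) := by
  have h1 : 1 / (2 : ℝ) ≤ ∏ p ∈ Icc 2 N, (1 - 1 / (p : ℝ) ^ 2) := by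
    rcases Nat.eq_zero_or_pos N with rfl | hN
    · norm_num
    have : ∏ p ∈ Icc 2 N, (1 - 1 / (p : ℝ) ^ 2) = ((N : ℝ) + 1) / (2 * N) := by
      clear hS
      induction N, hN using Nat.le_induction with
      | base => norm_num
      | succ n hn ih =>
        rw [Finset.prod_Icc_succ_top (by omega), ih]
        have : (n : ℝ) ≠ 0 := by positivity
        push_cast
        field_simp
        ring
    rw [this, div_le_div_iff₀ (by norm_num) (by positivity)]
    linarith
  refine h1.trans ?_
  rw [← Finset.prod_sdiff hS]
  have hf : ∀ p ∈ Icc 2 N, 0 ≤ (1 - 1 / (p : ℝ) ^ 2) ∧ (1 - 1 / (p : ℝ) ^ 2) ≤ 1 := by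
    intro p hp
    have : (2 : ℝ) ≤ p := by exact_mod_cast (Finset.mem_Icc.mp hp).1
    constructor
    · rw [sub_nonneg, div_le_one (by positivity)]; nlinarith
    · have : 0 ≤ 1 / (p : ℝ) ^ 2 := by positivity
      linarith
  apply mul_le_of_le_one_left
  · exact Finset.prod_nonneg fun p hp => (hf p (hS hp)).1
  · exact Finset.prod_le_one (fun p hp => (hf p (Finset.mem_sdiff.mp hp).1).1) (fun p hp => (hf p (Finset.mem_sdiff.mp hp).1).2)

open Finset in
/-- The product over a range of primes between `z` and `w`. -/
theorem prod_one_sub_inv_range (z w : ℕ) (hz : 2 ≤ z) (K : ℝ)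
    (hK : Real.log w ≤ K * Real.log z) :
    Real.exp (-(4 * K)) ≤ ∏ p ∈ ((range (w + 1)).filter Nat.Prime).filter (z < ·), (1 - 1 / (p : ℝ)) := by
  have hlog : 0 < Real.log z := Real.log_pos (by exact_mod_cast hz)
  have h1 : ∑ p ∈ ((range (w + 1)).filter Nat.Prime).filter (z < ·), 1 / (p : ℝ) ≤ 2 * K := by
    have : Real.log z * ∑ p ∈ ((range (w + 1)).filter Nat.Prime).filter (z < ·), 1 / (p : ℝ) ≤ Real.log z * (2 * K) := by
      rw [Finset.mul_sum]
      calc _ ≤ ∑ p ∈ ((range (w + 1)).filter Nat.Prime).filter (z < ·), Real.log p / p := by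
            refine Finset.sum_le_sum fun p hp => ?_
            have hzp : z < p := (Finset.mem_filter.mp hp).2
            rw [mul_one_div]
            gcongr
        _ ≤ ∑ p ∈ (range (w + 1)).filter Nat.Prime, Real.log p / p :=
            Finset.sum_le_sum_of_subset_of_nonneg (Finset.filter_subset _ _) fun p _ _ =>
              div_nonneg (Real.log_natCast_nonneg p) (by positivity)
        _ ≤ 2 * Real.log w := sum_log_div_le w
        _ ≤ _ := by linarith
    exact le_of_mul_le_mul_left this hlog
  calc Real.exp (-(4 * K)) ≤ Real.exp (∑ p ∈ ((range (w + 1)).filter Nat.Prime).filter (z < ·), -(2 * (1 / (p : ℝ)))) := by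
        apply Real.exp_le_exp.mpr
        rw [Finset.sum_neg_distrib, ← Finset.mul_sum]; linarith
    _ = ∏ p ∈ ((range (w + 1)).filter Nat.Prime).filter (z < ·), Real.exp (-(2 * (1 / (p : ℝ)))) := Real.exp_sum _ _
    _ ≤ _ := by
        refine Finset.prod_le_prod (fun _ _ => (Real.exp_pos _).le) fun p hp => ?_
        have hzp : z < p := (Finset.mem_filter.mp hp).2
        have hp : (2 : ℝ) ≤ p := by exact_mod_cast (by omega : 2 ≤ p)
        set t := 1 / (p : ℝ) with ht
        have ht0 : 0 ≤ t := by positivity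
        have ht1 : t ≤ 1 / 2 := by rw [ht]; gcongr
        rw [Real.exp_neg]
        apply inv_le_of_inv_le₀ (by linarith)
        have := Real.add_one_le_exp (2 * t)
        refine le_trans ?_ this
        rw [inv_le_iff_one_le_mul₀ (by linarith)]
        nlinarith

/-- The number of square roots of `-a` modulo `d`. -/
noncomputable def rootCount (a d : ℕ) : ℕ := Nat.card {x : ZMod d // x ^ 2 = -(a : ZMod d)}

theorem rootCount_one (a : ℕ) : rootCount a 1 = 1 := by
  unfold rootCount
  rw [Nat.card_eq_one_iff_unique]
  exact ⟨⟨fun x y => Subtype.ext (Subsingleton.elim (α := ZMod 1) _ _)⟩, ⟨⟨0, Subsingleton.elim (α := ZMod 1) _ _⟩⟩⟩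

theorem rootCount_mul (a m n : ℕ) (h : m.Coprime n) :
    rootCount a (m * n) = rootCount a m * rootCount a n := by
  unfold rootCount
  rw [← Nat.card_prod]
  let e := ZMod.chineseRemainder h
  refine Nat.card_congr ((e.toEquiv.subtypeEquiv (q := fun y : ZMod m × ZMod n =>
    y.1 ^ 2 = -(a : ZMod m) ∧ y.2 ^ 2 = -(a : ZMod n)) fun x => ?_).trans ?_)
  · rw [← e.injective.eq_iff]
    simp only [map_pow, map_neg, map_natCast, Prod.ext_iff]
    rfl
  · exact
      { toFun := fun x => (⟨x.1.1, x.2.1⟩, ⟨x.1.2, x.2.2⟩)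
        invFun := fun y => ⟨(y.1.1, y.2.1), y.1.2, y.2.2⟩
        left_inv := fun x => rfl
        right_inv := fun y => rfl }

theorem rootCount_le (a d : ℕ) (hd : 0 < d) : rootCount a d ≤ d := by
  have : NeZero d := ⟨hd.ne'⟩
  unfold rootCount
  calc _ ≤ Nat.card (ZMod d) := Nat.card_le_card_of_injective _ Subtype.val_injective
    _ = d := Nat.card_zmod d

theorem rootCount_prime (a p : ℕ) (hp : p.Prime) (hp2 : p ≠ 2) :
    (rootCount a p : ℝ) = 1 + (jacobiSym (-4 * (a : ℤ)) p : ℝ) := by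
  have : Fact p.Prime := ⟨hp⟩
  have h := legendreSym.card_sqrts p hp2 (-(a : ℤ))
  have h2 : rootCount a p = {x : ZMod p | x ^ 2 = ((-(a : ℤ) : ℤ) : ZMod p)}.toFinset.card := by
    unfold rootCount
    rw [Set.toFinset_card, ← Nat.card_eq_fintype_card]
    push_cast
    rfl
  have h3 : jacobiSym (-4 * (a : ℤ)) p = legendreSym p (-(a : ℤ)) := by
    rw [← jacobiSym.legendreSym.to_jacobiSym, show (-4 * (a : ℤ)) = 2 ^ 2 * (-(a : ℤ)) by ring,
      legendreSym.mul, legendreSym.sq_one' p, one_mul]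
    intro h0
    have h1 : ((2 : ℕ) : ZMod p) = 0 := by exact_mod_cast h0
    rw [ZMod.natCast_eq_zero_iff] at h1
    exact hp2 ((Nat.prime_dvd_prime_iff_eq hp Nat.prime_two).mp h1)
  rw [h3]
  have : (rootCount a p : ℤ) = legendreSym p (-(a : ℤ)) + 1 := by rw [h2]; exact h
  have h4 : ((rootCount a p : ℤ) : ℝ) = ((legendreSym p (-(a : ℤ)) + 1 : ℤ) : ℝ) := by rw [this]
  push_cast at h4
  linarith

theorem dvd_iff_root (a d m : ℕ) : d ∣ m ^ 2 + a ↔ (m : ZMod d) ^ 2 = -(a : ZMod d) := by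
  rw [← ZMod.natCast_eq_zero_iff]; push_cast
  exact eq_neg_iff_add_eq_zero.symm

open Finset in
theorem card_period (a d : ℕ) (hd : 0 < d) :
    ((range d).filter (fun m => d ∣ m ^ 2 + a)).card = rootCount a d := by
  have : NeZero d := ⟨hd.ne'⟩
  unfold rootCount
  classical
  rw [Nat.card_eq_fintype_card, Fintype.card_subtype]
  refine Finset.card_bij (fun m _ => (m : ZMod d)) ?_ ?_ ?_
  · intro m hm
    simpa [dvd_iff_root] using (Finset.mem_filter.mp hm).2
  · intro m hm n hn h
    have hm := Finset.mem_range.mp (Finset.mem_filter.mp hm).1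
    have hn := Finset.mem_range.mp (Finset.mem_filter.mp hn).1
    have := (ZMod.natCast_eq_natCast_iff' m n d).mp h
    rwa [Nat.mod_eq_of_lt hm, Nat.mod_eq_of_lt hn] at this
  · intro x hx
    refine ⟨x.val, ?_, ZMod.natCast_zmod_val x⟩
    rw [Finset.mem_filter, Finset.mem_range, dvd_iff_root, ZMod.natCast_zmod_val]
    exact ⟨ZMod.val_lt x, (Finset.mem_filter.mp hx).2⟩

open Finset in
theorem root_dist (a d N : ℕ) (hd : 0 < d) :
    |(((range N).filter (fun m => d ∣ m ^ 2 + a)).card : ℝ) - (rootCount a d : ℝ) / d * N| ≤ d := by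
  have key : ∀ q r : ℕ, r < d → ((range (d * q + r)).filter (fun m => d ∣ m ^ 2 + a)).card
      = q * rootCount a d + ((range r).filter (fun m => d ∣ m ^ 2 + a)).card := by
    intro q r _
    have per : ∀ q m : ℕ, d ∣ (d * q + m) ^ 2 + a ↔ d ∣ m ^ 2 + a := by
      intro q m
      rw [show (d * q + m) ^ 2 + a = d * (d * q ^ 2 + 2 * q * m) + (m ^ 2 + a) by ring]
      exact Nat.dvd_add_right (dvd_mul_right _ _)
    have step : ∀ q t : ℕ, ((range (d * q + t)).filter (fun m => d ∣ m ^ 2 + a)).card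
      = ((range (d * q)).filter (fun m => d ∣ m ^ 2 + a)).card + ((range t).filter (fun m => d ∣ m ^ 2 + a)).card := by
      intro q t
      rw [← Nat.count_eq_card_filter_range, ← Nat.count_eq_card_filter_range, ← Nat.count_eq_card_filter_range, Nat.count_add]
      congr 1
      simp only [per]
    rw [step]
    congr 1
    induction q with
    | zero => simp
    | succ q ih => rw [Nat.mul_succ, step, ih, card_period a d hd]; ring
  have hdr : (0 : ℝ) < d := by exact_mod_cast hd
  have hr := Nat.mod_lt N hd
  have hN := Nat.div_add_mod N d
  set q := N / d
  set r := N % d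
  have hk := key q r hr
  rw [hN] at hk
  rw [hk]
  have hc : (((range r).filter (fun m => d ∣ m ^ 2 + a)).card : ℝ) ≤ d := by
    have := Finset.card_filter_le (range r) (fun m => d ∣ m ^ 2 + a)
    rw [Finset.card_range] at this
    exact_mod_cast this.trans hr.le
  have hc0 : 0 ≤ (((range r).filter (fun m => d ∣ m ^ 2 + a)).card : ℝ) := by positivity
  set c := (((range r).filter (fun m => d ∣ m ^ 2 + a)).card)
  have hω : (rootCount a d : ℝ) ≤ d := by exact_mod_cast rootCount_le a d hd
  have hω0 : (0 : ℝ) ≤ rootCount a d := by positivity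
  have hNr : (N : ℝ) = d * q + r := by exact_mod_cast hN.symm
  have hrr : (r : ℝ) ≤ d := by exact_mod_cast hr.le
  have e : ((q * rootCount a d + c : ℕ) : ℝ) - (rootCount a d : ℝ) / d * N = c - rootCount a d / d * r := by
    rw [hNr]; push_cast; field_simp; ring
  rw [e]
  have h1 : (rootCount a d : ℝ) / d ≤ 1 := by rw [div_le_one hdr]; exact hω
  have h0 : 0 ≤ (rootCount a d : ℝ) / d := by positivity
  have h2 : (rootCount a d : ℝ) / d * r ≤ d := by
    calc _ ≤ 1 * (r : ℝ) := by gcongr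
      _ ≤ d := by linarith
  have h3 : 0 ≤ (rootCount a d : ℝ) / d * r := by positivity
  rw [abs_le]; constructor <;> linarith

/-- The sieve density. -/
noncomputable def sieveNu (a : ℕ) : ArithmeticFunction ℝ :=
  ⟨fun d => (rootCount a d : ℝ) / d, by simp⟩

theorem sieveNu_apply (a d : ℕ) : sieveNu a d = (rootCount a d : ℝ) / d := rfl

theorem sieveNu_mult (a : ℕ) : (sieveNu a).IsMultiplicative := by
  refine ⟨by simp [sieveNu_apply, rootCount_one], ?_⟩
  intro m n h
  simp only [sieveNu_apply, rootCount_mul a m n h]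
  push_cast
  rw [mul_div_mul_comm]

open Finset in
/-- The sifting primes. -/
def siftPrimes (a z : ℕ) : Finset ℕ :=
  (range (z + 1)).filter (fun p => p.Prime ∧ p ≠ 2 ∧ jacobiSym (-4 * (a : ℤ)) p ≠ -1)

theorem jac_cases (b : ℤ) (p : ℕ) : (jacobiSym b p : ℝ) = 0 ∨ (jacobiSym b p : ℝ) = 1 ∨ (jacobiSym b p : ℝ) = -1 := by
  rcases jacobiSym.trichotomy b p with h | h | h <;> rw [h] <;> simp

theorem siftPrimes_nu (a z p : ℕ) (hp : p ∈ siftPrimes a z) :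
    p.Prime ∧ 3 ≤ p ∧ p ≤ z ∧ sieveNu a p = (1 + (jacobiSym (-4 * (a : ℤ)) p : ℝ)) / p ∧
      1 / (p : ℝ) ≤ sieveNu a p ∧ sieveNu a p ≤ 2 / p := by
  simp only [siftPrimes, Finset.mem_filter, Finset.mem_range] at hp
  obtain ⟨hpz, hpp, hp2, hj⟩ := hp
  have h2 := hpp.two_le
  have hν : sieveNu a p = (1 + (jacobiSym (-4 * (a : ℤ)) p : ℝ)) / p := by
    rw [sieveNu_apply, rootCount_prime a p hpp hp2]
  have hj' : (jacobiSym (-4 * (a : ℤ)) p : ℝ) ≠ -1 := by exact_mod_cast hj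
  refine ⟨hpp, by omega, by omega, hν, ?_, ?_⟩ <;> rw [hν] <;> gcongr <;>
    rcases jac_cases (-4 * (a : ℤ)) p with h | h | h <;>
    first | exact absurd h hj' | (rw [h]; norm_num)

open Finset in
theorem sieve_count (a z N : ℕ) (hz : 2 ≤ z) :
    (((range N).filter (fun m => (m ^ 2 + a).Prime)).card : ℝ) ≤
      N * (2 * ∏ p ∈ siftPrimes a z, (1 - sieveNu a p)) + (z : ℝ) ^ 48 + (z + 1) := by
  set S := siftPrimes a z with hS
  have hSp : ∀ p ∈ S, p.Prime := fun p hp => (siftPrimes_nu a z p hp).1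
  have hpf : (∏ p ∈ S, p).primeFactors = S := Nat.primeFactors_prod hSp
  have hmem : ∀ p : ℕ, p.Prime → p ∣ ∏ p ∈ S, p → p ∈ S := by
    intro p hp hd
    rw [← hpf]
    exact Nat.mem_primeFactors.mpr ⟨hp, hd, Finset.prod_ne_zero_iff.mpr fun q hq => (hSp q hq).ne_zero⟩
  have hinj : ∀ x ∈ range N, ∀ y ∈ range N, x ^ 2 + a = y ^ 2 + a → x = y := by
    intro x _ y _ h
    exact Nat.pow_left_injective (n := 2) (by norm_num) (by simpa using h)
  let s : BoundingSieve :=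
    { support := (range N).image (fun m => m ^ 2 + a)
      prodPrimes := ∏ p ∈ S, p
      prodPrimes_squarefree := by
        refine Squarefree.squarefree_of_dvd ?_ (squarefree_primorial z)
        rw [primorial_eq_prod_primesLE]
        apply Finset.prod_dvd_prod_of_subset
        intro p hp
        obtain ⟨h1, _, h3, _⟩ := siftPrimes_nu a z p hp
        exact Nat.mem_primesLE.mpr ⟨h3, h1⟩
      weights := fun _ => 1
      weights_nonneg := fun _ => zero_le_one
      totalMass := N
      nu := sieveNu a
      nu_mult := sieveNu_mult a
      nu_pos_of_prime := by
        intro p hp hd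
        obtain ⟨_, h2, _, _, h3, _⟩ := siftPrimes_nu a z p (hmem p hp hd)
        refine lt_of_lt_of_le ?_ h3
        have : (0 : ℝ) < p := by exact_mod_cast hp.pos
        positivity
      nu_lt_one_of_prime := by
        intro p hp hd
        obtain ⟨_, h2, _, _, _, h3⟩ := siftPrimes_nu a z p (hmem p hp hd)
        refine lt_of_le_of_lt h3 ?_
        have : (3 : ℝ) ≤ p := by exact_mod_cast h2
        rw [div_lt_one (by linarith)]; linarith }
  have hzr : (2 : ℝ) ≤ z := by exact_mod_cast hz
  have hP0 : ∏ p ∈ S, p ≠ 0 := Finset.prod_ne_zero_iff.mpr fun q hq => (hSp q hq).ne_zero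
  have hsel := selberg_bound s (z ^ 8) (Nat.one_le_pow _ _ (by omega))
    (by
      intro d hd
      have hpos : 0 < sieveNu a d := BoundingSieve.nu_pos_of_dvd_prodPrimes (s := s) hd
      have hd0 : 0 < d := Nat.pos_of_dvd_of_pos hd (Nat.pos_of_ne_zero hP0)
      change (sieveNu a d)⁻¹ ≤ d
      rw [sieveNu_apply] at hpos ⊢
      have hc : rootCount a d ≠ 0 := by
        intro h; rw [h] at hpos; simp at hpos
      have hc' : (1 : ℝ) ≤ rootCount a d := by exact_mod_cast Nat.one_le_iff_ne_zero.mpr hc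
      rw [inv_div]
      exact div_le_self (by positivity) hc')
    (by
      intro d hd
      have hd0 : 0 < d := Nat.pos_of_dvd_of_pos hd (Nat.pos_of_ne_zero hP0)
      have h := root_dist a d N hd0
      have e : s.rem d = (((range N).filter (fun m => d ∣ m ^ 2 + a)).card : ℝ) - (rootCount a d : ℝ) / d * N := by
        simp only [BoundingSieve.rem, BoundingSieve.multSum, s]
        rw [Finset.sum_image hinj, ← Finset.sum_filter, Finset.sum_const, nsmul_eq_mul, mul_one,
          sieveNu_apply]
      rw [e]; exact h)
  have hlow := selberg_sum_lower s (z ^ 8) (by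
      calc 2 ≤ z := hz
        _ ≤ z ^ 8 := Nat.le_self_pow (by norm_num) z) (by
      change ∑ p ∈ (∏ p ∈ S, p).primeFactors, sieveNu a p * Real.log p ≤ _
      rw [hpf]
      calc _ ≤ ∑ p ∈ S, 2 * (Real.log p / p) := by
            refine Finset.sum_le_sum fun p hp => ?_
            obtain ⟨_, h2, _, _, _, h3⟩ := siftPrimes_nu a z p hp
            calc sieveNu a p * Real.log p ≤ 2 / p * Real.log p :=
                  mul_le_mul_of_nonneg_right h3 (Real.log_natCast_nonneg p)
              _ = _ := by ring
        _ ≤ ∑ p ∈ (range (z + 1)).filter Nat.Prime, 2 * (Real.log p / p) := by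
            apply Finset.sum_le_sum_of_subset_of_nonneg
            · intro p hp
              obtain ⟨h1, h2, h3, _⟩ := siftPrimes_nu a z p hp
              simp only [Finset.mem_filter, Finset.mem_range]
              exact ⟨by omega, h1⟩
            · intro p _ _
              have := Real.log_natCast_nonneg p
              positivity
        _ ≤ 2 * (2 * Real.log z) := by
            rw [← Finset.mul_sum]
            have := sum_log_div_le z
            linarith
        _ = Real.log (z ^ 8 : ℕ) / 2 := by
            push_cast; rw [Real.log_pow]; push_cast; ring)
  have hpf' : s.prodPrimes.primeFactors = S := hpf
  rw [hpf', Finset.prod_inv_distrib] at hlow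
  set G := ∑ l ∈ s.prodPrimes.divisors.filter (· ≤ z ^ 8), s.selbergTerms l with hG
  change _ ≤ G at hlow
  set F := ∏ p ∈ S, (1 - s.nu p) with hF
  have hFpos : 0 < F := by
    apply Finset.prod_pos
    intro p hp
    have := s.nu_lt_one_of_prime p (hSp p hp) (Finset.dvd_prod_of_mem _ hp)
    linarith
  have hFeq : ∏ p ∈ S, (1 - sieveNu a p) = F := rfl
  have hinvG : (N : ℝ) / G ≤ N * (2 * F) := by
    rw [div_eq_mul_inv]
    gcongr
    apply inv_le_of_inv_le₀ (by positivity)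
    refine le_trans (le_of_eq ?_) hlow
    rw [mul_inv]; ring
  have hsift : s.siftedSum = (((range N).filter (fun m => Nat.Coprime (∏ p ∈ S, p) (m ^ 2 + a))).card : ℝ) := by
    simp only [BoundingSieve.siftedSum, s]
    rw [Finset.sum_image hinj, ← Finset.sum_filter, Finset.sum_const, nsmul_eq_mul, mul_one]
  have hcard : ((range N).filter (fun m => (m ^ 2 + a).Prime)).card ≤
      ((range N).filter (fun m => Nat.Coprime (∏ p ∈ S, p) (m ^ 2 + a))).card + (z + 1) := by
    calc _ ≤ (((range N).filter (fun m => Nat.Coprime (∏ p ∈ S, p) (m ^ 2 + a))) ∪ range (z + 1)).card := by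
          apply Finset.card_le_card
          intro m hm
          obtain ⟨hmN, hmp⟩ := Finset.mem_filter.mp hm
          rw [Finset.mem_union]
          by_cases hc : Nat.Coprime (∏ p ∈ S, p) (m ^ 2 + a)
          · left; exact Finset.mem_filter.mpr ⟨hmN, hc⟩
          · right
            rw [Nat.coprime_comm, hmp.coprime_iff_not_dvd, not_not] at hc
            obtain ⟨_, _, h3, _⟩ := siftPrimes_nu a z _ (hmem _ hmp hc)
            rw [Finset.mem_range]
            have : m ≤ m ^ 2 := Nat.le_self_pow (by norm_num) m
            omega
      _ ≤ _ := by
          refine (Finset.card_union_le _ _).trans ?_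
          rw [Finset.card_range]
  have hcard' : (((range N).filter (fun m => (m ^ 2 + a).Prime)).card : ℝ) ≤ s.siftedSum + (z + 1) := by
    rw [hsift]; exact_mod_cast hcard
  have hmass : s.totalMass = N := rfl
  rw [hmass] at hsel
  have h48 : (((z ^ 8 : ℕ) : ℝ)) ^ 6 = (z : ℝ) ^ 48 := by push_cast; ring
  rw [h48] at hsel
  linarith

open Finset in
/-- Comparison of the sieve product with the character product. -/
theorem sieve_prod_le (a z : ℕ) (hz : 2 ≤ z) :
    ∏ p ∈ siftPrimes a z, (1 - sieveNu a p) ≤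
      4 / Real.log z * ∏ p ∈ (range (z + 1)).filter Nat.Prime,
        (1 - (jacobiSym (-4 * (a : ℤ)) p : ℝ) / p) := by
  set χ : ℕ → ℝ := fun p => (jacobiSym (-4 * (a : ℤ)) p : ℝ) with hχ
  set A := (range (z + 1)).filter Nat.Prime with hA
  set O := A.erase 2 with hO
  have h2A : 2 ∈ A := by
    simp only [hA, Finset.mem_filter, Finset.mem_range]
    exact ⟨by omega, Nat.prime_two⟩
  have hOp : ∀ p ∈ O, p.Prime ∧ 3 ≤ p ∧ p ≤ z := by
    intro p hp
    simp only [hO, hA, Finset.mem_erase, Finset.mem_filter, Finset.mem_range] at hp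
    have := hp.2.2.two_le
    exact ⟨hp.2.2, by omega, by omega⟩
  have h1 : ∏ p ∈ siftPrimes a z, (1 - sieveNu a p) = ∏ p ∈ O, (1 - (1 + χ p) / p) := by
    have hsub : siftPrimes a z ⊆ O := by
      intro p hp
      obtain ⟨h1, h2, h3, _⟩ := siftPrimes_nu a z p hp
      simp only [hO, hA, Finset.mem_erase, Finset.mem_filter, Finset.mem_range]
      exact ⟨by omega, by omega, h1⟩
    rw [← Finset.prod_subset hsub]
    · refine Finset.prod_congr rfl fun p hp => ?_
      rw [(siftPrimes_nu a z p hp).2.2.2.1]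
    · intro p hp hp'
      obtain ⟨h1, h2, h3⟩ := hOp p hp
      have : jacobiSym (-4 * (a : ℤ)) p = -1 := by
        by_contra hne
        apply hp'
        simp only [siftPrimes, Finset.mem_filter, Finset.mem_range]
        exact ⟨by omega, h1, by omega, hne⟩
      have e : χ p = -1 := by simp only [hχ]; rw [this]; simp
      rw [e]; simp
  have h2 : (∏ p ∈ O, (1 - (1 + χ p) / p)) * ∏ p ∈ O, (1 - 1 / (p : ℝ) ^ 2) ≤
      (∏ p ∈ O, (1 - 1 / (p : ℝ))) * ∏ p ∈ O, (1 - χ p / p) := by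
    rw [← Finset.prod_mul_distrib, ← Finset.prod_mul_distrib]
    have ht : ∀ p ∈ O, 0 < 1 / (p : ℝ) ∧ 1 / (p : ℝ) ≤ 1 / 3 := by
      intro p hp
      obtain ⟨h1, h2, h3⟩ := hOp p hp
      have : (3 : ℝ) ≤ p := by exact_mod_cast h2
      exact ⟨by positivity, by gcongr⟩
    have hrw : ∀ p : ℕ, (1 - (1 + χ p) / p) * (1 - 1 / (p : ℝ) ^ 2) =
        (1 - (1 + χ p) * (1 / (p : ℝ))) * (1 - (1 / (p : ℝ)) ^ 2) := by
      intro p; rw [one_div_pow]; ring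
    have hrw' : ∀ p : ℕ, (1 - χ p / p) = 1 - χ p * (1 / (p : ℝ)) := by
      intro p; ring
    apply Finset.prod_le_prod
    · intro p hp
      obtain ⟨h1, h2⟩ := ht p hp
      rw [hrw]
      rcases jac_cases (-4 * (a : ℤ)) p with h | h | h <;> simp only [hχ, h] <;>
        apply mul_nonneg <;> nlinarith
    · intro p hp
      obtain ⟨h1, h2⟩ := ht p hp
      rw [hrw, hrw']
      set t := 1 / (p : ℝ)
      rcases jac_cases (-4 * (a : ℤ)) p with h | h | h <;> simp only [hχ, h]
      · nlinarith [mul_nonneg (sq_nonneg t) (by linarith : 0 ≤ 1 - t)]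
      · nlinarith [mul_nonneg (sq_nonneg t) (by linarith : 0 ≤ 1 - 2 * t), sq_nonneg t]
      · nlinarith
  have hOsub : O ⊆ Icc 2 z := by
    intro p hp
    obtain ⟨h1, h2, h3⟩ := hOp p hp
    exact Finset.mem_Icc.mpr ⟨by omega, h3⟩
  have h3 := prod_one_sub_inv_sq_ge z O hOsub
  have h4 := prod_one_sub_inv_le z hz
  have h5 : ∏ p ∈ A, (1 - 1 / (p : ℝ)) = (1 / 2) * ∏ p ∈ O, (1 - 1 / (p : ℝ)) := by
    rw [← Finset.mul_prod_erase A _ h2A, ← hO]; norm_num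
  have h6 : ∏ p ∈ A, (1 - χ p / p) = ∏ p ∈ O, (1 - χ p / p) := by
    rw [← Finset.mul_prod_erase A _ h2A]
    have : jacobiSym (-4 * (a : ℤ)) 2 = 0 := by
      rw [jacobiSym.eq_zero_iff_not_coprime]
      intro h
      have h2 : (2 : ℕ) ∣ Int.gcd (-4 * (a : ℤ)) (2 : ℕ) := by
        apply Int.dvd_gcd
        · exact ⟨-2 * a, by push_cast; ring⟩
        · simp
      rw [h] at h2
      omega
    have e : χ 2 = 0 := by
      change ((jacobiSym (-4 * (a : ℤ)) 2 : ℤ) : ℝ) = 0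
      rw [this]; simp
    rw [e, ← hO]; simp
  have hfac : ∀ p ∈ O, 0 ≤ 1 - (1 + χ p) / p ∧ 0 ≤ 1 - χ p / p := by
    intro p hp
    obtain ⟨_, hp3, _⟩ := hOp p hp
    have : (3 : ℝ) ≤ p := by exact_mod_cast hp3
    constructor <;> rw [sub_nonneg, div_le_one (by linarith)] <;>
      rcases jac_cases (-4 * (a : ℤ)) p with h | h | h <;> simp only [hχ, h] <;> linarith
  have h7 : 0 ≤ ∏ p ∈ O, (1 - (1 + χ p) / p) := Finset.prod_nonneg fun p hp => (hfac p hp).1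
  have h8 : 0 ≤ ∏ p ∈ O, (1 - χ p / p) := Finset.prod_nonneg fun p hp => (hfac p hp).2
  rw [h5] at h4
  rw [h1, h6]
  set U := ∏ p ∈ O, (1 - (1 + χ p) / p)
  set V := ∏ p ∈ O, (1 - χ p / p)
  set W := ∏ p ∈ O, (1 - 1 / (p : ℝ))
  calc U ≤ 2 * (U * ∏ p ∈ O, (1 - 1 / (p : ℝ) ^ 2)) := by nlinarith
    _ ≤ 2 * (W * V) := by linarith
    _ ≤ 2 * ((2 / Real.log z) * V) := by
        gcongr
        have : 2 / Real.log z = 2 * (1 / Real.log z) := by ring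
        rw [this]; linarith
    _ = _ := by ring

open Finset in
/-- Lower bounds for the target product. -/
theorem target_prod (a z w : ℕ) (hz : 2 ≤ z) (hzw : z ≤ w) (K : ℝ)
    (hK : Real.log w ≤ K * Real.log z) :
    (∏ p ∈ (range (z + 1)).filter Nat.Prime, (1 - (jacobiSym (-4 * (a : ℤ)) p : ℝ) / p)) ≤
      Real.exp (4 * K) * ∏ p ∈ (range (w + 1)).filter Nat.Prime, (1 - (jacobiSym (-4 * (a : ℤ)) p : ℝ) / p)
    ∧ 1 / (w : ℝ) ≤ ∏ p ∈ (range (w + 1)).filter Nat.Prime, (1 - (jacobiSym (-4 * (a : ℤ)) p : ℝ) / p) := by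
  have hfac : ∀ p : ℕ, p.Prime → 0 ≤ 1 - 1 / (p : ℝ) ∧
      1 - 1 / (p : ℝ) ≤ 1 - (jacobiSym (-4 * (a : ℤ)) p : ℝ) / p := by
    intro p hp
    have : (2 : ℝ) ≤ p := by exact_mod_cast hp.two_le
    constructor
    · rw [sub_nonneg, div_le_one (by linarith)]; linarith
    · gcongr
      rcases jac_cases (-4 * (a : ℤ)) p with h | h | h <;> rw [h] <;> norm_num
  constructor
  · have h1 := prod_one_sub_inv_range z w hz K hK
    have h2 : ∏ p ∈ ((range (w + 1)).filter Nat.Prime).filter (z < ·), (1 - 1 / (p : ℝ)) ≤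
        ∏ p ∈ ((range (w + 1)).filter Nat.Prime).filter (z < ·), (1 - (jacobiSym (-4 * (a : ℤ)) p : ℝ) / p) := by
      apply Finset.prod_le_prod
      · intro p hp; exact (hfac p (Finset.mem_filter.mp (Finset.mem_filter.mp hp).1).2).1
      · intro p hp; exact (hfac p (Finset.mem_filter.mp (Finset.mem_filter.mp hp).1).2).2
    rw [← Finset.prod_filter_mul_prod_filter_not ((range (w + 1)).filter Nat.Prime) (z < ·)]
    have h3 : ((range (w + 1)).filter Nat.Prime).filter (¬ z < ·) = (range (z + 1)).filter Nat.Prime := by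
      ext p
      simp only [Finset.mem_filter, Finset.mem_range]
      constructor
      · rintro ⟨⟨_, h⟩, h'⟩; exact ⟨by omega, h⟩
      · rintro ⟨h, h'⟩; exact ⟨⟨by omega, h'⟩, by omega⟩
    rw [h3]
    have h4 : 0 ≤ ∏ p ∈ (range (z + 1)).filter Nat.Prime, (1 - (jacobiSym (-4 * (a : ℤ)) p : ℝ) / p) :=
      Finset.prod_nonneg fun p hp => by
        obtain ⟨e1, e2⟩ := hfac p (Finset.mem_filter.mp hp).2
        linarith
    set V := ∏ p ∈ (range (z + 1)).filter Nat.Prime, (1 - (jacobiSym (-4 * (a : ℤ)) p : ℝ) / p)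
    calc V = Real.exp (4 * K) * (Real.exp (-(4 * K)) * V) := by
          rw [← mul_assoc, ← Real.exp_add]; simp
      _ ≤ _ := by
          gcongr
          exact h1.trans h2
  · refine (prod_one_sub_inv_ge w (by omega) ((range (w + 1)).filter Nat.Prime) ?_).trans ?_
    · intro p hp
      simp only [Finset.mem_filter, Finset.mem_range] at hp
      exact Finset.mem_Icc.mpr ⟨hp.2.two_le, by omega⟩
    · apply Finset.prod_le_prod
      · intro p hp; exact (hfac p (Finset.mem_filter.mp hp).2).1
      · intro p hp; exact (hfac p (Finset.mem_filter.mp hp).2).2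

open Finset in
/-- Sieve bound: for fixed `u ≥ 1` there are a constant `C > 0` and a threshold
`X₀` (depending only on `u`) such that for all `X ≥ X₀` and every integer
`1 ≤ a ≤ X`, the number of primes `p` with `up ≤ X` and `p = a + m²` for some
`m ∈ ℤ` is at most `C·(√X/log X)·∏_{p ≤ X^{1/4}} (1 - χ_{-4a}(p)/p)`,
where `χ_{-4a}(p)` is the Kronecker symbol `(-4a/p)` (for primes `p` this is
the Jacobi symbol `J(-4a | p)`). -/
theorem stmt5 (u : ℕ) (hu : 1 ≤ u) :
    ∃ C > 0, ∃ X₀ : ℝ, ∀ X : ℝ, X₀ ≤ X → ∀ a : ℕ, 1 ≤ a → (a : ℝ) ≤ X →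
      ({p : ℕ | p.Prime ∧ (u * p : ℝ) ≤ X ∧ ∃ m : ℤ, (p : ℤ) = a + m ^ 2}.ncard : ℝ) ≤
        C * (Real.sqrt X / Real.log X) *
          ∏ p ∈ (range (⌊X⌋₊ + 1)).filter
              (fun p : ℕ => p.Prime ∧ (p : ℝ) ≤ X ^ ((1 : ℝ) / 4)),
            (1 - (jacobiSym (-4 * (a : ℤ)) p : ℝ) / p) := by
  refine ⟨7680 * Real.exp (4 * 120) + 60, by positivity, 2 ^ 240, ?_⟩
  intro X hX a ha haX
  have hX2 : (2 : ℝ) ≤ X := le_trans (by norm_num) hX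
  have hX1 : (1 : ℝ) ≤ X := by linarith
  have hX0 : (0 : ℝ) < X := by linarith
  have hlogX : 0 < Real.log X := Real.log_pos (by linarith)
  set z := ⌊X ^ ((1 : ℝ) / 240)⌋₊ with hzdef
  set w := ⌊X ^ ((1 : ℝ) / 4)⌋₊ with hwdef
  set N := ⌊Real.sqrt X⌋₊ + 1 with hNdef
  have hz : 2 ≤ z := by
    apply Nat.le_floor
    calc ((2 : ℕ) : ℝ) = ((2 : ℝ) ^ (240 : ℝ)) ^ ((1 : ℝ) / 240) := by
          rw [← Real.rpow_mul (by norm_num)]; norm_num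
      _ ≤ X ^ ((1 : ℝ) / 240) := by
          gcongr
          refine le_trans (le_of_eq ?_) hX
          exact_mod_cast Real.rpow_natCast (2 : ℝ) 240
  have hzr : (2 : ℝ) ≤ z := by exact_mod_cast hz
  have hzw : z ≤ w := by
    apply Nat.floor_mono
    apply Real.rpow_le_rpow_of_exponent_le hX1; norm_num
  have hzle : (z : ℝ) ≤ X ^ ((1 : ℝ) / 240) := Nat.floor_le (by positivity)
  have hwle : (w : ℝ) ≤ X ^ ((1 : ℝ) / 4) := Nat.floor_le (by positivity)
  have hw0 : (0 : ℝ) < w := by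
    have : (z : ℝ) ≤ w := by exact_mod_cast hzw
    linarith
  have hlogz : 0 < Real.log z := Real.log_pos (by linarith)
  have hXz : Real.log X ≤ 480 * Real.log z := by
    have h1 : X ^ ((1 : ℝ) / 240) ≤ (z : ℝ) ^ 2 := by
      have := (Nat.lt_floor_add_one (X ^ ((1 : ℝ) / 240))).le
      rw [← hzdef] at this
      nlinarith
    have h2 := Real.log_le_log (by positivity) h1
    rw [Real.log_rpow hX0, Real.log_pow] at h2
    push_cast at h2
    linarith
  have hK : Real.log w ≤ 120 * Real.log z := by
    have h2 := Real.log_le_log hw0 hwle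
    rw [Real.log_rpow hX0] at h2
    linarith
  have hset : (range (⌊X⌋₊ + 1)).filter (fun p : ℕ => p.Prime ∧ (p : ℝ) ≤ X ^ ((1 : ℝ) / 4))
      = (range (w + 1)).filter Nat.Prime := by
    ext p
    simp only [Finset.mem_filter, Finset.mem_range, Nat.lt_succ_iff]
    constructor
    · rintro ⟨_, h1, h2⟩
      exact ⟨Nat.le_floor h2, h1⟩
    · rintro ⟨h1, h2⟩
      have h3 : (p : ℝ) ≤ X ^ ((1 : ℝ) / 4) := le_trans (by exact_mod_cast h1) hwle
      refine ⟨Nat.le_floor (h3.trans ?_), h2, h3⟩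
      calc X ^ ((1 : ℝ) / 4) ≤ X ^ (1 : ℝ) := Real.rpow_le_rpow_of_exponent_le hX1 (by norm_num)
        _ = X := Real.rpow_one X
  rw [hset]
  obtain ⟨ht1, ht2⟩ := target_prod a z w hz hzw 120 hK
  have hs := sieve_count a z N hz
  have hp := sieve_prod_le a z hz
  set Q := ∏ p ∈ (range (w + 1)).filter Nat.Prime, (1 - (jacobiSym (-4 * (a : ℤ)) p : ℝ) / p)
  set V := ∏ p ∈ (range (z + 1)).filter Nat.Prime, (1 - (jacobiSym (-4 * (a : ℤ)) p : ℝ) / p)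
  have hQ0 : 0 < Q := lt_of_lt_of_le (by positivity) ht2
  have hcount : {p : ℕ | p.Prime ∧ (u * p : ℝ) ≤ X ∧ ∃ m : ℤ, (p : ℤ) = a + m ^ 2}.ncard ≤
      ((range N).filter (fun m => (m ^ 2 + a).Prime)).card := by
    refine le_trans ?_ (Finset.card_image_le (f := fun m => m ^ 2 + a))
    rw [← Set.ncard_coe_finset]
    apply Set.ncard_le_ncard _ (Finset.finite_toSet _)
    rintro p ⟨hpp, hpX, m, hm⟩
    have hpm : p = m.natAbs ^ 2 + a := by
      zify; rw [sq_abs]; linarith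
    simp only [Finset.coe_image, Set.mem_image, Finset.mem_coe, Finset.mem_filter, Finset.mem_range]
    refine ⟨m.natAbs, ⟨?_, hpm ▸ hpp⟩, hpm.symm⟩
    rw [hNdef, Nat.lt_succ_iff]
    apply Nat.le_floor
    apply Real.le_sqrt_of_sq_le
    have h1 : ((m.natAbs : ℝ)) ^ 2 ≤ p := by
      have : m.natAbs ^ 2 ≤ p := by omega
      exact_mod_cast this
    have h2 : (p : ℝ) ≤ u * p := by
      have : (1 : ℝ) ≤ u := by exact_mod_cast hu
      exact le_mul_of_one_le_left (by positivity) this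
    linarith
  have hcount' : ({p : ℕ | p.Prime ∧ (u * p : ℝ) ≤ X ∧ ∃ m : ℤ, (p : ℤ) = a + m ^ 2}.ncard : ℝ) ≤
      (((range N).filter (fun m => (m ^ 2 + a).Prime)).card : ℝ) := by exact_mod_cast hcount
  have hsqrt1 : 1 ≤ Real.sqrt X := by rw [Real.one_le_sqrt]; exact hX1
  have hN : (N : ℝ) ≤ 2 * Real.sqrt X := by
    rw [hNdef]; push_cast
    have := Nat.floor_le (Real.sqrt_nonneg X)
    linarith
  have hmain : (N : ℝ) * (2 * ∏ p ∈ siftPrimes a z, (1 - sieveNu a p)) ≤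
      7680 * Real.exp (4 * 120) * (Real.sqrt X / Real.log X) * Q := by
    have hlz : 4 / Real.log z ≤ 1920 / Real.log X := by
      rw [div_le_div_iff₀ hlogz hlogX]; linarith
    calc (N : ℝ) * (2 * ∏ p ∈ siftPrimes a z, (1 - sieveNu a p))
        ≤ N * (2 * (4 / Real.log z * (Real.exp (4 * 120) * Q))) := by
          gcongr
          refine hp.trans ?_
          gcongr
      _ ≤ (2 * Real.sqrt X) * (2 * (1920 / Real.log X * (Real.exp (4 * 120) * Q))) := by
          gcongr
      _ = _ := by ring
  have herr : (z : ℝ) ^ 48 + (z + 1) ≤ 60 * (Real.sqrt X / Real.log X) * Q := by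
    have h1 : (z : ℝ) ^ 48 ≤ X ^ ((1 : ℝ) / 5) := by
      calc (z : ℝ) ^ 48 ≤ (X ^ ((1 : ℝ) / 240)) ^ 48 := by gcongr
        _ = X ^ ((1 : ℝ) / 5) := by
          rw [← Real.rpow_natCast, ← Real.rpow_mul hX0.le]; norm_num
    have h2 : (z : ℝ) ≤ (z : ℝ) ^ 48 := le_self_pow₀ (by linarith) (by norm_num)
    have h3 : Real.log X ≤ X ^ ((1 : ℝ) / 20) / (1 / 20) := Real.log_le_rpow_div hX0.le (by norm_num)
    have h4 : 1 / X ^ ((1 : ℝ) / 4) ≤ Q := by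
      refine le_trans ?_ ht2
      gcongr
    have h5 : X ^ ((1 : ℝ) / 5) * Real.log X ≤ 20 * X ^ ((1 : ℝ) / 4) := by
      calc X ^ ((1 : ℝ) / 5) * Real.log X ≤ X ^ ((1 : ℝ) / 5) * (X ^ ((1 : ℝ) / 20) / (1 / 20)) := by gcongr
        _ = 20 * (X ^ ((1 : ℝ) / 5) * X ^ ((1 : ℝ) / 20)) := by ring
        _ = 20 * X ^ ((1 : ℝ) / 4) := by rw [← Real.rpow_add hX0]; norm_num
    have h6 : Real.sqrt X = X ^ ((1 : ℝ) / 4) * X ^ ((1 : ℝ) / 4) := by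
      rw [Real.sqrt_eq_rpow, ← Real.rpow_add hX0]; norm_num
    have h7 : X ^ ((1 : ℝ) / 4) ≤ Real.sqrt X * Q := by
      have hq : 0 < X ^ ((1 : ℝ) / 4) := by positivity
      rw [div_le_iff₀ hq] at h4
      rw [h6]
      nlinarith
    have h8 : X ^ ((1 : ℝ) / 5) ≤ 20 * (Real.sqrt X / Real.log X) * Q := by
      rw [show 20 * (Real.sqrt X / Real.log X) * Q = (20 * (Real.sqrt X * Q)) / Real.log X by ring,
        le_div_iff₀ hlogX]
      linarith
    linarith
  have hfin : (7680 * Real.exp (4 * 120) + 60) * (Real.sqrt X / Real.log X) * Q =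
      7680 * Real.exp (4 * 120) * (Real.sqrt X / Real.log X) * Q + 60 * (Real.sqrt X / Real.log X) * Q := by ring
  rw [hfin]
  linarith
end

section
/- Let d be a fundamental discriminant with |d| ≤ X such that L(s, χ_d) has no zeros in the region {σ > 99/100, |t| ≤ |d|}. Then ∏_{p ≤ X^{1/4}} (1 - χ_{-4a}(p)/p) ≪ log log X, where -4a = d·a₂² for a positive integer a₂ ≤ √X and 1 ≤ a ≤ X. -/
/-- `d` is a fundamental discriminant: either `d ≡ 1 (mod 4)` and squarefree, or
`d = 4m` with `m` squarefree and `m ≡ 2, 3 (mod 4)`. -/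
def IsFundamentalDiscriminant (d : ℤ) : Prop :=
  (Squarefree d ∧ d % 4 = 1) ∨
    (∃ m : ℤ, d = 4 * m ∧ Squarefree m ∧ (m % 4 = 2 ∨ m % 4 = 3))

open ArithmeticFunction in
lemma vonMangoldt_sum_bound : ∃ K : ℝ, 0 ≤ K ∧ ∀ δ : ℝ, 0 < δ → δ ≤ 1 →
    ∑' n : ℕ, vonMangoldt n / (n : ℝ) ^ (1 + δ) ≤ 1 / δ + K := by
  open vonMangoldt Complex in
  have hres : ∀ n : ℕ, residueClass (1 : ZMod 1) n = vonMangoldt n := by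
    intro n
    have h : (n : ZMod 1) = 1 := Subsingleton.elim _ _
    simp [vonMangoldt.residueClass, Set.indicator, h]
  have H {x : ℝ} (hx : 1 < x) :
      ∑' n : ℕ, vonMangoldt n / (n : ℝ) ^ x =
        (LFunctionResidueClassAux (1 : ZMod 1) x).re + 1 / (x - 1) := by
    refine ofReal_injective ?_
    simp only [ofReal_tsum, ofReal_div, ofReal_cpow (Nat.cast_nonneg _), ofReal_natCast,
      ofReal_add, ofReal_sub, ofReal_one]
    rw [← LFunctionResidueClassAux_real isUnit_one hx,
      eqOn_LFunctionResidueClassAux isUnit_one <| Set.mem_ofPred.mpr (ofReal_re x ▸ hx)]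
    simp only [Nat.totient_one, Nat.cast_one, inv_one, sub_add_cancel, LSeries, LSeries.term]
    refine tsum_congr fun n ↦ ?_
    rw [hres]
    split_ifs with hn
    · simp [hn]
    · rfl
  have : ContinuousOn (fun x : ℝ ↦ (LFunctionResidueClassAux (1 : ZMod 1) x).re) (Set.Icc 1 2) :=
    continuous_re.continuousOn.comp (t := Set.univ) (continuousOn_LFunctionResidueClassAux _)
      (fun ⦃x⦄ a ↦ trivial) |>.comp continuous_ofReal.continuousOn fun x hx ↦ by
        simpa only [Set.mem_ofPred_eq, ofReal_re] using hx.1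
  obtain ⟨C, hC⟩ := bddAbove_def.mp <| IsCompact.bddAbove_image isCompact_Icc this
  refine ⟨max C 0, le_max_right _ _, fun δ h0 h1 => ?_⟩
  rw [H (by linarith)]
  have := hC _ (Set.mem_image_of_mem _ (show 1 + δ ∈ Set.Icc (1 : ℝ) 2 from ⟨by linarith, by linarith⟩))
  simp only [add_sub_cancel_left]
  linarith [le_max_left C 0]

open ArithmeticFunction in
lemma vonMangoldt_summable {x : ℝ} (hx : 1 < x) :
    Summable fun n : ℕ => vonMangoldt n / (n : ℝ) ^ x := by
  have h := (LSeriesSummable_vonMangoldt (s := x) (by simpa using hx)).norm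
  refine h.congr fun n => ?_
  rw [LSeries.norm_term_eq]
  split_ifs with hn
  · simp [hn]
  · simp [abs_of_nonneg vonMangoldt_nonneg]

open ArithmeticFunction in
lemma logDeriv_LFunction_le {N : ℕ} [NeZero N] (χ : DirichletCharacter ℂ N) {s : ℂ} (hs : 1 < s.re) :
    ‖deriv (DirichletCharacter.LFunction χ) s / DirichletCharacter.LFunction χ s‖ ≤
      ∑' n : ℕ, vonMangoldt n / (n : ℝ) ^ s.re := by
  have h := DirichletCharacter.LSeries_twist_vonMangoldt_eq χ hs
  rw [DirichletCharacter.deriv_LFunction_eq_deriv_LSeries χ hs, DirichletCharacter.LFunction_eq_LSeries χ hs]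
  rw [← norm_neg, ← neg_div, ← h]
  refine tsum_of_norm_bounded (vonMangoldt_summable hs).hasSum fun n => ?_
  rw [LSeries.norm_term_eq]
  split_ifs with hn
  · simp [hn]
  · simp only [Pi.mul_apply, norm_mul, Complex.norm_real, Real.norm_eq_abs, abs_of_nonneg vonMangoldt_nonneg]
    gcongr
    exact mul_le_of_le_one_left vonMangoldt_nonneg (χ.norm_le_one _)

open ArithmeticFunction in
/-- the constant from proper prime powers -/
lemma nonprime_bound : ∃ K : ℝ, 0 ≤ K ∧ ∀ (N : ℕ) [NeZero N] (χ : DirichletCharacter ℂ N) (s : ℂ), 1 < s.re →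
    HasDerivAt (LSeries (fun n : ℕ => if n.Prime then χ (n : ZMod N) else 0))
      (-LSeries (LSeries.logMul (fun n : ℕ => if n.Prime then χ (n : ZMod N) else 0)) s) s ∧
    ‖LSeries (LSeries.logMul (fun n : ℕ => if n.Prime then χ (n : ZMod N) else 0)) s‖ ≤
    ‖deriv (DirichletCharacter.LFunction χ) s / DirichletCharacter.LFunction χ s‖ + K := by
  have hsum := vonMangoldt.summable_residueClass_non_primes_div (1 : ZMod 1)
  have hres : ∀ n : ℕ, vonMangoldt.residueClass (1 : ZMod 1) n = vonMangoldt n := by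
    intro n
    have h : (n : ZMod 1) = 1 := Subsingleton.elim _ _
    simp [vonMangoldt.residueClass, Set.indicator, h]
  simp_rw [hres] at hsum
  refine ⟨∑' n : ℕ, (if n.Prime then 0 else vonMangoldt n) / (n : ℝ), ?_, ?_⟩
  · refine tsum_nonneg fun n => div_nonneg ?_ (Nat.cast_nonneg _)
    split_ifs
    · exact le_rfl
    · exact vonMangoldt_nonneg
  intro N _ χ s hs
  set f : ℕ → ℂ := fun n : ℕ => if n.Prime then χ (n : ZMod N) else 0 with hf
  have hfb : ∀ n, ‖f n‖ ≤ 1 := by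
    intro n
    simp only [hf]
    split_ifs
    · exact χ.norm_le_one _
    · simp
  have habs : LSeries.abscissaOfAbsConv f < s.re := by
    refine lt_of_le_of_lt (LSeries.abscissaOfAbsConv_le_one_of_isBigO_one
      (Asymptotics.IsBigO.of_bound 1 (Filter.Eventually.of_forall fun n => by simpa using hfb n))) ?_
    exact_mod_cast hs
  refine ⟨LSeries_hasDerivAt habs, ?_⟩
  have h := DirichletCharacter.LSeries_twist_vonMangoldt_eq χ hs
  have hS1 := LSeriesSummable_logMul_of_lt_re habs
  have hS2 := DirichletCharacter.LSeriesSummable_twist_vonMangoldt χ hs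
  rw [DirichletCharacter.deriv_LFunction_eq_deriv_LSeries χ hs, DirichletCharacter.LFunction_eq_LSeries χ hs]
  rw [← norm_neg (_ / _), ← neg_div, ← h]
  rw [← sub_le_iff_le_add']
  refine (norm_sub_norm_le _ _).trans ?_
  rw [← LSeries_sub hS1 hS2]
  refine tsum_of_norm_bounded hsum.hasSum fun n => ?_
  rw [LSeries.norm_term_eq]
  rcases Nat.eq_zero_or_pos n with hn | hn
  · simp [hn]
  rw [if_neg hn.ne']
  have hn1 : (1 : ℝ) ≤ n := by exact_mod_cast hn
  have hpow : (n : ℝ) ≤ (n : ℝ) ^ s.re := by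
    simpa using Real.rpow_le_rpow_of_exponent_le hn1 hs.le
  by_cases hp : n.Prime
  · simp only [hf, LSeries.logMul, Pi.sub_apply, Pi.mul_apply, hp, if_true, vonMangoldt_apply_prime hp]
    rw [Complex.natCast_log]
    rw [mul_comm, sub_self]; simp
  · simp only [hf, LSeries.logMul, Pi.sub_apply, Pi.mul_apply, hp, if_false, mul_zero, zero_sub, norm_neg,
      norm_mul, Complex.norm_real, Real.norm_eq_abs, abs_of_nonneg vonMangoldt_nonneg]
    have : ‖χ (n : ZMod N)‖ * vonMangoldt n ≤ vonMangoldt n :=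
      mul_le_of_le_one_left vonMangoldt_nonneg (χ.norm_le_one _)
    exact div_le_div₀ vonMangoldt_nonneg this (by linarith) hpow

lemma char_sum_range_bound {N : ℕ} [NeZero N] (χ : DirichletCharacter ℂ N) (hχ : χ ≠ 1) (n : ℕ) :
    ‖∑ k ∈ Finset.range n, χ (k : ZMod N)‖ ≤ N := by
  induction n using Nat.strong_induction_on with
  | _ n ih =>
    by_cases h : n < N
    · calc ‖∑ k ∈ Finset.range n, χ (k : ZMod N)‖ ≤ ∑ k ∈ Finset.range n, (1 : ℝ) :=
            norm_sum_le_of_le _ fun k _ => χ.norm_le_one _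
        _ = n := by simp
        _ ≤ N := by exact_mod_cast h.le
    · push Not at h
      obtain ⟨m, rfl⟩ := Nat.exists_eq_add_of_le h
      rw [Finset.sum_range_add]
      have h0 : ∑ k ∈ Finset.range N, χ (k : ZMod N) = 0 := by
        rw [← χ.sum_eq_zero_of_ne_one hχ]
        refine Finset.sum_bij (fun k _ => (k : ZMod N)) ?_ ?_ ?_ ?_
        · simp
        · intro a ha b hb hab
          rw [ZMod.natCast_eq_natCast_iff'] at hab
          rwa [Nat.mod_eq_of_lt (Finset.mem_range.mp ha), Nat.mod_eq_of_lt (Finset.mem_range.mp hb)] at hab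
        · intro b _
          exact ⟨b.val, Finset.mem_range.mpr (ZMod.val_lt b), by simp⟩
        · simp
      rw [h0, zero_add]
      have h1 := ih m (by have := NeZero.pos N; omega)
      simpa using h1

lemma char_sum_Icc_bound {N : ℕ} [NeZero N] (χ : DirichletCharacter ℂ N) (hχ : χ ≠ 1) (n : ℕ) :
    ‖∑ k ∈ Finset.Icc 1 n, χ (k : ZMod N)‖ ≤ N := by
  have h1 := char_sum_range_bound χ hχ (n + 1)
  have hN : N ≠ 1 := fun h => hχ (DirichletCharacter.level_one' χ h)
  rw [Finset.sum_range_succ'] at h1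
  simp only [Nat.cast_zero, χ.map_zero' hN, add_zero] at h1
  rw [Finset.range_eq_Ico] at h1
  have h2 : ∑ k ∈ Finset.Icc 1 n, χ (k : ZMod N) = ∑ k ∈ Finset.Ico 0 n, χ ((k + 1 : ℕ) : ZMod N) := by
    rw [Finset.sum_Ico_add' (fun k : ℕ => χ (k : ZMod N)) 0 n 1]
    rfl
  rw [h2]; exact h1

open Complex MeasureTheory Set Filter Topology Asymptotics in
lemma LFunction_bound {N : ℕ} [NeZero N] (χ : DirichletCharacter ℂ N) (hχ : χ ≠ 1) {s : ℂ}
    (hs : 0 < s.re) : ‖DirichletCharacter.LFunction χ s‖ ≤ ‖s‖ * (N / s.re) := by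
  set S : ℝ → ℂ := fun t => ∑ k ∈ Finset.Icc 1 ⌊t⌋₊, χ (k : ZMod N) with hS
  have hSb : ∀ t, ‖S t‖ ≤ N := fun t => char_sum_Icc_bound χ hχ _
  have hSm : Measurable S := by
    exact (measurable_from_top (f := fun n : ℕ => ∑ k ∈ Finset.Icc 1 n, χ (k : ZMod N))).comp
      Nat.measurable_floor
  set g : ℝ → ℂ := (Ioi (1 : ℝ)).indicator S with hg
  have hgb : ∀ t, ‖g t‖ ≤ N := fun t => (norm_indicator_le_norm_self _ _).trans (hSb t)
  have hgm : Measurable g := hSm.indicator measurableSet_Ioi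
  have hmel : ∀ w : ℂ, mellin g (-w) = ∫ t in Ioi (1 : ℝ), S t * (t : ℂ) ^ (-(w + 1)) := by
    intro w
    rw [mellin]
    have : ∀ t : ℝ, (t : ℂ) ^ (-w - 1) • g t
        = (Ioi (1 : ℝ)).indicator (fun t : ℝ => S t * (t : ℂ) ^ (-(w + 1))) t := by
      intro t
      by_cases ht : t ∈ Ioi (1 : ℝ)
      · simp only [hg, indicator_of_mem ht, smul_eq_mul]
        rw [mul_comm]; congr 2; ring
      · simp only [hg, indicator_of_notMem ht, smul_zero]
    simp_rw [this]
    rw [setIntegral_indicator measurableSet_Ioi]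
    congr 2
    ext x; simp only [mem_inter_iff, mem_Ioi]; constructor
    · exact fun h => h.2
    · exact fun h => ⟨by linarith, h⟩
  have hdiff : ∀ w : ℂ, 0 < w.re → DifferentiableAt ℂ (mellin g) (-w) := by
    intro w hw
    refine mellin_differentiableAt_of_isBigO_rpow (a := 0) (b := -w.re - 1) ?_ ?_ (by simpa) ?_ (by simp)
    · refine LocallyIntegrable.locallyIntegrableOn ?_ _
      have : LocallyIntegrable (fun _ : ℝ => (N : ℝ)) volume := locallyIntegrable_const _
      refine this.mono hgm.aestronglyMeasurable (Eventually.of_forall fun t => ?_)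
      simpa using hgb t
    · refine IsBigO.of_bound N (Eventually.of_forall fun t => ?_)
      simpa using hgb t
    · refine (IsBigO.of_bound 1 ?_)
      have : Iio (1 : ℝ) ∈ 𝓝[>] (0 : ℝ) := mem_nhdsWithin_of_mem_nhds (Iio_mem_nhds one_pos)
      filter_upwards [this] with t ht
      have : t ∉ Ioi (1 : ℝ) := by simpa using (mem_Iio.mp ht).le
      simp only [hg, indicator_of_notMem this, norm_zero]
      positivity
  have hU : IsOpen {w : ℂ | 0 < w.re} := isOpen_lt continuous_const continuous_re
  have hRHS : AnalyticOnNhd ℂ (fun w : ℂ => w * mellin g (-w)) {w : ℂ | 0 < w.re} := by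
    refine DifferentiableOn.analyticOnNhd (fun w hw => ?_) hU
    have : DifferentiableAt ℂ (fun w => mellin g (-w)) w :=
      (hdiff w hw).comp w differentiableAt_id.neg
    exact (differentiableAt_id.mul this).differentiableWithinAt
  have hLHS : AnalyticOnNhd ℂ (DirichletCharacter.LFunction χ) {w : ℂ | 0 < w.re} :=
    (DirichletCharacter.differentiable_LFunction hχ).differentiableOn.analyticOnNhd hU
  have heq : EqOn (DirichletCharacter.LFunction χ) (fun w : ℂ => w * mellin g (-w)) {w : ℂ | 0 < w.re} := by
    refine hLHS.eqOn_of_preconnected_of_eventuallyEq hRHS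
      (convex_halfSpace_re_gt 0).isPreconnected (z₀ := 2) (by simp) ?_
    have : {w : ℂ | 1 < w.re} ∈ 𝓝 (2 : ℂ) :=
      (isOpen_lt continuous_const continuous_re).mem_nhds (by simp)
    filter_upwards [this] with w hw
    have hw : 1 < w.re := hw
    rw [DirichletCharacter.LFunction_eq_LSeries χ hw, hmel]
    rw [LSeries_eq_mul_integral (fun n : ℕ => χ (n : ZMod N)) le_rfl (by linarith) 
      (DirichletCharacter.LSeriesSummable_of_one_lt_re χ hw)]
    refine IsBigO.of_bound N (Eventually.of_forall fun n => ?_)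
    simpa using char_sum_Icc_bound χ hχ n
  rw [heq hs]
  simp only [norm_mul, hmel]
  gcongr
  calc ‖∫ t in Ioi (1 : ℝ), S t * (t : ℂ) ^ (-(s + 1))‖
      ≤ ∫ t in Ioi (1 : ℝ), N * t ^ (-(s.re + 1)) := by
        refine norm_integral_le_of_norm_le ?_ ?_
        · exact (integrableOn_Ioi_rpow_of_lt (by linarith) one_pos).const_mul _
        · filter_upwards [ae_restrict_mem measurableSet_Ioi] with t ht
          have ht : 1 < t := ht
          rw [norm_mul, norm_cpow_eq_rpow_re_of_pos (by linarith)]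
          simp only [neg_re, add_re, one_re]
          gcongr
          exact hSb t
    _ = N / s.re := by
        rw [integral_const_mul, integral_Ioi_rpow_of_lt (by linarith) one_pos, Real.one_rpow]
        have : s.re ≠ 0 := hs.ne'
        rw [show -(s.re + 1) + 1 = - s.re by ring]
        field_simp

open Complex Metric Set in
lemma logDeriv_bound (f : ℂ → ℂ) (M : ℝ) (hM : 0 < M)
    (hf : DifferentiableOn ℂ f (ball 2 (101 / 100)))
    (hf0 : ∀ z ∈ ball (2 : ℂ) (101 / 100), f z ≠ 0)
    (hfM : ∀ z ∈ ball (2 : ℂ) (101 / 100), ‖f z‖ ≤ Real.exp M * ‖f 2‖) :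
    ∀ z : ℂ, ‖z - 2‖ ≤ 1004 / 1000 → ‖deriv f z / f z‖ ≤ 350000 * M := by
  have hF : DifferentiableOn ℂ (fun z => deriv f z / f z) (ball 2 (101 / 100)) :=
    (hf.deriv isOpen_ball).div hf hf0
  obtain ⟨g, hg2, hg⟩ := hF.isExactOn_ball.with_val_at 2 0
  have h2mem : (2 : ℂ) ∈ ball (2 : ℂ) (101 / 100) := mem_ball_self (by norm_num)
  have hfd : ∀ z ∈ ball (2 : ℂ) (101 / 100), HasDerivAt f (deriv f z) z := fun z hz =>
    (hf.differentiableAt (isOpen_ball.mem_nhds hz)).hasDerivAt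
  have hconst : ∀ z ∈ ball (2 : ℂ) (101 / 100), f z * exp (-g z) = f 2 := by
    intro z hz
    have hd : ∀ w ∈ ball (2 : ℂ) (101 / 100), HasDerivAt (fun z => f z * exp (-g z)) 0 w := by
      intro w hw
      have h := (hfd w hw).mul (hg w hw).neg.cexp
      refine h.congr_deriv ?_
      have h0 := hf0 w hw
      have h1 : f w * (deriv f w / f w) = deriv f w := mul_div_cancel₀ _ h0
      linear_combination (-cexp (-g w)) * h1
    have := (convex_ball (2 : ℂ) (101 / 100)).norm_image_sub_le_of_norm_hasDerivWithin_le
      (C := 0) (fun w hw => (hd w hw).hasDerivWithinAt) (by simp) h2mem hz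
    simp only [zero_mul, norm_le_zero_iff, sub_eq_zero] at this
    rw [this, hg2]; simp
  have hre : ∀ z ∈ ball (2 : ℂ) (101 / 100), (g z).re ≤ M := by
    intro z hz
    have h1 : f z = f 2 * exp (g z) := by
      rw [← hconst z hz, mul_assoc, ← Complex.exp_add]; simp
    have h2 := hfM z hz
    rw [h1, norm_mul, norm_exp, mul_comm] at h2
    have h3 : 0 < ‖f 2‖ := norm_pos_iff.mpr (hf0 2 h2mem)
    exact Real.exp_le_exp.mp (le_of_mul_le_mul_right h2 h3)
  have hbc : ∀ z : ℂ, ‖z - 2‖ ≤ 1007 / 1000 → ‖g z‖ ≤ 700 * M := by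
    intro z hz
    have hsh : ∀ w ∈ ball (0 : ℂ) (101 / 100), 2 + w ∈ ball (2 : ℂ) (101 / 100) := by
      intro w hw; simpa [dist_eq_norm] using hw
    have hd : DifferentiableOn ℂ (fun w => g (2 + w)) (ball 0 (101 / 100)) := by
      intro w hw
      exact ((hg _ (hsh w hw)).differentiableAt.comp w (by fun_prop)).differentiableWithinAt
    have hb := borelCaratheodory_zero (f := fun w => g (2 + w)) (z := z - 2) hM hd
      (fun w hw => hre _ (hsh w hw)) (by norm_num) (by rw [mem_ball_zero_iff]; linarith) (by simpa using hg2)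
    simp only [add_sub_cancel] at hb
    refine hb.trans ?_
    rw [div_le_iff₀ (by linarith)]
    nlinarith [norm_nonneg (z - 2)]
  intro z hz
  have hzm : z ∈ ball (2 : ℂ) (101 / 100) := by
    rw [mem_ball, dist_eq_norm]; linarith
  rw [← (hg z hzm).deriv]
  have hsub : closedBall z (2 / 1000) ⊆ ball (2 : ℂ) (101 / 100) := by
    intro w hw
    rw [mem_closedBall, dist_eq_norm] at hw
    rw [mem_ball, dist_eq_norm]
    have := norm_sub_le_norm_sub_add_norm_sub w z 2
    linarith
  have hd : DiffContOnCl ℂ g (ball z (2 / 1000)) := by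
    refine DifferentiableOn.diffContOnCl ?_
    rw [closure_ball _ (by norm_num)]
    exact fun w hw => (hg w (hsub hw)).differentiableAt.differentiableWithinAt
  have := norm_deriv_le_of_forall_mem_sphere_norm_le (C := 700 * M) (by norm_num) hd (by
    intro w hw
    apply hbc
    rw [mem_sphere, dist_eq_norm] at hw
    have := norm_sub_le_norm_sub_add_norm_sub w z 2
    linarith)
  refine this.trans (le_of_eq ?_)
  ring

open Complex Metric Set in
lemma three_circles (F : ℂ → ℂ) (hF : DifferentiableOn ℂ F (ball 2 (101 / 100)))
    (a b η : ℝ) (ha1 : 1 ≤ a) (hb1 : 1 ≤ b) (hη : 0 < η) (hη2 : η ≤ 1 / 2)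
    (ha : ∀ z : ℂ, ‖z - 2‖ = 1 - η → ‖F z‖ ≤ a)
    (hb : ∀ z : ℂ, ‖z - 2‖ ≤ 1004 / 1000 → ‖F z‖ ≤ b)
    (σ : ℝ) (hσ : 1 ≤ σ) (hση : σ ≤ 1 + η) : ‖F σ‖ ≤ a * b ^ (600 * η) := by
  set l := Real.log (1 - η) with hl
  set u := Real.log (1004 / 1000) with hu
  have hu0 : 2 / 600 < u := by
    have := Real.one_sub_inv_le_log_of_pos (x := 1004 / 1000) (by norm_num)
    norm_num at this ⊢
    linarith
  have hl0 : l < 0 := Real.log_neg (by linarith) (by linarith)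
  have hl1 : - (2 * η) ≤ l := by
    have := Real.one_sub_inv_le_log_of_pos (x := 1 - η) (by linarith)
    refine le_trans ?_ this
    rw [le_sub_iff_add_le, ← le_sub_iff_add_le', inv_le_iff_one_le_mul₀ (by linarith)]
    nlinarith
  have hlu : l < u := by linarith
  have hnorm : ∀ w : ℂ, ‖(2 - cexp w) - 2‖ = Real.exp w.re := by
    intro w; rw [sub_sub_cancel_left, norm_neg, norm_exp]
  have hexpu : Real.exp u = 1004 / 1000 := Real.exp_log (by norm_num)
  have hexpl : Real.exp l = 1 - η := Real.exp_log (by linarith)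
  have hcl : ∀ w : ℂ, w.re ≤ u → ‖(2 - cexp w) - 2‖ ≤ 1004 / 1000 := by
    intro w hw
    rw [hnorm, ← hexpu]
    exact Real.exp_le_exp.mpr hw
  have hd : DiffContOnCl ℂ (fun w => F (2 - cexp w)) (HadamardThreeLines.verticalStrip l u) := by
    refine DifferentiableOn.diffContOnCl (fun w hw => ?_)
    have hw' : w.re ≤ u := by
      rw [HadamardThreeLines.verticalStrip, closure_preimage_re, closure_Ioo hlu.ne] at hw
      exact hw.2
    have h1 : 2 - cexp w ∈ ball (2 : ℂ) (101 / 100) := by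
      rw [mem_ball, dist_eq_norm]
      have := hcl w hw'
      linarith
    have h2 := hF.differentiableAt (isOpen_ball.mem_nhds h1)
    exact (h2.comp w (by fun_prop)).differentiableWithinAt
  have h2σ : 0 < 2 - σ := by linarith
  have hzre : ((Real.log (2 - σ) : ℝ) : ℂ).re = Real.log (2 - σ) := ofReal_re _
  have hz1 : l ≤ Real.log (2 - σ) := Real.log_le_log (by linarith) (by linarith)
  have hz2 : Real.log (2 - σ) ≤ 0 := Real.log_nonpos h2σ.le (by linarith)
  have key := HadamardThreeLines.norm_le_interp_of_mem_verticalClosedStrip' (f := fun w => F (2 - cexp w))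
    (z := ((Real.log (2 - σ) : ℝ) : ℂ)) (a := a) (b := b) hlu
    (by
      rw [HadamardThreeLines.verticalClosedStrip, mem_preimage, hzre]
      exact ⟨hz1, by linarith⟩) hd
    (by
      refine ⟨b, ?_⟩
      rintro _ ⟨w, hw, rfl⟩
      exact hb _ (hcl w hw.2))
    (by
      intro w hw
      refine ha _ ?_
      rw [hnorm, show w.re = l from hw, hexpl])
    (by
      intro w hw
      exact hb _ (hcl w (le_of_eq hw)))
  have hpt : (2 : ℂ) - cexp ((Real.log (2 - σ) : ℝ) : ℂ) = σ := by
    rw [← ofReal_exp, Real.exp_log h2σ]; push_cast; ring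
  simp only [hpt, hzre] at key
  refine key.trans ?_
  set θ := (Real.log (2 - σ) - l) / (u - l)
  have hθ0 : 0 ≤ θ := div_nonneg (by linarith) (by linarith)
  have hθ1 : θ ≤ 600 * η := by
    rw [div_le_iff₀ (by linarith)]
    nlinarith
  have h1 : a ^ (1 - θ) ≤ a := by
    calc a ^ (1 - θ) ≤ a ^ (1 : ℝ) := Real.rpow_le_rpow_of_exponent_le ha1 (by linarith)
      _ = a := Real.rpow_one a
  have h2 : b ^ θ ≤ b ^ (600 * η) := Real.rpow_le_rpow_of_exponent_le hb1 hθ1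
  exact mul_le_mul h1 h2 (by positivity) (by positivity)

lemma gaussSum_sq_prim {N : ℕ} [NeZero N] {F : Type*} [Field F] (χ : DirichletCharacter F N)
    (hχ : χ.IsPrimitive) (hq : MulChar.IsQuadratic χ) (e : AddChar (ZMod N) F)
    (he : e.IsPrimitive) : gaussSum χ e ^ 2 = χ (-1) * Fintype.card (ZMod N) := by
  classical
  have h1 : ∀ a, gaussSum χ (e.mulShift a) = χ a * gaussSum χ e := by
    intro a
    rw [gaussSum_mulShift_of_isPrimitive e hχ, hq.inv]
  rw [pow_two]
  nth_rewrite 1 [gaussSum]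
  rw [Finset.sum_mul]
  have h2 : ∀ b, χ b * e b * gaussSum χ e = ∑ c, χ c * e (b * (c + 1)) := by
    intro b
    rw [mul_right_comm, ← h1, gaussSum, Finset.sum_mul]
    refine Finset.sum_congr rfl fun c _ => ?_
    rw [AddChar.mulShift_apply, mul_assoc, ← AddChar.map_add_eq_mul]
    congr 2; ring
  simp_rw [h2]
  rw [Finset.sum_comm]
  simp_rw [← Finset.mul_sum, AddChar.sum_mulShift _ he]
  rw [Finset.sum_eq_single (-1)]
  · simp
  · intro b _ hb
    rw [if_neg]
    · simp
    · intro h; exact hb (eq_neg_of_add_eq_zero_left h)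
  · simp

lemma exists_int_char {N : ℕ} (χ : DirichletCharacter ℂ N) (hχ2 : χ ^ 2 = 1) :
    ∃ χZ : MulChar (ZMod N) ℤ, χZ.IsQuadratic ∧ ∀ a, χ a = (χZ a : ℂ) := by
  classical
  have hq : MulChar.IsQuadratic χ := MulChar.isQuadratic_iff_sq_eq_one.mpr hχ2
  have key : ∀ a, χ a = (((if χ a = 0 then 0 else if χ a = 1 then 1 else -1 : ℤ)) : ℂ) := by
    intro a
    rcases hq a with h | h | h
    · simp [h]
    · simp [h]
    · rw [h]; norm_num
  refine ⟨⟨⟨⟨fun a => if χ a = 0 then 0 else if χ a = 1 then 1 else -1, ?_⟩, ?_⟩, ?_⟩, ?_, ?_⟩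
  · simp
  · intro a b
    have h : (((if χ (a*b) = 0 then 0 else if χ (a*b) = 1 then 1 else -1 : ℤ)) : ℂ) = 
      (((if χ a = 0 then 0 else if χ a = 1 then 1 else -1 : ℤ)) : ℂ) *
      (((if χ b = 0 then 0 else if χ b = 1 then 1 else -1 : ℤ)) : ℂ) := by
      rw [← key, ← key, ← key, map_mul]
    exact_mod_cast h
  · intro a ha
    simp [χ.map_nonunit ha]
  · intro a
    show (if χ a = 0 then 0 else if χ a = 1 then 1 else -1 : ℤ) = 0 ∨ _ = (1:ℤ) ∨ _ = (-1 : ℤ)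
    show (if χ a = 0 then 0 else if χ a = 1 then 1 else -1 : ℤ) = 0 ∨ (if χ a = 0 then 0 else if χ a = 1 then 1 else -1 : ℤ) = (1:ℤ) ∨ (if χ a = 0 then 0 else if χ a = 1 then 1 else -1 : ℤ) = (-1 : ℤ)
    split_ifs <;> simp
  · exact key

lemma chi_eq_jacobi {N : ℕ} [NeZero N] (χ : DirichletCharacter ℂ N) (hχ : χ.IsPrimitive)
    (hχ2 : χ ^ 2 = 1) (ε : ℤ) (hε : χ (-1) = ε) (p : ℕ) (hp : p.Prime) (hp2 : p ≠ 2) :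
    χ p = (jacobiSym (ε * N) p : ℂ) := by
  classical
  have : Fact p.Prime := ⟨hp⟩
  by_cases hpN : p ∣ N
  · have h1 : ¬ IsUnit (p : ZMod N) := by
      intro h
      rw [ZMod.isUnit_iff_coprime] at h
      exact (Nat.Prime.coprime_iff_not_dvd hp).mp h hpN
    rw [χ.map_nonunit h1, ← jacobiSym.legendreSym.to_jacobiSym]
    rw [(legendreSym.eq_zero_iff p _).mpr]
    · simp
    · push_cast
      rw [(ZMod.natCast_eq_zero_iff N p).mpr hpN, mul_zero]
  have hu : IsUnit (p : ZMod N) := by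
    rw [ZMod.isUnit_iff_coprime]
    exact (Nat.Prime.coprime_iff_not_dvd hp).mpr hpN
  obtain ⟨χZ, hq, hZ⟩ := exists_int_char χ hχ2
  have hNF : ((⟨N, Nat.pos_of_ne_zero (NeZero.ne N)⟩ : ℕ+) : ZMod p) ≠ 0 := by
    simpa [ZMod.natCast_eq_zero_iff] using hpN
  let ψ := AddChar.primitiveZModChar ⟨N, Nat.pos_of_ne_zero (NeZero.ne N)⟩ (ZMod p) hNF
  let F := CyclotomicField ψ.n (ZMod p)
  have : CharP F p := charP_of_injective_algebraMap (algebraMap (ZMod p) F).injective p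
  let e : AddChar (ZMod N) F := ψ.char
  have he : e.IsPrimitive := ψ.prim
  let χF : DirichletCharacter F N := χZ.ringHomComp (Int.castRingHom F)
  have hqF : MulChar.IsQuadratic χF := hq.comp _
  have h11 : (-1 : F) ≠ 1 := by
    intro h
    have h2 : ((2 : ℕ) : F) = 0 := by
      push_cast
      linear_combination -h
    rw [CharP.cast_eq_zero_iff F p 2] at h2
    exact hp2 ((Nat.prime_dvd_prime_iff_eq hp Nat.prime_two).mp h2)
  have hF : ∀ a, χF a = (χZ a : F) := fun a => rfl
  have hprim : χF.IsPrimitive := by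
    have hd := χF.conductor_dvd_level
    have h1 := (DirichletCharacter.factorsThrough_iff_ker_unitsMap (χ := χF) hd).mp χF.factorsThrough_conductor
    have h2 : χ.FactorsThrough χF.conductor := by
      rw [DirichletCharacter.factorsThrough_iff_ker_unitsMap (χ := χ) hd]
      intro u hu
      have h3 := h1 hu
      rw [MonoidHom.mem_ker] at h3 ⊢
      rw [Units.ext_iff] at h3 ⊢
      simp only [MulChar.coe_toUnitHom, Units.val_one] at h3 ⊢
      rw [hZ]
      rw [hF] at h3
      rcases hq (u : ZMod N) with h | h | h
      · rw [h] at h3; simp at h3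
      · simp [h]
      · rw [h] at h3
        exact absurd (by simpa using h3) h11
    have h3 : χ.conductor ≤ χF.conductor := Nat.sInf_le h2
    rw [DirichletCharacter.IsPrimitive] at hχ ⊢
    rw [hχ] at h3
    exact le_antisymm (Nat.le_of_dvd (Nat.pos_of_ne_zero (NeZero.ne N)) hd) h3
  have hg := gaussSum_sq_prim χF hprim hqF e he
  have key := Char.card_pow_char_pow hqF e p 1 hu hp2 hg
  rw [pow_one, pow_one, ZMod.card, hF, hF] at key
  have hεZ : χZ (-1) = ε := by
    have := hZ (-1)
    rw [hε] at this
    exact_mod_cast this.symm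
  rw [hεZ] at key
  have hl := legendreSym.eq_pow p (ε * N)
  have hl2 := congrArg (algebraMap (ZMod p) F) hl
  rw [map_pow, map_intCast, map_intCast] at hl2
  push_cast at hl2
  rw [key] at hl2
  rw [hZ, ← jacobiSym.legendreSym.to_jacobiSym]
  congr 1
  have hleg : (ε * N : ℤ) = ε * N := rfl
  have hcases : legendreSym p (ε * N) = 0 ∨ legendreSym p (ε * N) = 1 ∨ legendreSym p (ε * N) = -1 := by
    exact quadraticChar_isQuadratic (ZMod p) _
  rcases hq (p : ZMod N) with h | h | h <;> rcases hcases with h' | h' | h' <;> rw [h, h'] at hl2 ⊢ <;> simp at hl2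
  · exact absurd hl2 h11
  · exact absurd hl2.symm h11

open ArithmeticFunction in
lemma prime_sum_approx : ∃ K : ℝ, 0 ≤ K ∧ ∀ c : ℕ → ℂ, (∀ n, ‖c n‖ ≤ 1) → ∀ z : ℝ, 0 < z → 1 ≤ Real.log z →
    ‖∑ p ∈ (Finset.range (⌊z⌋₊ + 1)).filter Nat.Prime, c p / (p : ℂ) -
      LSeries (fun n : ℕ => if n.Prime then c n else 0) ((1 + 1 / Real.log z : ℝ) : ℂ)‖ ≤ K := by
  obtain ⟨K, hK0, hK⟩ := vonMangoldt_sum_bound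
  refine ⟨Real.exp 1 * (1 + K), by positivity, fun c hc z hz0 hz => ?_⟩
  set δ := 1 / Real.log z with hδ
  have hδ0 : 0 < δ := by positivity
  have hδ1 : δ ≤ 1 := by rw [hδ, div_le_one (by linarith)]; exact hz
  have hδl : δ * Real.log z = 1 := by rw [hδ]; field_simp
  set f : ℕ → ℂ := fun n : ℕ => if n.Prime then c n else 0 with hf
  have hfb : ∀ n, ‖f n‖ ≤ 1 := by
    intro n
    simp only [hf]
    split_ifs
    · exact hc _
    · simp
  have hS : LSeriesSummable f ((1 + δ : ℝ) : ℂ) := by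
    refine LSeriesSummable_of_bounded_of_one_lt_re (m := 1) (fun n _ => hfb n) ?_
    rw [Complex.ofReal_re]; linarith
  set g : ℕ → ℂ := fun n => if n ∈ (Finset.range (⌊z⌋₊ + 1)).filter Nat.Prime then c n / (n : ℂ) else 0 with hg
  have hgs : HasSum g (∑ p ∈ (Finset.range (⌊z⌋₊ + 1)).filter Nat.Prime, c p / (p : ℂ)) := by
    have : ∑ p ∈ (Finset.range (⌊z⌋₊ + 1)).filter Nat.Prime, c p / (p : ℂ) =
      ∑ p ∈ (Finset.range (⌊z⌋₊ + 1)).filter Nat.Prime, g p := by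
      refine Finset.sum_congr rfl fun p hp => ?_
      simp only [hg, if_pos hp]
    rw [this]
    refine hasSum_sum_of_ne_finset_zero fun n hn => ?_
    simp only [hg, if_neg hn]
  have hd := hgs.sub (LSeriesSummable.LSeriesHasSum hS)
  rw [← hd.tsum_eq]
  have hsum := (vonMangoldt_summable (x := 1 + δ) (by linarith)).mul_left (Real.exp 1 * δ)
  have hle : ∑' n : ℕ, Real.exp 1 * δ * (vonMangoldt n / (n : ℝ) ^ (1 + δ)) ≤ Real.exp 1 * (1 + K) := by
    rw [tsum_mul_left, mul_assoc]
    refine mul_le_mul_of_nonneg_left ?_ (Real.exp_pos 1).le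
    calc δ * _ ≤ δ * (1 / δ + K) := mul_le_mul_of_nonneg_left (hK δ hδ0 hδ1) hδ0.le
      _ = 1 + δ * K := by field_simp
      _ ≤ 1 + K := by nlinarith
  refine le_trans (tsum_of_norm_bounded hsum.hasSum fun n => ?_) hle
  have hnn : 0 ≤ Real.exp 1 * δ * (vonMangoldt n / (n : ℝ) ^ (1 + δ)) := by
    have : 0 ≤ vonMangoldt n := vonMangoldt_nonneg
    positivity
  by_cases hp : n.Prime
  swap
  · have h1 : g n = 0 := by simp [hg, hp]
    have h2 : LSeries.term f ((1 + δ : ℝ) : ℂ) n = 0 := by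
      rw [LSeries.term]; split_ifs <;> simp [hf, hp]
    rw [h1, h2]; simpa using hnn
  have hn0 : n ≠ 0 := hp.ne_zero
  have hnpos : (0 : ℝ) < n := by exact_mod_cast hp.pos
  have hn1 : (1 : ℝ) ≤ n := by exact_mod_cast hp.one_le
  rw [LSeries.term_of_ne_zero hn0]
  simp only [hf, if_pos hp, vonMangoldt_apply_prime hp]
  have hpow : ((n : ℂ) ^ ((1 + δ : ℝ) : ℂ)) = (((n : ℝ) ^ (1 + δ) : ℝ) : ℂ) := by
    rw [Complex.ofReal_cpow hnpos.le]; simp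
  rw [hpow]
  have hpp : 0 < (n : ℝ) ^ (1 + δ) := by positivity
  have hsplit : (n : ℝ) ^ (1 + δ) = n * Real.exp (δ * Real.log n) := by
    rw [Real.rpow_add hnpos, Real.rpow_one, Real.rpow_def_of_pos hnpos δ, mul_comm δ]
  have hlog0 : 0 ≤ Real.log n := Real.log_nonneg hn1
  by_cases hm : n ∈ (Finset.range (⌊z⌋₊ + 1)).filter Nat.Prime
  · simp only [hg, if_pos hm]
    have hnz : (n : ℝ) ≤ z := by
      have := Finset.mem_range.mp (Finset.mem_filter.mp hm).1
      exact (Nat.le_floor_iff' hn0).mp (by omega)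
    set t := δ * Real.log n with ht
    have ht1 : t ≤ 1 := by
      rw [← hδl]; exact mul_le_mul_of_nonneg_left (Real.log_le_log hnpos hnz) hδ0.le
    have ht0 : 0 ≤ t := by positivity
    have hkey : c n / (n : ℂ) - c n / (((n : ℝ) ^ (1 + δ) : ℝ) : ℂ) =
        c n * (((Real.exp t - 1) / (n : ℝ) ^ (1 + δ) : ℝ) : ℂ) := by
      rw [hsplit]
      have : (n : ℂ) ≠ 0 := by exact_mod_cast hn0
      push_cast
      field_simp
    rw [hkey, norm_mul, Complex.norm_real, Real.norm_eq_abs, abs_of_nonneg (by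
      have := Real.one_le_exp ht0
      exact div_nonneg (by linarith) hpp.le)]
    have h1 : Real.exp t - 1 ≤ Real.exp 1 * t := by
      have h2 : 1 - t ≤ Real.exp (-t) := by linarith [Real.add_one_le_exp (-t)]
      have h3 : Real.exp t ≤ Real.exp 1 := Real.exp_le_exp.mpr ht1
      have h4 : Real.exp t * Real.exp (-t) = 1 := by rw [← Real.exp_add]; simp
      have := Real.exp_pos t
      nlinarith
    calc ‖c n‖ * ((Real.exp t - 1) / (n : ℝ) ^ (1 + δ)) ≤ 1 * ((Real.exp 1 * t) / (n : ℝ) ^ (1 + δ)) := by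
          refine mul_le_mul (hc n) (div_le_div_of_nonneg_right h1 hpp.le) ?_ zero_le_one
          have := Real.one_le_exp ht0
          exact div_nonneg (by linarith) hpp.le
      _ = _ := by rw [ht]; ring
  · simp only [hg, if_neg hm]
    have hnz : z < n := by
      by_contra h
      push Not at h
      refine hm (Finset.mem_filter.mpr ⟨Finset.mem_range.mpr ?_, hp⟩)
      have := (Nat.le_floor_iff' hn0).mpr h
      omega
    have h1 : 1 ≤ δ * Real.log n := by
      rw [← hδl]; exact mul_le_mul_of_nonneg_left (Real.log_le_log hz0 hnz.le) hδ0.le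
    rw [zero_sub, norm_neg, norm_div, Complex.norm_real, Real.norm_eq_abs, abs_of_pos hpp]
    have he : 1 ≤ Real.exp 1 := Real.one_le_exp zero_le_one
    calc ‖c n‖ / (n : ℝ) ^ (1 + δ) ≤ (Real.exp 1 * (δ * Real.log n)) / (n : ℝ) ^ (1 + δ) := by
          refine div_le_div_of_nonneg_right ((hc n).trans ?_) hpp.le
          nlinarith
      _ = _ := by ring

lemma prime_recip_bound : ∃ K : ℝ, 0 ≤ K ∧ ∀ y : ℝ, 0 < y → 1 ≤ Real.log y →
    ∑ p ∈ (Finset.range (⌊y⌋₊ + 1)).filter Nat.Prime, 1 / (p : ℝ) ≤ Real.log (Real.log y) + K := by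
  obtain ⟨K₁, hK₁0, hK₁⟩ := vonMangoldt_sum_bound
  obtain ⟨K₂, hK₂0, hK₂⟩ := nonprime_bound
  obtain ⟨K₃, hK₃0, hK₃⟩ := prime_sum_approx
  set χ : DirichletCharacter ℂ 1 := 1 with hχ
  have hχ1 : ∀ n : ℕ, χ (n : ZMod 1) = 1 := by
    intro n
    rw [Subsingleton.elim (n : ZMod 1) 1, map_one]
  set f : ℕ → ℂ := (fun n : ℕ => if n.Prime then χ (n : ZMod 1) else 0) with hf
  set g : ℝ → ℝ := fun u => (LSeries f ((1 + u : ℝ) : ℂ)).re with hg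
  have hgd : ∀ u : ℝ, 0 < u → HasDerivAt g (-(LSeries (LSeries.logMul f) ((1 + u : ℝ) : ℂ))).re u := by
    intro u hu
    have h := (hK₂ 1 χ ((1 + u : ℝ) : ℂ) (by rw [Complex.ofReal_re]; linarith)).1
    have h2 : HasDerivAt (fun u : ℝ => 1 + u) 1 u := (hasDerivAt_id u).const_add 1
    have h3 := (h.real_of_complex).comp u h2
    exact h3.congr_deriv (mul_one _)
  have hgb : ∀ u : ℝ, 0 < u → u ≤ 1 →
      -(1 / u + K₁ + K₂) ≤ (-(LSeries (LSeries.logMul f) ((1 + u : ℝ) : ℂ))).re := by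
    intro u hu hu1
    have hre : 1 < ((1 + u : ℝ) : ℂ).re := by rw [Complex.ofReal_re]; linarith
    have h := (hK₂ 1 χ ((1 + u : ℝ) : ℂ) hre).2
    have h2 := logDeriv_LFunction_le χ hre
    have h3 := hK₁ u hu hu1
    rw [Complex.ofReal_re] at h2
    have h4 := Complex.re_le_norm (LSeries (LSeries.logMul f) ((1 + u : ℝ) : ℂ))
    rw [Complex.neg_re]
    linarith
  set φ : ℝ → ℝ := fun u => g u + Real.log u + (K₁ + K₂) * u with hφ
  have hφd : ∀ u : ℝ, 0 < u → HasDerivAt φ ((-(LSeries (LSeries.logMul f) ((1 + u : ℝ) : ℂ))).re + u⁻¹ + (K₁ + K₂)) u := by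
    intro u hu
    have := ((hgd u hu).add (Real.hasDerivAt_log hu.ne')).add ((hasDerivAt_id u).const_mul (K₁ + K₂))
    exact this.congr_deriv (by ring)
  have hmono : ∀ δ : ℝ, 0 < δ → δ ≤ 1 → φ δ ≤ φ 1 := by
    intro δ h0 h1
    have : MonotoneOn φ (Set.Icc δ 1) := by
      refine monotoneOn_of_deriv_nonneg (convex_Icc _ _) ?_ ?_ ?_
      · exact fun u hu => (hφd u (by linarith [hu.1])).continuousAt.continuousWithinAt
      · exact fun u hu => (hφd u (by rw [interior_Icc] at hu; linarith [hu.1])).differentiableAt.differentiableWithinAt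
      · intro u hu
        rw [interior_Icc] at hu
        have hu0 : 0 < u := by linarith [hu.1]
        rw [(hφd u hu0).deriv]
        have := hgb u hu0 hu.2.le
        rw [one_div] at this
        linarith
    exact this ⟨le_rfl, h1⟩ ⟨h1, le_rfl⟩ h1
  refine ⟨|φ 1| + K₃, by positivity, fun y hy hly => ?_⟩
  have h1 := hK₃ (fun n => χ (n : ZMod 1)) (fun n => χ.norm_le_one _) y hy hly
  set δ := 1 / Real.log y with hδ
  have hδ0 : 0 < δ := by positivity
  have hδ1 : δ ≤ 1 := by rw [hδ, div_le_one (by linarith)]; exact hly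
  have h2 := hmono δ hδ0 hδ1
  have h3 := (Complex.re_le_norm _).trans h1
  rw [Complex.sub_re] at h3
  have h4 : (∑ p ∈ (Finset.range (⌊y⌋₊ + 1)).filter Nat.Prime, χ (p : ZMod 1) / (p : ℂ)).re =
      ∑ p ∈ (Finset.range (⌊y⌋₊ + 1)).filter Nat.Prime, 1 / (p : ℝ) := by
    rw [Complex.re_sum]
    refine Finset.sum_congr rfl fun p _ => ?_
    rw [hχ1, ← Complex.ofReal_natCast, ← Complex.ofReal_one, ← Complex.ofReal_div, Complex.ofReal_re]
  rw [h4] at h3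
  have h5 : Real.log δ = - Real.log (Real.log y) := by rw [hδ, one_div, Real.log_inv]
  have h6 := le_abs_self (φ 1)
  have h8 : φ δ = (LSeries (fun n => if Nat.Prime n then χ (n : ZMod 1) else 0) ((1 + δ : ℝ) : ℂ)).re +
    Real.log δ + (K₁ + K₂) * δ := rfl
  have h7 : 0 ≤ (K₁ + K₂) * δ := by positivity
  linarith

lemma G_diff : ∃ K : ℝ, 0 ≤ K ∧ ∀ (N : ℕ) [NeZero N] (χ : DirichletCharacter ℂ N) (δ η B : ℝ), 0 < δ → δ ≤ η →
    (∀ σ : ℝ, 1 ≤ σ → σ ≤ 1 + η →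
      ‖deriv (DirichletCharacter.LFunction χ) (σ : ℂ) / DirichletCharacter.LFunction χ (σ : ℂ)‖ ≤ B) →
    ‖LSeries (fun n : ℕ => if n.Prime then χ (n : ZMod N) else 0) ((1 + δ : ℝ) : ℂ) -
      LSeries (fun n : ℕ => if n.Prime then χ (n : ZMod N) else 0) ((1 + η : ℝ) : ℂ)‖ ≤ (B + K) * η := by
  obtain ⟨K₂, hK₂0, hK₂⟩ := nonprime_bound
  refine ⟨K₂, hK₂0, fun N _ χ δ η B hδ hδη hB => ?_⟩
  set f : ℕ → ℂ := (fun n : ℕ => if n.Prime then χ (n : ZMod N) else 0) with hf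
  have hd : ∀ σ ∈ Set.Icc (1 + δ) (1 + η), HasDerivWithinAt (fun σ : ℝ => LSeries f (σ : ℂ))
      (-(LSeries (LSeries.logMul f) (σ : ℂ))) (Set.Icc (1 + δ) (1 + η)) σ := by
    intro σ hσ
    exact ((hK₂ N χ (σ : ℂ) (by rw [Complex.ofReal_re]; linarith [hσ.1])).1.comp_ofReal).hasDerivWithinAt
  have hb : ∀ σ ∈ Set.Icc (1 + δ) (1 + η), ‖-(LSeries (LSeries.logMul f) (σ : ℂ))‖ ≤ B + K₂ := by
    intro σ hσ
    rw [norm_neg]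
    have h1 := (hK₂ N χ (σ : ℂ) (by rw [Complex.ofReal_re]; linarith [hσ.1])).2
    have h2 := hB σ (by linarith [hσ.1]) hσ.2
    linarith
  have := (convex_Icc (1 + δ) (1 + η)).norm_image_sub_le_of_norm_hasDerivWithin_le hd hb
    (Set.right_mem_Icc.mpr (by linarith)) (Set.left_mem_Icc.mpr (by linarith))
  refine this.trans ?_
  have hB0 : 0 ≤ B + K₂ := (norm_nonneg _).trans (hb _ (Set.left_mem_Icc.mpr (by linarith)))
  refine mul_le_mul_of_nonneg_left ?_ hB0
  rw [Real.norm_eq_abs, abs_le]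
  constructor <;> linarith

lemma L2_lower {N : ℕ} [NeZero N] (χ : DirichletCharacter ℂ N) :
    3 / 10 ≤ ‖DirichletCharacter.LFunction χ 2‖ := by
  have h2 : 1 < (2 : ℂ).re := by norm_num
  rw [DirichletCharacter.LFunction_eq_LSeries χ h2]
  have hS : HasSum (LSeries.term (fun n : ℕ => χ (n : ZMod N)) 2) (LSeries (fun n : ℕ => χ (n : ZMod N)) 2) :=
    LSeriesSummable.LSeriesHasSum (DirichletCharacter.LSeriesSummable_of_one_lt_re χ h2)
  have h1 : HasSum (fun n : ℕ => if n = 1 then (1 : ℂ) else 0) 1 := by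
    have := hasSum_single (f := fun n : ℕ => if n = 1 then (1 : ℂ) else 0) 1 (fun n hn => if_neg hn)
    rwa [if_pos rfl] at this
  have h1' : HasSum (fun n : ℕ => if n = 1 then (1 : ℝ) else 0) 1 := by
    have := hasSum_single (f := fun n : ℕ => if n = 1 then (1 : ℝ) else 0) 1 (fun n hn => if_neg hn)
    rwa [if_pos rfl] at this
  have hd := hS.sub h1
  have hz := hasSum_zeta_two.sub h1'
  have hterm : ∀ n : ℕ, ‖LSeries.term (fun n : ℕ => χ (n : ZMod N)) 2 n - (if n = 1 then (1 : ℂ) else 0)‖ ≤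
      1 / (n : ℝ) ^ 2 - (if n = 1 then (1 : ℝ) else 0) := by
    intro n
    rcases Nat.eq_zero_or_pos n with hn | hn
    · simp [hn]
    by_cases hn1 : n = 1
    · subst hn1
      rw [LSeries.term_of_ne_zero one_ne_zero]
      simp
    · simp only [if_neg hn1, sub_zero]
      rw [LSeries.norm_term_eq, if_neg hn.ne']
      have : (n : ℝ) ^ (2 : ℂ).re = (n : ℝ) ^ 2 := by
        rw [show (2 : ℂ).re = ((2 : ℕ) : ℝ) by norm_num, Real.rpow_natCast]
      rw [this]
      exact div_le_div_of_nonneg_right (χ.norm_le_one _) (by positivity)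
  have hb := tsum_of_norm_bounded hz hterm
  rw [hd.tsum_eq] at hb
  have hpi : Real.pi ^ 2 / 6 - 1 ≤ 7 / 10 := by
    have := Real.pi_lt_d4
    have := Real.pi_pos
    nlinarith
  have h3 := norm_sub_norm_le (1 : ℂ) (1 - LSeries (fun n : ℕ => χ (n : ZMod N)) 2)
  rw [sub_sub_cancel, norm_sub_rev 1 (LSeries _ _), norm_one] at h3
  linarith

open ArithmeticFunction in
lemma logDeriv_final : ∃ B₀ : ℝ, 0 ≤ B₀ ∧ ∀ (N : ℕ) [NeZero N] (χ : DirichletCharacter ℂ N) (X : ℝ),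
    χ ≠ 1 → 3 ≤ N → (N : ℝ) ≤ X → 14 ≤ X → 2 ≤ Real.log (Real.log X) →
    (∀ s : ℂ, 99 / 100 < s.re → |s.im| ≤ N → DirichletCharacter.LFunction χ s ≠ 0) →
    ∀ σ : ℝ, 1 ≤ σ → σ ≤ 1 + 1 / Real.log (Real.log X) →
    ‖deriv (DirichletCharacter.LFunction χ) (σ : ℂ) / DirichletCharacter.LFunction χ (σ : ℂ)‖ ≤
      B₀ * Real.log (Real.log X) := by
  obtain ⟨K, hK0, hK⟩ := vonMangoldt_sum_bound
  refine ⟨(2 + K) * Real.exp (600 * (Real.log 700000 + 1)), by positivity, ?_⟩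
  intro N _ χ X hχ hN hNX hX hLL h0 σ hσ1 hσ2
  set T := Real.log (Real.log X) with hT
  set η := 1 / T with hη
  have hη0 : 0 < η := by positivity
  have hη2 : η ≤ 1 / 2 := one_div_le_one_div_of_le (by norm_num) hLL
  have hTη : η * T = 1 := by rw [hη]; field_simp
  have hX0 : 0 < X := by linarith
  have hl1 : 1 ≤ Real.log X := by
    rw [Real.le_log_iff_exp_le hX0]
    linarith [Real.exp_one_lt_d9]
  set L := DirichletCharacter.LFunction χ with hL
  have hdiff : Differentiable ℂ L := DirichletCharacter.differentiable_LFunction hχ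
  have hN3 : (3 : ℝ) ≤ N := by exact_mod_cast hN
  have hball : ∀ z ∈ Metric.ball (2 : ℂ) (101 / 100), 99 / 100 < z.re ∧ |z.im| ≤ N ∧ ‖z‖ ≤ 301 / 100 := by
    intro z hz
    rw [Metric.mem_ball, dist_eq_norm] at hz
    have h1 := (Complex.abs_re_le_norm (z - 2)).trans_lt hz
    have h2 := (Complex.abs_im_le_norm (z - 2)).trans_lt hz
    have h3 := norm_sub_norm_le z 2
    simp at h1 h2 h3
    rw [abs_lt] at h1
    refine ⟨by linarith, by linarith, by linarith⟩
  have hf0 : ∀ z ∈ Metric.ball (2 : ℂ) (101 / 100), L z ≠ 0 := fun z hz =>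
    h0 z (hball z hz).1 (hball z hz).2.1
  have hfM : ∀ z ∈ Metric.ball (2 : ℂ) (101 / 100), ‖L z‖ ≤ Real.exp (2 * Real.log X) * ‖L 2‖ := by
    intro z hz
    obtain ⟨h1, -, h3⟩ := hball z hz
    have h4 := LFunction_bound χ hχ (s := z) (by linarith)
    have h5 : (N : ℝ) / z.re ≤ X / (99 / 100) := by
      apply div_le_div₀ hX0.le hNX (by norm_num) h1.le
    have h6 : Real.exp (2 * Real.log X) = X ^ 2 := by
      rw [two_mul, Real.exp_add, Real.exp_log hX0]; ring
    rw [h6]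
    calc ‖L z‖ ≤ ‖z‖ * (N / z.re) := h4
      _ ≤ (301 / 100) * (X / (99 / 100)) := by
        refine mul_le_mul h3 h5 (div_nonneg (by positivity) (by linarith)) (by norm_num)
      _ ≤ X ^ 2 * (3 / 10) := by nlinarith
      _ ≤ _ := mul_le_mul_of_nonneg_left (L2_lower χ) (by positivity)
  have hb := logDeriv_bound L (2 * Real.log X) (by linarith) hdiff.differentiableOn hf0 hfM
  have hF : DifferentiableOn ℂ (fun z => deriv L z / L z) (Metric.ball 2 (101 / 100)) :=
    (hdiff.differentiableOn.deriv Metric.isOpen_ball).div hdiff.differentiableOn hf0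
  have ha : ∀ z : ℂ, ‖z - 2‖ = 1 - η → ‖deriv L z / L z‖ ≤ T + K := by
    intro z hz
    have h1 := (Complex.abs_re_le_norm (z - 2))
    rw [hz, abs_le] at h1
    simp at h1
    have hre : 1 + η ≤ z.re := by linarith
    have h2 := logDeriv_LFunction_le χ (s := z) (by linarith)
    have h3 := hK η hη0 (by linarith)
    have h4 : ∑' n : ℕ, vonMangoldt n / (n : ℝ) ^ z.re ≤ ∑' n : ℕ, vonMangoldt n / (n : ℝ) ^ (1 + η) := by
      refine Summable.tsum_le_tsum (fun n => ?_) (vonMangoldt_summable (by linarith)) (vonMangoldt_summable (by linarith))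
      rcases Nat.eq_zero_or_pos n with hn | hn
      · simp [hn]
      have hn1 : (1 : ℝ) ≤ n := by exact_mod_cast hn
      exact div_le_div_of_nonneg_left vonMangoldt_nonneg (by positivity)
        (Real.rpow_le_rpow_of_exponent_le hn1 hre)
    have h5 : 1 / η = T := by rw [hη, one_div_one_div]
    rw [h5] at h3
    exact h2.trans (h4.trans h3)
  have hmain := three_circles (fun z => deriv L z / L z) hF (T + K) (350000 * (2 * Real.log X)) η
    (by linarith) (by linarith) hη0 hη2 ha hb σ hσ1 hσ2
  refine hmain.trans ?_
  have h7 : (350000 * (2 * Real.log X)) ^ (600 * η) ≤ Real.exp (600 * (Real.log 700000 + 1)) := by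
    rw [show 350000 * (2 * Real.log X) = 700000 * Real.log X by ring,
      Real.rpow_def_of_pos (by linarith), Real.log_mul (by norm_num) (by linarith), ← hT]
    apply Real.exp_le_exp.mpr
    have h8 : 0 ≤ Real.log 700000 := Real.log_nonneg (by norm_num)
    nlinarith
  calc (T + K) * (350000 * (2 * Real.log X)) ^ (600 * η)
      ≤ ((2 + K) * T) * Real.exp (600 * (Real.log 700000 + 1)) := by
        refine mul_le_mul (by nlinarith) h7 (by positivity) (by positivity)
    _ = _ := by ring

lemma prime_char_sum : ∃ K : ℝ, 0 ≤ K ∧ ∀ (N : ℕ) [NeZero N] (χ : DirichletCharacter ℂ N) (X : ℝ),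
    χ ≠ 1 → 3 ≤ N → (N : ℝ) ≤ X → 14 ≤ X → 3 ≤ Real.log (Real.log X) →
    (∀ s : ℂ, 99 / 100 < s.re → |s.im| ≤ N → DirichletCharacter.LFunction χ s ≠ 0) →
    ‖∑ p ∈ (Finset.range (⌊X ^ ((1 : ℝ) / 4)⌋₊ + 1)).filter Nat.Prime, χ (p : ZMod N) / (p : ℂ) -
      ∑ p ∈ (Finset.range (⌊Real.log X⌋₊ + 1)).filter Nat.Prime, χ (p : ZMod N) / (p : ℂ)‖ ≤ K := by
  obtain ⟨B₀, hB0, hB⟩ := logDeriv_final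
  obtain ⟨K₁, hK₁0, hK₁⟩ := prime_sum_approx
  obtain ⟨K₂, hK₂0, hK₂⟩ := G_diff
  refine ⟨2 * K₁ + B₀ + K₂, by positivity, ?_⟩
  intro N _ χ X hχ hN hNX hX hLL h0
  have hX0 : 0 < X := by linarith
  set T := Real.log (Real.log X) with hT
  have hl0 : 1 ≤ Real.log X := by
    rw [Real.le_log_iff_exp_le hX0]
    linarith [Real.exp_one_lt_d9]
  have hexp : Real.exp T = Real.log X := Real.exp_log (by linarith)
  have h4T : 4 * T ≤ Real.log X := by
    have h1 : Real.exp T = Real.exp 1 * (Real.exp 1 * Real.exp 1) * Real.exp (T - 3) := by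
      rw [← Real.exp_add, ← Real.exp_add, ← Real.exp_add]; congr 1; ring
    have h2 := Real.add_one_le_exp (T - 3)
    have h3 : 12 ≤ Real.exp 1 * (Real.exp 1 * Real.exp 1) := by
      have := Real.exp_one_gt_d9
      have h4 : 6 ≤ Real.exp 1 * Real.exp 1 := by nlinarith
      nlinarith
    rw [← hexp, h1]
    nlinarith
  have hlz : Real.log (X ^ ((1 : ℝ) / 4)) = 1 / 4 * Real.log X := Real.log_rpow hX0 _
  have hz := hK₁ (fun n => χ (n : ZMod N)) (fun n => χ.norm_le_one _) (X ^ ((1 : ℝ) / 4)) (by positivity)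
    (by rw [hlz]; linarith)
  have hy := hK₁ (fun n => χ (n : ZMod N)) (fun n => χ.norm_le_one _) (Real.log X) (by linarith)
    (by rw [← hT]; linarith)
  have hG := hK₂ N χ (1 / Real.log (X ^ ((1 : ℝ) / 4))) (1 / T) (B₀ * T)
    (by rw [hlz]; positivity)
    (one_div_le_one_div_of_le (by linarith) (by rw [hlz]; linarith))
    (hB N χ X hχ hN hNX hX (by linarith) h0)
  rw [← hT] at hy
  have h5 : (B₀ * T + K₂) * (1 / T) ≤ B₀ + K₂ := by
    rw [mul_one_div, div_le_iff₀ (by linarith)]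
    nlinarith
  set A := ∑ p ∈ (Finset.range (⌊X ^ ((1 : ℝ) / 4)⌋₊ + 1)).filter Nat.Prime, χ (p : ZMod N) / (p : ℂ)
  set B := ∑ p ∈ (Finset.range (⌊Real.log X⌋₊ + 1)).filter Nat.Prime, χ (p : ZMod N) / (p : ℂ)
  set GA := LSeries (fun n : ℕ => if n.Prime then χ (n : ZMod N) else 0) ((1 + 1 / Real.log (X ^ ((1 : ℝ) / 4)) : ℝ) : ℂ)
  set GB := LSeries (fun n : ℕ => if n.Prime then χ (n : ZMod N) else 0) ((1 + 1 / T : ℝ) : ℂ)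
  have h6 : A - B = (A - GA) + (GA - GB) - (B - GB) := by ring
  rw [h6]
  have := norm_sub_le ((A - GA) + (GA - GB)) (B - GB)
  have := norm_add_le (A - GA) (GA - GB)
  linarith

lemma card_primeFactors_le (a : ℕ) (ha : 0 < a) : (a.primeFactors.card : ℝ) ≤ 2 * Real.log a := by
  have h1 : 2 ^ a.primeFactors.card ≤ a := by
    calc 2 ^ a.primeFactors.card ≤ ∏ p ∈ a.primeFactors, p := by
          refine Finset.pow_card_le_prod _ _ _ fun p hp => (Nat.prime_of_mem_primeFactors hp).two_le
      _ ≤ a := Nat.le_of_dvd ha (Nat.prod_primeFactors_dvd a)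
  have h2 : ((2 : ℝ) ^ a.primeFactors.card) ≤ a := by exact_mod_cast h1
  have h3 := Real.log_le_log (by positivity) h2
  rw [Real.log_pow] at h3
  have := Real.log_two_gt_d9
  nlinarith [Nat.cast_nonneg (α := ℝ) a.primeFactors.card]

lemma level_ge_three {n : ℕ} (hn : n ≠ 0) (χ : DirichletCharacter ℂ n) (h : χ (-1) = -1) : 3 ≤ n ∧ χ ≠ 1 := by
  have hne : ((1 : ℂ)) ≠ -1 := by norm_num
  constructor
  · by_contra hlt
    have h12 : n = 1 ∨ n = 2 := by omega
    have : (-1 : ZMod n) = 1 := by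
      rcases h12 with rfl | rfl <;> decide
    rw [this, map_one] at h
    exact hne h
  · rintro rfl
    rw [MulChar.one_apply (isUnit_one.neg)] at h
    exact hne h

lemma jacobi_bounds (b : ℤ) (p : ℕ) : (-1 : ℝ) ≤ (jacobiSym b p : ℝ) ∧ (jacobiSym b p : ℝ) ≤ 1 := by
  rcases jacobiSym.trichotomy b p with h | h | h <;> rw [h] <;> norm_num

lemma factor_bounds (b : ℤ) (p : ℕ) (hp : p.Prime) :
    0 ≤ 1 - (jacobiSym b p : ℝ) / p ∧ 1 - (jacobiSym b p : ℝ) / p ≤ 2 := by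
  have h1 := jacobi_bounds b p
  have hp1 : (1 : ℝ) ≤ p := by exact_mod_cast hp.one_le
  have hp0 : (0 : ℝ) < p := by linarith
  constructor
  · rw [sub_nonneg, div_le_one hp0]; linarith
  · have : -1 ≤ (jacobiSym b p : ℝ) / p := by rw [le_div_iff₀ hp0]; linarith
    linarith

/-- the lower bound for the prime sum -/
lemma psi_sum_lower : ∃ K : ℝ, 0 ≤ K ∧ ∀ (N : ℕ) [NeZero N] (χ : DirichletCharacter ℂ N) (X : ℝ),
    χ.IsPrimitive → χ ^ 2 = 1 → χ (-1) = -1 →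
    (N : ℝ) ≤ X → Real.exp (Real.exp 3) ≤ X →
    (∀ s : ℂ, 99 / 100 < s.re → |s.im| ≤ N → DirichletCharacter.LFunction χ s ≠ 0) →
    ∀ (b : ℤ) (a₂ : ℕ), 0 < a₂ → (a₂ : ℝ) ≤ X → b = -(N : ℤ) * (a₂ : ℤ) ^ 2 →
    -(Real.log (Real.log (Real.log X)) + K) ≤
    ∑ p ∈ (Finset.range (⌊X ^ ((1 : ℝ) / 4)⌋₊ + 1)).filter Nat.Prime, (jacobiSym b p : ℝ) / p := by
  obtain ⟨K₁, hK₁0, hK₁⟩ := prime_char_sum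
  obtain ⟨K₂, hK₂0, hK₂⟩ := prime_recip_bound
  refine ⟨K₁ + K₂ + 2, by positivity, ?_⟩
  intro N _ χ X hprim hsq hodd hNX hX h0 b a₂ ha₂ ha₂X hb
  obtain ⟨hN3, hχ1⟩ := level_ge_three (NeZero.ne N) χ hodd
  have he3 : (12 : ℝ) < Real.exp 3 := by
    have h1 : Real.exp 3 = Real.exp 1 * (Real.exp 1 * Real.exp 1) := by
      rw [← Real.exp_add, ← Real.exp_add]; congr 1; ring
    have := Real.exp_one_gt_d9
    have h4 : 6 ≤ Real.exp 1 * Real.exp 1 := by nlinarith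
    rw [h1]
    nlinarith
  have hX14 : 14 ≤ X := by
    have := Real.add_one_le_exp (Real.exp 3)
    have h2 : 14 ≤ Real.exp (Real.exp 3) := by
      have := Real.quadratic_le_exp_of_nonneg (x := Real.exp 3) (by positivity)
      nlinarith
    linarith
  have hX0 : 0 < X := by linarith
  have hl : Real.exp 3 ≤ Real.log X := (Real.le_log_iff_exp_le hX0).mpr hX
  have hl0 : 0 < Real.log X := by linarith
  have hll : 3 ≤ Real.log (Real.log X) := (Real.le_log_iff_exp_le hl0).mpr hl
  have hchar := hK₁ N χ X hχ1 hN3 hNX hX14 hll h0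
  have hrec := hK₂ (Real.log X) hl0 (by linarith)
  have hyz : Real.log X ≤ X ^ ((1 : ℝ) / 4) := by
    set T := Real.log (Real.log X) with hT
    have hexp : Real.exp T = Real.log X := Real.exp_log hl0
    have h1 : Real.exp T = Real.exp 3 * Real.exp (T - 3) := by
      rw [← Real.exp_add]; congr 1; ring
    have h2 := Real.add_one_le_exp (T - 3)
    have h4T : 4 * T ≤ Real.log X := by
      rw [← hexp, h1]; nlinarith
    rw [← hexp, Real.rpow_def_of_pos hX0]
    apply Real.exp_le_exp.mpr
    linarith
  set Z := (Finset.range (⌊X ^ ((1 : ℝ) / 4)⌋₊ + 1)).filter Nat.Prime with hZ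
  set Y := (Finset.range (⌊Real.log X⌋₊ + 1)).filter Nat.Prime with hY
  have hYZ : Y ⊆ Z := by
    apply Finset.filter_subset_filter
    rw [Finset.range_subset_range]
    have := Nat.floor_mono hyz
    omega
  rw [← Finset.sum_sdiff hYZ] at hchar ⊢
  rw [add_sub_cancel_right] at hchar
  have hYlow : -(∑ p ∈ Y, 1 / (p : ℝ)) ≤ ∑ p ∈ Y, (jacobiSym b p : ℝ) / p := by
    rw [← Finset.sum_neg_distrib]
    refine Finset.sum_le_sum fun p _ => ?_
    rw [← neg_div]
    exact div_le_div_of_nonneg_right (jacobi_bounds b p).1 (Nat.cast_nonneg _)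
  have hre : -K₁ ≤ ∑ p ∈ Z \ Y, (χ (p : ZMod N) / (p : ℂ)).re := by
    rw [← Complex.re_sum]
    have := (abs_le.mp ((Complex.abs_re_le_norm _).trans hchar)).1
    exact this
  have hmem : ∀ p ∈ Z \ Y, p.Prime ∧ Real.log X < p := by
    intro p hp
    rw [Finset.mem_sdiff] at hp
    have hpp := (Finset.mem_filter.mp hp.1).2
    refine ⟨hpp, ?_⟩
    by_contra h
    push Not at h
    apply hp.2
    refine Finset.mem_filter.mpr ⟨Finset.mem_range.mpr ?_, hpp⟩
    have := Nat.le_floor h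
    omega
  have hterm : ∀ p ∈ Z \ Y, (χ (p : ZMod N) / (p : ℂ)).re - (if p ∈ a₂.primeFactors then 1 / Real.log X else 0) ≤
      (jacobiSym b p : ℝ) / p := by
    intro p hp
    obtain ⟨hpp, hpl⟩ := hmem p hp
    have hp2 : p ≠ 2 := by
      rintro rfl
      norm_num at hpl
      linarith
    have hp0 : (0 : ℝ) < p := by linarith
    have hpne : NeZero p := ⟨hpp.ne_zero⟩
    have hχp := chi_eq_jacobi χ hprim hsq (-1) (by rw [hodd]; norm_num) p hpp hp2
    have hcre : (χ (p : ZMod N) / (p : ℂ)).re = (jacobiSym (-1 * (N : ℤ)) p : ℝ) / p := by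
      rw [hχp, ← Complex.ofReal_intCast, ← Complex.ofReal_natCast, ← Complex.ofReal_div, Complex.ofReal_re]
    have hbj : jacobiSym b p = jacobiSym (-1 * (N : ℤ)) p * jacobiSym (a₂ : ℤ) p ^ 2 := by
      rw [hb, jacobiSym.mul_left, jacobiSym.pow_left, neg_one_mul]
    rw [hcre]
    by_cases hd : p ∣ a₂
    · rw [if_pos (Nat.mem_primeFactors.mpr ⟨hpp, hd, ha₂.ne'⟩)]
      have hz : jacobiSym (a₂ : ℤ) p = 0 := by
        rw [jacobiSym.eq_zero_iff_not_coprime, Int.gcd_natCast_natCast, Nat.gcd_eq_right hd]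
        exact hpp.one_lt.ne'
      rw [hbj, hz]
      simp only [ne_eq, OfNat.ofNat_ne_zero, not_false_eq_true, zero_pow, mul_zero, Int.cast_zero, zero_div,
        sub_nonpos]
      exact div_le_div₀ zero_le_one (jacobi_bounds _ p).2 hl0 hpl.le
    · rw [if_neg (fun h => hd (Nat.dvd_of_mem_primeFactors h))]
      have hz : jacobiSym (a₂ : ℤ) p ^ 2 = 1 := by
        apply jacobiSym.sq_one
        rw [Int.gcd_natCast_natCast]
        exact ((Nat.Prime.coprime_iff_not_dvd hpp).mpr hd).symm
      rw [hbj, hz, mul_one, sub_zero]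
  have hcount : ∑ p ∈ Z \ Y, (if p ∈ a₂.primeFactors then 1 / Real.log X else 0) ≤ 2 := by
    rw [← Finset.sum_filter, Finset.sum_const, nsmul_eq_mul]
    have h1 : (((Z \ Y).filter (· ∈ a₂.primeFactors)).card : ℝ) ≤ a₂.primeFactors.card := by
      exact_mod_cast Finset.card_le_card (fun p hp => (Finset.mem_filter.mp hp).2)
    have h2 := card_primeFactors_le a₂ ha₂
    have h3 : Real.log a₂ ≤ Real.log X := Real.log_le_log (by exact_mod_cast ha₂) ha₂X
    rw [mul_one_div, div_le_iff₀ hl0]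
    linarith
  have hsum := Finset.sum_le_sum hterm
  rw [Finset.sum_sub_distrib] at hsum
  linarith

open Finset in
/-- If `d` is a "good" fundamental discriminant, i.e. the quadratic character
`χ_d` (the real primitive Dirichlet character modulo `|d|` with sign `χ_d(-1) =
sign d`) has `L(s, χ_d) ≠ 0` in the region `{Re s > 99/100, |Im s| ≤ |d|}`,
then for any `1 ≤ a ≤ X` with `-4a = d·a₂²` (with `a₂ ≤ √X` a positive integer)
one has `∏_{p ≤ X^{1/4}} (1 - χ_{-4a}(p)/p) ≪ log log X`, with an absolute
implied constant. -/
theorem stmt6 :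
    ∃ C > 0, ∀ X : ℝ, 3 ≤ X → ∀ d : ℤ, ∀ hd0 : d ≠ 0, IsFundamentalDiscriminant d →
      |(d : ℝ)| ≤ X →
      ∀ χ : DirichletCharacter ℂ d.natAbs, χ.IsPrimitive → χ ^ 2 = 1 →
      χ (-1) = (if d < 0 then -1 else 1) →
      (∀ s : ℂ, 99 / 100 < s.re → |s.im| ≤ |(d : ℝ)| →
        @DirichletCharacter.LFunction d.natAbs ⟨Int.natAbs_ne_zero.mpr hd0⟩ χ s ≠ 0) →
      ∀ a a₂ : ℕ, 1 ≤ a → (a : ℝ) ≤ X → 0 < a₂ → (a₂ : ℝ) ≤ Real.sqrt X →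
      -4 * (a : ℤ) = d * (a₂ : ℤ) ^ 2 →
      ∏ p ∈ (range (⌊X⌋₊ + 1)).filter
          (fun p : ℕ => p.Prime ∧ (p : ℝ) ≤ X ^ ((1 : ℝ) / 4)),
        (1 - (jacobiSym (-4 * (a : ℤ)) p : ℝ) / p) ≤
        C * Real.log (Real.log X) := by
  obtain ⟨K, hK0, hK⟩ := psi_sum_lower
  have hl3 : 1 < Real.log 3 := by
    rw [Real.lt_log_iff_exp_lt (by norm_num)]
    linarith [Real.exp_one_lt_d9]
  have hll3 : 0 < Real.log (Real.log 3) := Real.log_pos hl3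
  set P : ℝ := 2 ^ (⌊Real.exp (Real.exp 3)⌋₊ + 1) with hP
  have hP0 : 0 < P := by positivity
  refine ⟨P / Real.log (Real.log 3) + Real.exp K, by positivity, ?_⟩
  intro X hX d hd0 _ hdX χ hprim hsq hodd hL a a₂ ha haX ha₂ ha₂X heq
  have hX0 : 0 < X := by linarith
  have hlX : Real.log 3 ≤ Real.log X := Real.log_le_log (by norm_num) hX
  have hllX : Real.log (Real.log 3) ≤ Real.log (Real.log X) := Real.log_le_log (by linarith) hlX
  set S := (range (⌊X⌋₊ + 1)).filter (fun p : ℕ => p.Prime ∧ (p : ℝ) ≤ X ^ ((1 : ℝ) / 4)) with hS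
  have hSp : ∀ p ∈ S, p.Prime := fun p hp => (Finset.mem_filter.mp hp).2.1
  rcases lt_or_ge X (Real.exp (Real.exp 3)) with hsmall | hlarge
  · have h1 : ∏ p ∈ S, (1 - (jacobiSym (-4 * (a : ℤ)) p : ℝ) / p) ≤ P := by
      calc ∏ p ∈ S, (1 - (jacobiSym (-4 * (a : ℤ)) p : ℝ) / p) ≤ ∏ p ∈ S, (2 : ℝ) :=
            Finset.prod_le_prod (fun p hp => (factor_bounds _ p (hSp p hp)).1)
              (fun p hp => (factor_bounds _ p (hSp p hp)).2)
        _ = 2 ^ S.card := by rw [Finset.prod_const]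
        _ ≤ P := by
          refine pow_le_pow_right₀ (by norm_num) ?_
          calc S.card ≤ (range (⌊X⌋₊ + 1)).card := Finset.card_filter_le _ _
            _ = ⌊X⌋₊ + 1 := Finset.card_range _
            _ ≤ _ := by
              have := Nat.floor_mono hsmall.le
              omega
    have h2 : P ≤ P / Real.log (Real.log 3) * Real.log (Real.log X) := by
      rw [div_mul_eq_mul_div, le_div_iff₀ hll3]
      exact mul_le_mul_of_nonneg_left hllX hP0.le
    have h3 : 0 ≤ Real.exp K * Real.log (Real.log X) := by
      have := Real.exp_pos K
      nlinarith
    linarith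
  · have hneg : d < 0 := by
      have h1 : 0 < (a₂ : ℤ) ^ 2 := by positivity
      by_contra h
      push Not at h
      have : 0 ≤ d * (a₂ : ℤ) ^ 2 := by positivity
      omega
    have : NeZero d.natAbs := ⟨Int.natAbs_ne_zero.mpr hd0⟩
    rw [if_pos hneg] at hodd
    have habs : ((d.natAbs : ℕ) : ℝ) = |(d : ℝ)| := by
      rw [Nat.cast_natAbs, Int.cast_abs]
    have hdN : d = -((d.natAbs : ℕ) : ℤ) := by omega
    have hsqrt : Real.sqrt X ≤ X := by
      rw [Real.sqrt_le_left hX0.le]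
      nlinarith
    have hlow := hK d.natAbs χ X hprim hsq hodd (by rw [habs]; exact hdX) hlarge
      (fun s h1 h2 => hL s h1 (by rw [← habs]; exact h2)) (-4 * (a : ℤ)) a₂ ha₂ (ha₂X.trans hsqrt)
      (by rw [heq, ← hdN])
    have hSeq : S = (Finset.range (⌊X ^ ((1 : ℝ) / 4)⌋₊ + 1)).filter Nat.Prime := by
      have hzX : X ^ ((1 : ℝ) / 4) ≤ X := by
        calc X ^ ((1 : ℝ) / 4) ≤ X ^ (1 : ℝ) :=
              Real.rpow_le_rpow_of_exponent_le (by linarith) (by norm_num)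
          _ = X := Real.rpow_one X
      ext p
      simp only [hS, Finset.mem_filter, Finset.mem_range]
      constructor
      · rintro ⟨-, hp, hpz⟩
        refine ⟨?_, hp⟩
        have := Nat.le_floor hpz
        omega
      · rintro ⟨hlt, hp⟩
        have hpz : (p : ℝ) ≤ X ^ ((1 : ℝ) / 4) := (Nat.le_floor_iff' hp.ne_zero).mp (by omega)
        refine ⟨?_, hp, hpz⟩
        have := Nat.le_floor (hpz.trans hzX)
        omega
    rw [← hSeq] at hlow
    have hT0 : 0 < Real.log (Real.log X) := by linarith
    have h1 : ∏ p ∈ S, (1 - (jacobiSym (-4 * (a : ℤ)) p : ℝ) / p) ≤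
        Real.log (Real.log X) * Real.exp K := by
      calc ∏ p ∈ S, (1 - (jacobiSym (-4 * (a : ℤ)) p : ℝ) / p)
          ≤ ∏ p ∈ S, Real.exp (-((jacobiSym (-4 * (a : ℤ)) p : ℝ) / p)) :=
            Finset.prod_le_prod (fun p hp => (factor_bounds _ p (hSp p hp)).1)
              (fun p hp => Real.one_sub_le_exp_neg _)
        _ = Real.exp (-∑ p ∈ S, (jacobiSym (-4 * (a : ℤ)) p : ℝ) / p) := by
            rw [← Real.exp_sum, Finset.sum_neg_distrib]
        _ ≤ Real.exp (Real.log (Real.log (Real.log X)) + K) := Real.exp_le_exp.mpr (by linarith)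
        _ = _ := by rw [Real.exp_add, Real.exp_log hT0]
    have h2 : 0 ≤ P / Real.log (Real.log 3) * Real.log (Real.log X) := by positivity
    linarith
end

section
/- For a primitive real Dirichlet character χ modulo q ≤ X, one has ∑_{p ≤ X^{1/4}} χ(p)/p = log L(1 + 1/log X, χ) + O(1), where the sum is over primes and the implied constant is absolute. -/
open ArithmeticFunction vonMangoldt in
lemma mangoldt_bound : ∃ C > 0, ∀ x : ℝ, 1 < x → x ≤ 2 →
    Summable (fun n : ℕ => vonMangoldt n / (n : ℝ) ^ x) ∧
    ∑' n : ℕ, vonMangoldt n / (n : ℝ) ^ x ≤ C / (x - 1) := by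
  have hres (n : ℕ) : residueClass (1 : ZMod 1) n = vonMangoldt n := by
    simp [residueClass, Set.indicator_apply, Subsingleton.elim (n : ZMod 1) 1]
  have hs {x : ℝ} (hx : 1 < x) : Summable (fun n : ℕ => vonMangoldt n / (n : ℝ) ^ x) := by
    have := LSeriesSummable_vonMangoldt (s := (x : ℂ)) (by simpa using hx)
    have h2 := this.norm
    refine h2.congr fun n => ?_
    rw [LSeries.norm_term_eq]
    split_ifs with h
    · simp [h]
    · simp [abs_of_nonneg vonMangoldt_nonneg]
  have H {x : ℝ} (hx : 1 < x) :
      ∑' n : ℕ, vonMangoldt n / (n : ℝ) ^ x =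
        (LFunctionResidueClassAux (1 : ZMod 1) x).re + 1 / (x - 1) := by
    have h := LFunctionResidueClassAux_real (a := (1 : ZMod 1)) isUnit_one hx
    have h2 := eqOn_LFunctionResidueClassAux (a := (1 : ZMod 1)) isUnit_one
      (x := (x : ℂ)) (by simpa using hx)
    have h3 : LSeries (fun n => ((residueClass (1 : ZMod 1) n : ℝ) : ℂ)) (x : ℂ)
        = ((∑' n : ℕ, vonMangoldt n / (n : ℝ) ^ x : ℝ) : ℂ) := by
      rw [LSeries, Complex.ofReal_tsum]
      refine tsum_congr fun n => ?_
      rw [LSeries.term_def, hres]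
      split_ifs with h0
      · simp [h0]
      · push_cast
        rw [Complex.ofReal_cpow (by positivity)]
        simp
    simp only [h3] at h2
    have h4 := congrArg Complex.re h2
    have h5 : (((Nat.totient 1 : ℕ) : ℂ)⁻¹ / ((x : ℂ) - 1)) = ((1 / (x - 1) : ℝ) : ℂ) := by simp
    rw [h5, ← Complex.ofReal_sub, Complex.ofReal_re] at h4
    linarith
  have hc : ContinuousOn (fun x : ℝ => (LFunctionResidueClassAux (1 : ZMod 1) (x : ℂ)).re)
      (Set.Icc 1 2) := by
    refine Complex.continuous_re.comp_continuousOn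
      ((continuousOn_LFunctionResidueClassAux (1 : ZMod 1)).comp
        Complex.continuous_ofReal.continuousOn ?_)
    intro x hx
    simpa using hx.1
  obtain ⟨B, hB⟩ := isCompact_Icc.exists_bound_of_continuousOn hc
  refine ⟨|B| + 1, by positivity, fun x h1 h2 => ⟨hs h1, ?_⟩⟩
  rw [H h1]
  have := (le_abs_self _).trans (hB x ⟨h1.le, h2⟩)
  have h3 : |B| ≤ |B| / (x - 1) := by
    rw [le_div_iff₀ (by linarith)]
    nlinarith [abs_nonneg B]
  rw [add_div]
  linarith [le_abs_self B]

/-- termwise estimate -/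
lemma term_bound (X : ℝ) (hX : 3 ≤ X) (c : ℝ) (hc : |c| ≤ 1) (p : ℕ) (hp : p.Prime) :
    |(if (p : ℝ) ≤ X ^ ((1 : ℝ) / 4) then c / p else 0) +
      Real.log (1 - c * (p : ℝ) ^ (-(1 + 1 / Real.log X)))| ≤
      4 * (1 / Real.log X) * (Real.log p / (p : ℝ) ^ (1 + 1 / Real.log X))
       + 2 * (1 / (p : ℝ) ^ 2) := by
  have hlX : 1 < Real.log X := by
    rw [Real.lt_log_iff_exp_lt (by linarith)]
    linarith [Real.exp_one_lt_d9]
  set ε := 1 / Real.log X with hε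
  have hε0 : 0 < ε := by positivity
  have hεX : ε * Real.log X = 1 := by rw [hε]; field_simp
  have hp2 : (2 : ℝ) ≤ p := by exact_mod_cast hp.two_le
  have hp0 : (0 : ℝ) < p := by linarith
  have hlp : 0 < Real.log p := Real.log_pos (by linarith)
  set P := (p : ℝ) ^ (-(1 + ε)) with hP
  have hP0 : 0 < P := by positivity
  have hPle : P ≤ (p : ℝ)⁻¹ := by
    rw [hP, ← Real.rpow_neg_one]
    exact Real.rpow_le_rpow_of_exponent_le (by linarith) (by linarith)
  have hPinv : (p : ℝ)⁻¹ ≤ 1 / 2 := by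
    rw [inv_le_comm₀ hp0 (by norm_num)]; linarith
  have hdiv : Real.log p / (p : ℝ) ^ (1 + ε) = Real.log p * P := by
    rw [hP, Real.rpow_neg hp0.le, div_eq_mul_inv]
  have hcP : |c * P| ≤ P := by
    rw [abs_mul, abs_of_pos hP0]; nlinarith
  have hlog := Real.abs_log_sub_add_sum_range_le (x := c * P) (by linarith) 1
  have h2 : |c * P + Real.log (1 - c * P)| ≤ 2 * (1 / (p : ℝ) ^ 2) := by
    simp only [Finset.sum_range_one] at hlog
    norm_num at hlog
    refine hlog.trans ?_
    rw [div_le_iff₀ (by rw [← abs_mul]; linarith), ← abs_mul]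
    have : |c * P| ^ 2 ≤ (p : ℝ)⁻¹ ^ 2 := by
      apply pow_le_pow_left₀ (abs_nonneg _); linarith
    rw [one_div, ← inv_pow]
    nlinarith [sq_nonneg ((p : ℝ)⁻¹)]
  have h1 : |(if (p : ℝ) ≤ X ^ ((1 : ℝ) / 4) then c / p else 0) - c * P| ≤
      4 * ε * (Real.log p * P) := by
    have hXl : Real.log (X ^ ((1 : ℝ) / 4)) = 1 / 4 * Real.log X :=
      Real.log_rpow (by linarith) _
    have hXp : 0 < X ^ ((1 : ℝ) / 4) := by positivity
    split_ifs with h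
    · have hl : Real.log p ≤ 1 / 4 * Real.log X := by
        rw [← hXl]; exact Real.log_le_log hp0 h
      have hu : ε * Real.log p ≤ 1 / 4 := by nlinarith
      have e1 : (p : ℝ)⁻¹ = Real.exp (ε * Real.log p) * P := by
        rw [hP, ← Real.rpow_neg_one, Real.rpow_def_of_pos hp0, Real.rpow_def_of_pos hp0,
          ← Real.exp_add]
        congr 1; ring
      have hu0 : 0 < ε * Real.log p := by positivity
      have e2 : Real.exp (ε * Real.log p) - 1 ≤ 4 * (ε * Real.log p) := by
        have := Real.abs_exp_sub_one_le (x := ε * Real.log p) (by rw [abs_of_pos hu0]; linarith)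
        rw [abs_of_pos hu0] at this
        linarith [le_abs_self (Real.exp (ε * Real.log p) - 1)]
      have e3 : c / p - c * P = c * ((Real.exp (ε * Real.log p) - 1) * P) := by
        rw [div_eq_mul_inv, e1]; ring
      have e4 : 0 ≤ Real.exp (ε * Real.log p) - 1 := by
        linarith [Real.add_one_le_exp (ε * Real.log p)]
      rw [e3, abs_mul, abs_of_nonneg (mul_nonneg e4 hP0.le)]
      calc _ ≤ 1 * ((Real.exp (ε * Real.log p) - 1) * P) := by gcongr
        _ ≤ 4 * (ε * Real.log p) * P := by rw [one_mul]; gcongr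
        _ = _ := by ring
    · push Not at h
      have hl : 1 / 4 * Real.log X ≤ Real.log p := by
        rw [← hXl]; exact Real.log_le_log hXp h.le
      have hu : 1 ≤ 4 * (ε * Real.log p) := by nlinarith
      rw [zero_sub, abs_neg]
      nlinarith
  rw [hdiv]
  calc _ = |((if (p : ℝ) ≤ X ^ ((1 : ℝ) / 4) then c / p else 0) - c * P) +
        (c * P + Real.log (1 - c * P))| := by ring_nf
    _ ≤ _ := (abs_add_le _ _).trans (add_le_add h1 h2)

lemma logL (q : ℕ) [NeZero q] (χ : DirichletCharacter ℂ q) (hχ : ∀ n : ZMod q, (χ n).im = 0)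
    (s : ℝ) (hs : 1 < s) :
    HasSum (fun p : Nat.Primes => - Real.log (1 - (χ ((p : ℕ) : ZMod q)).re * ((p : ℕ) : ℝ) ^ (-s)))
      (Real.log (χ.LFunction (s : ℂ)).re) := by
  have hs' : 1 < (s : ℂ).re := by simpa using hs
  have hsum := DirichletCharacter.summable_neg_log_one_sub_mul_prime_cpow χ hs'
  have hE := DirichletCharacter.LSeries_eulerProduct_exp_log χ hs'
  have hterm (p : Nat.Primes) : -Complex.log (1 - χ ((p : ℕ) : ZMod q) * ((p : ℕ) : ℂ) ^ (-(s : ℂ)))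
      = ((- Real.log (1 - (χ ((p : ℕ) : ZMod q)).re * ((p : ℕ) : ℝ) ^ (-s)) : ℝ) : ℂ) := by
    have hc : χ ((p : ℕ) : ZMod q) = ((χ ((p : ℕ) : ZMod q)).re : ℂ) := by
      apply Complex.ext <;> simp [hχ]
    have hc1 : |(χ ((p : ℕ) : ZMod q)).re| ≤ 1 :=
      (Complex.abs_re_le_norm _).trans (DirichletCharacter.norm_le_one χ _)
    have hp2 : (1 : ℝ) < (p : ℕ) := by exact_mod_cast p.2.one_lt
    have hP : ((p : ℕ) : ℝ) ^ (-s) < 1 :=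
      Real.rpow_lt_one_of_one_lt_of_neg hp2 (by linarith)
    have hP0 : 0 < ((p : ℕ) : ℝ) ^ (-s) := by positivity
    rw [Complex.ofReal_neg, Complex.ofReal_log (by nlinarith [abs_le.mp hc1])]
    rw [hc]
    push_cast
    rw [Complex.ofReal_cpow (by positivity)]
    simp
  simp only [hterm] at hsum hE
  have hsr := Complex.summable_ofReal.mp hsum
  rw [DirichletCharacter.LFunction_eq_LSeries χ hs', ← hE, ← Complex.ofReal_tsum,
    ← Complex.ofReal_exp, Complex.ofReal_re, Real.log_exp]
  exact hsr.hasSum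

open Finset in
/-- For a primitive real Dirichlet character `χ` modulo `q ≤ X`,
`∑_{p ≤ X^{1/4}} χ(p)/p = log L(1 + 1/log X, χ) + O(1)`, where the sum is over
primes and the implied constant is absolute. -/
theorem stmt7 :
    ∃ C > 0, ∀ X : ℝ, 3 ≤ X → ∀ q : ℕ, ∀ hq : 0 < q, (q : ℝ) ≤ X →
      ∀ χ : DirichletCharacter ℂ q, χ.IsPrimitive → (∀ n : ZMod q, (χ n).im = 0) →
      |(∑ p ∈ (range (⌊X⌋₊ + 1)).filter
            (fun p : ℕ => p.Prime ∧ (p : ℝ) ≤ X ^ ((1 : ℝ) / 4)),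
          (χ (p : ZMod q)).re / p) -
        Real.log ((@DirichletCharacter.LFunction q ⟨hq.ne'⟩ χ
          (1 + 1 / Real.log X)).re)| ≤ C := by
  obtain ⟨C, hC, hM⟩ := mangoldt_bound
  have hsq : Summable (fun n : ℕ => 1 / (n : ℝ) ^ 2) :=
    Real.summable_one_div_nat_pow.mpr (by norm_num)
  have hsq0 : 0 ≤ ∑' n : ℕ, 1 / (n : ℝ) ^ 2 := tsum_nonneg fun n => by positivity
  refine ⟨4 * C + 2 * ∑' n : ℕ, 1 / (n : ℝ) ^ 2, by positivity, ?_⟩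
  intro X hX q hq _ χ _ hχ
  haveI : NeZero q := ⟨hq.ne'⟩
  have hlX : 1 < Real.log X := by
    rw [Real.lt_log_iff_exp_lt (by linarith)]
    linarith [Real.exp_one_lt_d9]
  have hε0 : 0 < 1 / Real.log X := by positivity
  have hε1 : 1 / Real.log X ≤ 1 := by rw [div_le_one (by linarith)]; exact hlX.le
  have hL := logL q χ hχ (1 + 1 / Real.log X) (by linarith)
  obtain ⟨hMs, hMb⟩ := hM (1 + 1 / Real.log X) (by linarith) (by linarith)
  rw [add_sub_cancel_left] at hMb
  have hF : HasSum (fun p : Nat.Primes => if ((p : ℕ) : ℝ) ≤ X ^ ((1 : ℝ) / 4) then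
      (χ ((p : ℕ) : ZMod q)).re / ((p : ℕ) : ℝ) else 0)
      (∑ p ∈ (range (⌊X⌋₊ + 1)).filter
            (fun p : ℕ => p.Prime ∧ (p : ℝ) ≤ X ^ ((1 : ℝ) / 4)),
          (χ (p : ZMod q)).re / p) := by
    have h1 : HasSum (fun p : ℕ => if p.Prime ∧ (p : ℝ) ≤ X ^ ((1 : ℝ) / 4) then
        (χ (p : ZMod q)).re / (p : ℝ) else 0) (∑ p ∈ (range (⌊X⌋₊ + 1)).filter
            (fun p : ℕ => p.Prime ∧ (p : ℝ) ≤ X ^ ((1 : ℝ) / 4)),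
          (χ (p : ZMod q)).re / p) := by
      rw [Finset.sum_filter]
      apply hasSum_sum_of_ne_finset_zero
      intro p hp
      rw [if_neg]
      rintro ⟨_, h⟩
      apply hp
      rw [Finset.mem_range, Nat.lt_succ_iff]
      apply Nat.le_floor
      refine h.trans ?_
      calc X ^ ((1 : ℝ) / 4) ≤ X ^ (1 : ℝ) :=
            Real.rpow_le_rpow_of_exponent_le (by linarith) (by norm_num)
        _ = X := Real.rpow_one X
    rw [← hasSum_subtype_iff_of_support_subset (s := {p : ℕ | p.Prime})] at h1
    · have he : (fun p : Nat.Primes => if ((p : ℕ) : ℝ) ≤ X ^ ((1 : ℝ) / 4) then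
          (χ ((p : ℕ) : ZMod q)).re / ((p : ℕ) : ℝ) else 0) =
          (fun p : ℕ => if p.Prime ∧ (p : ℝ) ≤ X ^ ((1 : ℝ) / 4) then
          (χ (p : ZMod q)).re / (p : ℝ) else 0) ∘ (fun p : Nat.Primes => (p : ℕ)) := by
        funext p
        simp [p.2]
      rw [he]
      exact h1
    · intro p hp
      by_contra h
      apply hp
      have : ¬ p.Prime := h
      simp [this]
  have hD := hF.sub hL
  have hinj : Function.Injective (fun p : Nat.Primes => (p : ℕ)) := Subtype.val_injective
  have hG1 : HasSum (fun p : Nat.Primes => Real.log (p : ℕ) / ((p : ℕ) : ℝ) ^ (1 + 1 / Real.log X))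
      (∑' p : Nat.Primes, Real.log (p : ℕ) / ((p : ℕ) : ℝ) ^ (1 + 1 / Real.log X)) := by
    apply Summable.hasSum
    refine (hMs.comp_injective hinj).congr fun p => ?_
    simp [ArithmeticFunction.vonMangoldt_apply_prime p.2]
  have hG1b : ∑' p : Nat.Primes, Real.log (p : ℕ) / ((p : ℕ) : ℝ) ^ (1 + 1 / Real.log X)
      ≤ C / (1 / Real.log X) := by
    refine le_trans ?_ hMb
    refine Summable.tsum_le_tsum_of_inj (fun p : Nat.Primes => (p : ℕ)) hinj ?_ ?_ hG1.summable hMs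
    · intro n _
      exact div_nonneg ArithmeticFunction.vonMangoldt_nonneg (by positivity)
    · intro p
      simp [ArithmeticFunction.vonMangoldt_apply_prime p.2]
  have hG2 : HasSum (fun p : Nat.Primes => 1 / ((p : ℕ) : ℝ) ^ 2)
      (∑' p : Nat.Primes, 1 / ((p : ℕ) : ℝ) ^ 2) := (hsq.comp_injective hinj).hasSum
  have hG2b : ∑' p : Nat.Primes, 1 / ((p : ℕ) : ℝ) ^ 2 ≤ ∑' n : ℕ, 1 / (n : ℝ) ^ 2 :=
    Summable.tsum_le_tsum_of_inj (fun p : Nat.Primes => (p : ℕ)) hinj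
      (fun n _ => by positivity) (fun p => le_rfl) hG2.summable hsq
  have hG := (hG1.mul_left (4 * (1 / Real.log X))).add (hG2.mul_left 2)
  have hterm (p : Nat.Primes) := term_bound X hX (χ ((p : ℕ) : ZMod q)).re
    ((Complex.abs_re_le_norm _).trans (DirichletCharacter.norm_le_one χ _)) p p.2
  have hup := hasSum_le (fun p => by
    have := (abs_le.mp (hterm p)).2
    rw [sub_neg_eq_add]; exact this) hD hG
  have hlo := hasSum_le (fun p => by
    have := (abs_le.mp (hterm p)).1
    rw [sub_neg_eq_add]; exact this) hG.neg hD
  have hcast : ((1 + 1 / Real.log X : ℝ) : ℂ) = 1 + 1 / (Real.log X : ℂ) := by push_cast; rfl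
  rw [hcast] at hup hlo
  have hfin : 4 * (1 / Real.log X) * (∑' p : Nat.Primes, Real.log (p : ℕ) /
      ((p : ℕ) : ℝ) ^ (1 + 1 / Real.log X)) ≤ 4 * C := by
    calc _ ≤ 4 * (1 / Real.log X) * (C / (1 / Real.log X)) := by gcongr
      _ = 4 * C := by field_simp
  rw [abs_le]
  constructor <;> linarith
end
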